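/- For every n≥3 and every θ∈ℝ^n, the closed interval [1/n, 1/n + (n+1)/(n(2n−1)(n²+n+1))] is contained in Spec^θ(λ_n), i.e., for every λ in this interval there exists x∈ℝ with λ_n^θ(x) = λ. -/

import Mathlib

open MeasureTheory Filter Set
open scoped ENNReal NNReal

noncomputable section

/-- The set `S_n^θ(ψ)` of `(ψ,θ)`-approximable points of `ℝ^n` (sup norm on `Fin n → ℝ`):
points `x` with `‖x - (p+θ)/q‖ ≤ ψ q / q` for infinitely many `(p,q) ∈ ℤ^n × ℕ`. -/
def SApprox (n : ℕ) (θ : Fin n → ℝ) (ψ : ℝ → ℝ) : Set (Fin n → ℝ) :=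
  {x | {pq : (Fin n → ℤ) × ℕ | 0 < pq.2 ∧
    ‖(fun i => x i - ((pq.1 i : ℝ) + θ i) / (pq.2 : ℝ) : Fin n → ℝ)‖ ≤
      ψ (pq.2 : ℝ) / (pq.2 : ℝ)}.Infinite}

/-- Iterated partial derivatives along a list of coordinate directions. -/
def listPDeriv {d n : ℕ} : List (Fin d) → ((Fin d → ℝ) → (Fin n → ℝ)) → ((Fin d → ℝ) → (Fin n → ℝ))
  | [], f => f
  | i :: is, f => fun x => fderiv ℝ (listPDeriv is f) x (Pi.single i 1)

/-- `f` is `l`-nondegenerate at `x`: `f` is `C^l` near `x` and the partial derivatives of `f`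
at `x` of orders `1,…,l` span `ℝ^n`. -/
def IsLNondegenerateAt {d n : ℕ} (l : ℕ) (f : (Fin d → ℝ) → (Fin n → ℝ)) (x : Fin d → ℝ) : Prop :=
  (∃ V ∈ nhds x, ContDiffOn ℝ l f V) ∧
  Submodule.span ℝ {v : Fin n → ℝ | ∃ β : List (Fin d),
    1 ≤ β.length ∧ β.length ≤ l ∧ v = listPDeriv β f x} = ⊤

def IsNondegenerateAt {d n : ℕ} (f : (Fin d → ℝ) → (Fin n → ℝ)) (x : Fin d → ℝ) : Prop :=
  ∃ l : ℕ, IsLNondegenerateAt l f x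

/-- `f` is nondegenerate in `U`: nondegenerate at almost every point of `U`. -/
def IsNondegenerateIn {d n : ℕ} (f : (Fin d → ℝ) → (Fin n → ℝ)) (U : Set (Fin d → ℝ)) : Prop :=
  ∀ᵐ x ∂(volume : Measure (Fin d → ℝ)), x ∈ U → IsNondegenerateAt f x

/-- `f` is nonsingular on `U`: its Jacobian has rank `d` at every point of `U`. -/
def IsNonsingularOn {d n : ℕ} (f : (Fin d → ℝ) → (Fin n → ℝ)) (U : Set (Fin d → ℝ)) : Prop :=
  ∀ x ∈ U, LinearMap.rank (fderiv ℝ f x).toLinearMap = (d : Cardinal)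

/-- `η(n,d)`. -/
def etaND (n d : ℕ) : ℝ := if 1 < d then 1 / ((n : ℝ) - 1) else 3 / (2 * (n : ℝ) - 1)

/-- The set counted by `N*_θ(Δ;ε,t)`. -/
def NstarSet {d n : ℕ} (f : (Fin d → ℝ) → Fin n → ℝ) (θ : Fin n → ℝ)
    (Δ : Set (Fin d → ℝ)) (ε t : ℝ) : Set ((Fin n → ℤ) × ℤ) :=
  {pq | Real.exp (t - 1) ≤ (pq.2 : ℝ) ∧ (pq.2 : ℝ) ≤ Real.exp t ∧
    sInf ((fun x => ‖(fun i => f x i - ((pq.1 i : ℝ) + θ i) / (pq.2 : ℝ) : Fin n → ℝ)‖) '' Δ)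
      ≤ ε / Real.exp t}

/-- `N*_θ(Δ;ε,t)`. -/
def Nstar {d n : ℕ} (f : (Fin d → ℝ) → Fin n → ℝ) (θ : Fin n → ℝ)
    (Δ : Set (Fin d → ℝ)) (ε t : ℝ) : ℕ := (NstarSet f θ Δ ε t).ncard

/-- The set counted by `N_θ(Δ;ε,t)` (with `1 ≤ q ≤ e^t`). -/
def NfullSet {d n : ℕ} (f : (Fin d → ℝ) → Fin n → ℝ) (θ : Fin n → ℝ)
    (Δ : Set (Fin d → ℝ)) (ε t : ℝ) : Set ((Fin n → ℤ) × ℤ) :=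
  {pq | 1 ≤ pq.2 ∧ (pq.2 : ℝ) ≤ Real.exp t ∧
    sInf ((fun x => ‖(fun i => f x i - ((pq.1 i : ℝ) + θ i) / (pq.2 : ℝ) : Fin n → ℝ)‖) '' Δ)
      ≤ ε / Real.exp t}

/-- `N_θ(Δ;ε,t)`. -/
def Nfull {d n : ℕ} (f : (Fin d → ℝ) → Fin n → ℝ) (θ : Fin n → ℝ)
    (Δ : Set (Fin d → ℝ)) (ε t : ℝ) : ℕ := (NfullSet f θ Δ ε t).ncard

/-- Sup norm of the gradient of a scalar function on `ℝ^d`. -/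
def gradSupNorm {d : ℕ} (g : (Fin d → ℝ) → ℝ) (x : Fin d → ℝ) : ℝ :=
  ‖(fun j : Fin d => fderiv ℝ g x (Pi.single j 1) : Fin d → ℝ)‖

/-- The set `𝔖_f(δ,K,T)`. -/
def SfrakSet {d n : ℕ} (U : Set (Fin d → ℝ)) (f : (Fin d → ℝ) → Fin n → ℝ)
    (δ K : ℝ) (T : Fin n → ℝ) : Set (Fin d → ℝ) :=
  {x | x ∈ U ∧ ∃ a₀ : ℤ, ∃ a : Fin n → ℤ, a ≠ 0 ∧
    |(a₀ : ℝ) + ∑ i, f x i * (a i : ℝ)| < δ ∧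
    gradSupNorm (fun y => ∑ i, f y i * (a i : ℝ)) x < K ∧
    ∀ i, |(a i : ℝ)| < T i}

/-- First-order partial derivative `∂_i f_j` (0-based indices as naturals; junk value 0
out of range). -/
def pd1 {d m : ℕ} (f : (Fin d → ℝ) → Fin m → ℝ) (i j : ℕ) (x : Fin d → ℝ) : ℝ :=
  if h : i < d ∧ j < m then
    fderiv ℝ (fun y => f y ⟨j, h.2⟩) x (Pi.single (⟨i, h.1⟩ : Fin d) 1)
  else 0

/-- Second-order partial derivative `∂_{i'} ∂_i f_j`. -/
def pd2 {d m : ℕ} (f : (Fin d → ℝ) → Fin m → ℝ) (i i' j : ℕ) (x : Fin d → ℝ) : ℝ :=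
  if h : i' < d then fderiv ℝ (fun y => pd1 f i j y) x (Pi.single (⟨i', h⟩ : Fin d) 1) else 0

/-- The Monge map `x ↦ (x, f(x)) : ℝ^d → ℝ^{d+m}`. -/
def fullMap (d m : ℕ) (f : (Fin d → ℝ) → Fin m → ℝ) : (Fin d → ℝ) → Fin (d + m) → ℝ :=
  fun x i => if h : (i : ℕ) < d then x ⟨(i : ℕ), h⟩
    else f x ⟨(i : ℕ) - d, by have := i.isLt; omega⟩

/-- The `i`-th Minkowski successive minimum (w.r.t. the closed unit Euclidean ball) of the
lattice `g ℤ^k`. -/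
def succMin {k : ℕ} (i : ℕ) (g : Matrix (Fin k) (Fin k) ℝ) : ℝ :=
  sInf {r : ℝ | 0 ≤ r ∧ i ≤ Module.finrank ℝ
    (Submodule.span ℝ {w : Fin k → ℝ | (∃ v : Fin k → ℤ, v ≠ 0 ∧
      w = g.mulVec (fun j => (v j : ℝ))) ∧ Real.sqrt (∑ j, w j ^ 2) ≤ r})}

/-- The unipotent matrix `u₁(x) ∈ SL_{n+1}(ℝ)`, `n = d+m`. -/
def u1Mat {d m : ℕ} (f : (Fin d → ℝ) → Fin m → ℝ) (x : Fin d → ℝ) :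
    Matrix (Fin (d + m + 1)) (Fin (d + m + 1)) ℝ := fun r c =>
  if (r : ℕ) = (c : ℕ) then 1
  else if (r : ℕ) < m ∧ m ≤ (c : ℕ) ∧ (c : ℕ) < d + m then
    - pd1 f (d + m - 1 - (c : ℕ)) (m - 1 - (r : ℕ)) x
  else if (r : ℕ) < m ∧ (c : ℕ) = d + m then
    (if h : m - 1 - (r : ℕ) < m then f x ⟨m - 1 - (r : ℕ), h⟩ else 0)
      - ∑ i : Fin d, x i * pd1 f (i : ℕ) (m - 1 - (r : ℕ)) x
  else if m ≤ (r : ℕ) ∧ (r : ℕ) < d + m ∧ (c : ℕ) = d + m then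
    (if h : d + m - 1 - (r : ℕ) < d then x ⟨d + m - 1 - (r : ℕ), h⟩ else 0)
  else 0

/-- The inverse `a_{ε,t,v}⁻¹` of the diagonal matrix `a_{ε,t,v}`. -/
def aInvMat (d m : ℕ) (ε t v : ℝ) : Matrix (Fin (d + m + 1)) (Fin (d + m + 1)) ℝ :=
  Matrix.diagonal (fun i => v * (if (i : ℕ) < m then ε⁻¹
    else if (i : ℕ) < d + m then (ε ^ m * Real.exp t) ^ ((1 : ℝ) / d)
    else (v ^ (d + m + 1) * Real.exp t)⁻¹))

/-- The set `𝔊(v,t,ε)`. -/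
def Gfrak {d m : ℕ} (U : Set (Fin d → ℝ)) (f : (Fin d → ℝ) → Fin m → ℝ)
    (v t ε : ℝ) : Set (Fin d → ℝ) :=
  {x | x ∈ U ∧ v ≤ succMin 1 (aInvMat d m ε t v * u1Mat f x)}

/-- The set `𝒩_θ(t,ε,B)`. -/
def NCal {d m : ℕ} (f : (Fin d → ℝ) → Fin m → ℝ) (θ : Fin (d + m) → ℝ)
    (t : ℕ) (ε : ℝ) (B : Set (Fin d → ℝ)) : Set (ℕ × (Fin d → ℤ) × (Fin m → ℤ)) :=
  {q | 0 < q.1 ∧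
    (fun i => ((q.2.1 i : ℝ) + θ (Fin.castAdd m i)) / (q.1 : ℝ)) ∈ B ∧
    Real.exp ((t : ℝ) - 1) ≤ (q.1 : ℝ) ∧ (q.1 : ℝ) ≤ Real.exp t ∧
    ‖(fun j => (q.1 : ℝ) * f (fun i => ((q.2.1 i : ℝ) + θ (Fin.castAdd m i)) / (q.1 : ℝ)) j
        - θ (Fin.natAdd d j) - (q.2.2 j : ℝ) : Fin m → ℝ)‖ ≤ ε}

/-- The set `Δ_θ(t,ε,B,ρ)`. -/
def DeltaCal {d m : ℕ} (f : (Fin d → ℝ) → Fin m → ℝ) (θ : Fin (d + m) → ℝ)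
    (t : ℕ) (ε : ℝ) (B : Set (Fin d → ℝ)) (ρ : ℝ) : Set (Fin d → ℝ) :=
  ⋃ q ∈ NCal f θ t ε B,
    Metric.ball (fun i => ((q.2.1 i : ℝ) + θ (Fin.castAdd m i)) / (q.1 : ℝ)) ρ

/-- `φ = (ε^n e^t)^{1/(n+1)}`, `n = d+m`. -/
def phiC (d m : ℕ) (ε t : ℝ) : ℝ := (ε ^ (d + m) * Real.exp t) ^ ((1 : ℝ) / (d + m + 1))

/-- `h = dt/(2(n+1))`. -/
def hC (d m : ℕ) (t : ℝ) : ℝ := (d : ℝ) * t / (2 * ((d : ℝ) + m + 1))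

def gMat (d m : ℕ) (ε t : ℝ) : Matrix (Fin (d + m + 1)) (Fin (d + m + 1)) ℝ :=
  Matrix.diagonal (fun i => phiC d m ε t *
    (if (i : ℕ) < d + m then ε⁻¹ else Real.exp (-t)))

def bMat (d m : ℕ) (t : ℝ) : Matrix (Fin (d + m + 1)) (Fin (d + m + 1)) ℝ :=
  Matrix.diagonal (fun i => if (i : ℕ) < m then Real.exp (hC d m t)
    else if (i : ℕ) < d + m then Real.exp (-(((m : ℝ) + 1) * t) / (2 * ((d : ℝ) + m + 1)))
    else Real.exp (hC d m t))

def dMat (d m : ℕ) (ε : ℝ) : Matrix (Fin (d + m + 1)) (Fin (d + m + 1)) ℝ :=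
  Matrix.diagonal (fun i => if (i : ℕ) < m then 1
    else if (i : ℕ) < d + m then Real.sqrt ε else 1)

/-- The raw nongeneric set `𝔐₀(ε,t)`. -/
def M0frak {d m : ℕ} (U : Set (Fin d → ℝ)) (f : (Fin d → ℝ) → Fin m → ℝ)
    (ε t : ℝ) : Set (Fin d → ℝ) :=
  {x | x ∈ U ∧ phiC d m ε t * Real.exp (hC d m t) <
    succMin (d + m + 1) (dMat d m ε * bMat d m t * gMat d m ε t * u1Mat f x)}

/-- The nongeneric (special) set `𝔐(ε,t)`. -/
def Mfrak {d m : ℕ} (U : Set (Fin d → ℝ)) (f : (Fin d → ℝ) → Fin m → ℝ)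
    (ε t : ℝ) : Set (Fin d → ℝ) :=
  (⋃ x ∈ M0frak U f ε t, Metric.ball x (Real.sqrt ε * Real.exp (-t / 2))) ∩ U

/-- The inhomogeneous Diophantine exponent `λ_n^θ(x)` of `(x,x²,…,x^n)`, as a value
in `[0,∞]`. -/
def lambdaN (n : ℕ) (θ : Fin n → ℝ) (x : ℝ) : ℝ≥0∞ :=
  sSup {lam : ℝ≥0∞ | ∃ τ : ℝ, lam = ENNReal.ofReal τ ∧
    (fun i : Fin n => x ^ ((i : ℕ) + 1)) ∈ SApprox n θ (fun q => q ^ (-τ))}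

end

lemma km_exists_spaced (l : ℝ) (hl : 0 < l) : ∀ (k : ℕ) (E : Set ℝ), BddBelow E →
    ENNReal.ofReal (2 * l * k) < volume E →
    ∃ f : Fin (k + 1) → ℝ, (∀ i, f i ∈ E) ∧ ∀ i j, i < j → f i + l ≤ f j := by
  intro k
  induction k with
  | zero =>
    intro E _ hv
    have hne : E.Nonempty := by
      rw [nonempty_iff_ne_empty]; rintro rfl; simp at hv
    obtain ⟨x, hx⟩ := hne
    refine ⟨fun _ => x, fun _ => hx, fun i j h => ?_⟩
    exact absurd h (by omega)
  | succ k ih =>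
    intro E hb hv
    have hne : E.Nonempty := by
      rw [nonempty_iff_ne_empty]; rintro rfl; simp at hv
    obtain ⟨x0, hx0, hx0l⟩ := Real.lt_sInf_add_pos hne hl
    set s := sInf E
    have hsub : E ⊆ Icc s (s + 2 * l) ∪ (E ∩ Ici (x0 + l)) := by
      intro y hy
      by_cases h : x0 + l ≤ y
      · exact Or.inr ⟨hy, h⟩
      · exact Or.inl ⟨csInf_le hb hy, by linarith⟩
    have h1 : volume E ≤ ENNReal.ofReal (2 * l) + volume (E ∩ Ici (x0 + l)) := by
      refine (measure_mono hsub).trans ((measure_union_le _ _).trans ?_)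
      rw [Real.volume_Icc]; gcongr; linarith
    have h2 : ENNReal.ofReal (2 * l * k) < volume (E ∩ Ici (x0 + l)) := by
      by_contra hcon
      push Not at hcon
      have h3 : volume E ≤ ENNReal.ofReal (2 * l) + ENNReal.ofReal (2 * l * k) :=
        h1.trans (by gcongr)
      rw [← ENNReal.ofReal_add (by positivity) (by positivity)] at h3
      refine absurd (lt_of_lt_of_le hv h3) ?_
      rw [not_lt]; apply le_of_eq; congr 1; push_cast; ring
    obtain ⟨f, hf, hf2⟩ := ih (E ∩ Ici (x0 + l)) (hb.mono inter_subset_left) h2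
    refine ⟨Fin.cons x0 f, ?_, ?_⟩
    · intro i
      refine Fin.cases ?_ ?_ i
      · simpa using hx0
      · intro j; simpa using (hf j).1
    · intro i j
      refine Fin.cases ?_ ?_ i
      · refine Fin.cases ?_ ?_ j
        · intro h; exact absurd h (lt_irrefl _)
        · intro j _; simpa using (hf j).2
      · intro i
        refine Fin.cases ?_ ?_ j
        · intro h; exact absurd h (by simp)
        · intro j h; simpa using hf2 i j (by simpa using h)

/-- polynomial growth from a set of positive measure -/
lemma km_poly_growth (D : ℕ) (p : Polynomial ℝ) (hp : p.natDegree ≤ D) (E : Set ℝ) (a b m t : ℝ)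
    (hE : E ⊆ Icc a b) (ht : ∀ x ∈ E, |p.eval x| ≤ t) (hm : 0 < m)
    (hv : ENNReal.ofReal m ≤ volume E) (x : ℝ) (hx : x ∈ Icc a b) :
    |p.eval x| ≤ ((D + 1) * (2 * D + 1) ^ D) * t * ((b - a) / m) ^ D := by
  set l := m / (2 * D + 1) with hl
  have hl0 : 0 < l := by positivity
  obtain ⟨f, hf, hf2⟩ := km_exists_spaced l hl0 D E (bddBelow_Icc.mono hE) (by
    refine lt_of_lt_of_le ?_ hv
    rw [ENNReal.ofReal_lt_ofReal_iff hm, hl]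
    rw [show 2 * (m / (2 * (D:ℝ) + 1)) * D = m * (2 * D) / (2 * D + 1) by ring]
    rw [div_lt_iff₀ (by positivity)]; nlinarith)
  have hsep : ∀ i j, i ≠ j → l ≤ |f i - f j| := by
    intro i j hij
    rcases lt_or_gt_of_ne hij with h | h
    · have := hf2 i j h; rw [abs_sub_comm]; exact le_trans (by linarith) (le_abs_self _)
    · have := hf2 j i h; exact le_trans (by linarith) (le_abs_self _)
  have hinj : Set.InjOn f (Finset.univ : Finset (Fin (D+1))) := by
    intro i _ j _ hij
    by_contra hne
    have := hsep i j hne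
    rw [hij, sub_self, abs_zero] at this; linarith
  have ht0 : 0 ≤ t := (abs_nonneg _).trans (ht _ (hf 0))
  have hint := Lagrange.eq_interpolate (s := (Finset.univ : Finset (Fin (D+1)))) (v := f) (f := p) hinj (by
    refine lt_of_le_of_lt Polynomial.degree_le_natDegree ?_
    simp only [Finset.card_univ, Fintype.card_fin]
    exact_mod_cast Nat.lt_succ_of_le hp)
  have hba : l ≤ b - a := by
    have : ENNReal.ofReal m ≤ ENNReal.ofReal (b - a) := by
      refine hv.trans ((measure_mono hE).trans ?_); rw [Real.volume_Icc]
    have h3 : m ≤ b - a := by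
      have h0 : 0 ≤ b - a := by linarith [hx.1, hx.2]
      exact (ENNReal.ofReal_le_ofReal_iff h0).1 this
    refine le_trans ?_ h3
    rw [hl]; apply div_le_self hm.le; linarith [(Nat.cast_nonneg D : (0:ℝ) ≤ D)]
  rw [hint, Lagrange.interpolate_apply, Polynomial.eval_finset_sum]
  have hterm : ∀ i ∈ (Finset.univ : Finset (Fin (D+1))),
      |Polynomial.eval x (Polynomial.C (Polynomial.eval (f i) p) * Lagrange.basis Finset.univ f i)|
        ≤ t * ((b - a) / l) ^ D := by
    intro i _
    rw [Polynomial.eval_mul, Polynomial.eval_C, abs_mul]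
    refine mul_le_mul (ht _ (hf i)) ?_ (abs_nonneg _) ht0
    rw [Lagrange.basis, Polynomial.eval_prod, Finset.abs_prod]
    calc ∏ j ∈ Finset.univ.erase i, |Polynomial.eval x (Lagrange.basisDivisor (f i) (f j))|
        ≤ ∏ j ∈ Finset.univ.erase i, ((b - a) / l) := by
          refine Finset.prod_le_prod (fun _ _ => abs_nonneg _) ?_
          intro j hj
          have hij : i ≠ j := (Finset.ne_of_mem_erase hj).symm
          simp only [Lagrange.basisDivisor, Polynomial.eval_mul, Polynomial.eval_C,
            Polynomial.eval_sub, Polynomial.eval_X]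
          rw [abs_mul, abs_inv, inv_mul_eq_div]
          have h1 : |x - f j| ≤ b - a := by
            have := hE (hf j)
            rw [abs_le]; constructor <;> linarith [hx.1, hx.2, this.1, this.2]
          exact div_le_div₀ (by linarith) h1 hl0 (hsep i j hij)
      _ = ((b - a) / l) ^ D := by
          rw [Finset.prod_const, Finset.card_erase_of_mem (Finset.mem_univ _)]; simp
  refine (Finset.abs_sum_le_sum_abs _ _).trans ((Finset.sum_le_sum hterm).trans ?_)
  rw [Finset.sum_const, Finset.card_univ, Fintype.card_fin, nsmul_eq_mul]
  apply le_of_eq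
  rw [hl, div_div_eq_mul_div, mul_div_right_comm, mul_pow]
  push_cast; ring

def KMMarked {S : Type*} (comp : S → S → Prop) (ψ : S → ℝ → ℝ) (ε : ℝ) (T : Set S) (x : ℝ) :
    Prop :=
  ∃ F ⊆ T, (∀ s ∈ F, ∀ t ∈ F, comp s t) ∧ (∀ s ∈ F, ε ≤ ψ s x ∧ ψ s x ≤ 1) ∧
    ∀ t ∈ T, t ∉ F → (∀ s ∈ F, comp s t) → 1 ≤ ψ t x

def KMconst : ℕ → ℝ
  | 0 => 0
  | k+1 => 20 * (1 + KMconst k)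

lemma KMconst_nonneg (k : ℕ) : 0 ≤ KMconst k := by
  induction k with
  | zero => simp [KMconst]
  | succ k ih => simp only [KMconst]; linarith

lemma km_sum_len {a b : ℝ} (hab : a < b) (u : Set ℝ) (hu : u ⊆ Icc a b) (s : ℝ → ℝ)
    (hs : ∀ x ∈ u, 0 < s x ∧ s x ≤ b - a)
    (hd : u.PairwiseDisjoint fun x => Metric.closedBall x (s x / 5)) :
    u.Countable ∧ ∑' x : u, ENNReal.ofReal (s x) ≤ ENNReal.ofReal (5 * (b - a)) := by
  have hc : u.Countable := by
    refine hd.countable_of_nonempty_interior ?_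
    intro x hx
    refine ⟨x, ?_⟩
    rw [mem_interior_iff_mem_nhds]
    exact Metric.closedBall_mem_nhds _ (by have := (hs x hx).1; positivity)
  refine ⟨hc, ?_⟩
  have h1 : volume (⋃ x ∈ u, Metric.closedBall x (s x / 5)) =
      ∑' x : u, volume (Metric.closedBall (x:ℝ) (s x / 5)) :=
    measure_biUnion hc hd (fun x _ => Metric.isClosed_closedBall.measurableSet)
  have h2 : volume (⋃ x ∈ u, Metric.closedBall x (s x / 5)) ≤
      ENNReal.ofReal (2 * (b - a)) := by
    calc _ ≤ volume (Icc (a - (b-a)/5) (b + (b-a)/5)) := by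
          apply measure_mono
          intro y hy
          simp only [mem_iUnion] at hy
          obtain ⟨x, hx, hy⟩ := hy
          rw [Real.closedBall_eq_Icc] at hy
          have := hu hx
          have := hs x hx
          constructor
          · linarith [hy.1, (hu hx).1]
          · linarith [hy.2, (hu hx).2]
      _ ≤ _ := by
          rw [Real.volume_Icc]
          apply ENNReal.ofReal_le_ofReal; linarith
  rw [h1] at h2
  have h3 : ∀ x : u, ENNReal.ofReal (s x) = ENNReal.ofReal (5/2) *
      volume (Metric.closedBall (x:ℝ) (s x / 5)) := by
    intro x
    rw [Real.volume_closedBall, ← ENNReal.ofReal_mul (by norm_num)]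
    congr 1; ring
  simp_rw [h3]
  rw [ENNReal.tsum_mul_left]
  calc _ ≤ ENNReal.ofReal (5/2) * ENNReal.ofReal (2 * (b - a)) := by gcongr
    _ = _ := by
      rw [← ENNReal.ofReal_mul (by norm_num)]; congr 1; ring

theorem km_abstract {S : Type*} [Nonempty S] (comp : S → S → Prop) (hsymm : ∀ s t, comp s t → comp t s)
    (hrefl : ∀ s, comp s s) (rk : S → ℕ) (hrk : ∀ s t, comp s t → s ≠ t → rk s ≠ rk t)
    (ψ : S → ℝ → ℝ) (hψ : ∀ s, Continuous (ψ s)) (ε G : ℝ) (hG : 0 ≤ G)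
    (hgood : ∀ s a b, a < b → (∃ x ∈ Icc a b, 1 ≤ ψ s x) →
      volume {x | x ∈ Icc a b ∧ ψ s x < ε} ≤ ENNReal.ofReal (G * (b - a)))
    (k : ℕ) : ∀ (T : Set S) (R : Finset ℕ), R.card ≤ k → (∀ t ∈ T, rk t ∈ R) →
      ∀ a b, a < b → (∀ t ∈ T, ∃ x ∈ Icc a b, 1 ≤ ψ t x) →
      volume {x | x ∈ Icc a b ∧ ¬ KMMarked comp ψ ε T x} ≤
        ENNReal.ofReal (KMconst k * G * (b - a)) := by
  induction k with
  | zero =>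
    intro T R hR hT a b hab _
    have : R = ∅ := by simpa using hR
    have hT0 : ∀ t, t ∉ T := fun t ht => by have := hT t ht; simp_all
    have : {x | x ∈ Icc a b ∧ ¬ KMMarked comp ψ ε T x} = ∅ := by
      ext x
      simp only [mem_ofPred_eq, mem_empty_iff_false, iff_false, not_and, not_not]
      intro _
      exact ⟨∅, by simp, by simp, by simp, fun t ht => absurd ht (hT0 t)⟩
    rw [this]; simp
  | succ k ih =>
    intro T R hR hT a b hab hsup
    set B := {x | x ∈ Icc a b ∧ ¬ KMMarked comp ψ ε T x} with hB
    -- radius choice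
    have key : ∀ x ∈ B, ∃ s : ℝ, ∃ Δ ∈ T, 0 < s ∧ s ≤ b - a ∧
        (∀ y ∈ Icc (x - s) (x + s), ψ Δ y < 1) ∧
        (∀ t ∈ T, ∃ y ∈ Icc (x - 2 * s) (x + 2 * s), 1 ≤ ψ t y) := by
      intro x hx
      set Rx : Set ℝ := {r | 0 < r ∧ ∃ Δ ∈ T, ∀ y ∈ Icc (x - r) (x + r), ψ Δ y < 1} with hRx
      have hbd : ∀ r ∈ Rx, r ≤ b - a := by
        rintro r ⟨hr, Δ, hΔ, h⟩
        obtain ⟨y, hy, h1⟩ := hsup Δ hΔ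
        by_contra hcon
        push Not at hcon
        have := h y ⟨by linarith [hx.1.1, hx.1.2, hy.1, hy.2], by
          linarith [hx.1.1, hx.1.2, hy.1, hy.2]⟩
        linarith
      have hne : Rx.Nonempty := by
        have h2 := hx.2
        have : ∃ t ∈ T, ψ t x < 1 := by
          by_contra hcon
          push Not at hcon
          exact h2 ⟨∅, by simp, by simp, by simp, fun t ht _ _ => hcon t ht⟩
        obtain ⟨t, ht, h1⟩ := this
        have := (hψ t).continuousAt.eventually_lt (continuousAt_const (x := x) (y := (1:ℝ))) h1
        obtain ⟨r, hr, h⟩ := Metric.eventually_nhds_iff.1 this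
        refine ⟨r/2, by positivity, t, ht, fun y hy => h ?_⟩
        rw [Real.dist_eq, abs_lt]
        constructor <;> linarith [hy.1, hy.2]
      have hbdd : BddAbove Rx := ⟨b - a, hbd⟩
      have hpos : 0 < sSup Rx := by
        obtain ⟨r, hr⟩ := hne
        exact lt_of_lt_of_le hr.1 (le_csSup hbdd hr)
      obtain ⟨s, hs, hs2⟩ := exists_lt_of_lt_csSup hne (show sSup Rx / 2 < sSup Rx by linarith)
      have hs' := hs
      obtain ⟨hs0, Δ, hΔ, h⟩ := hs
      refine ⟨s, Δ, hΔ, hs0, hbd s hs', h, ?_⟩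
      intro t ht
      by_contra hcon
      push Not at hcon
      have : 2 * s ∈ Rx := ⟨by positivity, t, ht, hcon⟩
      have := le_csSup hbdd this
      linarith
    choose! s Δ hΔT hs0 hsb hlt hge using key
    obtain ⟨u, huB, hdis, hcov⟩ := Vitali.exists_disjoint_subfamily_covering_enlargement_closedBall
      B (fun x => x) (fun x => s x / 5) (b - a)
      (fun x hx => by have := hsb x hx; have := hs0 x hx; linarith) 5 (by norm_num)
    obtain ⟨huc, hlen⟩ := km_sum_len hab u (fun x hx => (huB hx).1) s
      (fun x hx => ⟨hs0 x (huB hx), hsb x (huB hx)⟩) hdis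
    have hloc : ∀ x ∈ u, volume (B ∩ Icc (x - s x) (x + s x)) ≤
        ENNReal.ofReal (4 * (1 + KMconst k) * G) * ENNReal.ofReal (s x) := by
      intro x hxu
      have hx := huB hxu
      set T' : Set S := {t | t ∈ T ∧ t ≠ Δ x ∧ comp (Δ x) t} with hT'
      have h1 := hgood (Δ x) (x - 2 * s x) (x + 2 * s x) (by linarith [hs0 x hx])
        (hge x hx _ (hΔT x hx))
      have h2 := ih T' (R.erase (rk (Δ x)))
        (by rw [Finset.card_erase_of_mem (hT _ (hΔT x hx))]; omega)
        (fun t ht => Finset.mem_erase.2 ⟨fun h => hrk _ _ ht.2.2 (Ne.symm ht.2.1) h.symm, hT t ht.1⟩)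
        (x - 2 * s x) (x + 2 * s x) (by linarith [hs0 x hx])
        (fun t ht => hge x hx t ht.1)
      have hsub : B ∩ Icc (x - s x) (x + s x) ⊆
          {y | y ∈ Icc (x - 2 * s x) (x + 2 * s x) ∧ ψ (Δ x) y < ε} ∪
          {y | y ∈ Icc (x - 2 * s x) (x + 2 * s x) ∧ ¬ KMMarked comp ψ ε T' y} := by
        rintro y ⟨hyB, hy⟩
        have hy2 : y ∈ Icc (x - 2 * s x) (x + 2 * s x) :=
          ⟨by linarith [hy.1, hs0 x hx], by linarith [hy.2, hs0 x hx]⟩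
        by_contra hcon
        simp only [mem_union, mem_ofPred_eq, not_or, not_and, not_not, not_lt] at hcon
        have hc1 := hcon.1 hy2
        obtain ⟨F, hFT, hFc, hFb, hFt⟩ := hcon.2 hy2
        apply hyB.2
        refine ⟨insert (Δ x) F, ?_, ?_, ?_, ?_⟩
        · exact insert_subset (hΔT x hx) (fun t ht => (hFT ht).1)
        · rintro p (rfl | hp) q (rfl | hq)
          · exact hrefl _
          · exact (hFT hq).2.2
          · exact hsymm _ _ (hFT hp).2.2
          · exact hFc p hp q hq
        · rintro p (rfl | hp)
          · exact ⟨hc1, (hlt x hx y hy).le⟩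
          · exact hFb p hp
        · intro t ht htF hcomp
          simp only [mem_insert_iff, not_or] at htF
          exact hFt t ⟨ht, htF.1, hcomp _ (mem_insert _ _)⟩ htF.2
            (fun q hq => hcomp q (mem_insert_of_mem _ hq))
      calc _ ≤ _ := measure_mono hsub
        _ ≤ _ := measure_union_le _ _
        _ ≤ _ := add_le_add h1 h2
        _ = _ := by
          have := KMconst_nonneg k
          have := hs0 x hx
          rw [← ENNReal.ofReal_mul (by positivity), ← ENNReal.ofReal_add]
          · congr 1; ring
          · have : 0 ≤ x + 2 * s x - (x - 2 * s x) := by linarith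
            positivity
          · have : 0 ≤ x + 2 * s x - (x - 2 * s x) := by linarith
            positivity
    have hBsub : B ⊆ ⋃ x ∈ u, (B ∩ Icc (x - s x) (x + s x)) := by
      intro y hy
      obtain ⟨x, hxu, hsubx⟩ := hcov y hy
      simp only [mem_iUnion]
      refine ⟨x, hxu, hy, ?_⟩
      have := hsubx (Metric.mem_closedBall_self (by have := hs0 y hy; positivity))
      rw [Real.closedBall_eq_Icc] at this
      constructor <;> linarith [this.1, this.2]
    calc volume B ≤ volume (⋃ x ∈ u, (B ∩ Icc (x - s x) (x + s x))) := measure_mono hBsub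
      _ ≤ ∑' x : u, volume (B ∩ Icc ((x:ℝ) - s x) (x + s x)) := measure_biUnion_le _ huc _
      _ ≤ ∑' x : u, ENNReal.ofReal (4 * (1 + KMconst k) * G) * ENNReal.ofReal (s x) :=
          ENNReal.tsum_le_tsum (fun x => hloc x x.2)
      _ = ENNReal.ofReal (4 * (1 + KMconst k) * G) * ∑' x : u, ENNReal.ofReal (s x) :=
          ENNReal.tsum_mul_left
      _ ≤ ENNReal.ofReal (4 * (1 + KMconst k) * G) * ENNReal.ofReal (5 * (b - a)) := by gcongr
      _ = _ := by
          have := KMconst_nonneg k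
          rw [← ENNReal.ofReal_mul (by positivity)]
          congr 1; simp only [KMconst]; ring

/-- The matrix of values, derivatives and higher coefficients. -/
def Um (n : ℕ) (x : ℝ) : Matrix (Fin (n+1)) (Fin (n+1)) ℝ := Matrix.of fun i j =>
  if i.val = 0 then x ^ j.val else if i.val = 1 then (j.val : ℝ) * x ^ (j.val - 1) else
    if i = j then 1 else 0

def Hm (n : ℕ) (w : Fin (n+1) → ℝ) (x : ℝ) : Matrix (Fin (n+1)) (Fin (n+1)) ℝ :=
  Matrix.of fun i j => w i * Um n x i j

def castV {m k : ℕ} (R : Type*) [Ring R] (v : Fin k → Fin m → ℤ) : Matrix (Fin m) (Fin k) R :=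
  Matrix.of fun j c => (v c j : R)

def mn {m k : ℕ} (H : Matrix (Fin m) (Fin m) ℝ) (v : Fin k → Fin m → ℤ) (I : Fin k → Fin m) : ℝ :=
  ((H * castV ℝ v).submatrix I id).det

def nm {m k : ℕ} (H : Matrix (Fin m) (Fin m) ℝ) (v : Fin k → Fin m → ℤ) : ℝ :=
  ‖fun I : Fin k → Fin m => mn H v I‖

lemma mn_Hm {n k : ℕ} (w : Fin (n+1) → ℝ) (x : ℝ) (v : Fin k → Fin (n+1) → ℤ) (I) :
    mn (Hm n w x) v I = (∏ r, w (I r)) * mn (Um n x) v I := by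
  unfold mn
  rw [← Matrix.det_mul_column]
  congr 1
  ext r c
  simp only [Matrix.submatrix_apply, Matrix.mul_apply, Hm, Matrix.of_apply, Finset.mul_sum]
  refine Finset.sum_congr rfl fun j _ => ?_
  simp [mul_assoc]

lemma mn_le_nm {m k : ℕ} (H : Matrix (Fin m) (Fin m) ℝ) (v : Fin k → Fin m → ℤ) (I) :
    |mn H v I| ≤ nm H v := norm_le_pi_norm (fun I => mn H v I) I

lemma nm_le {m k : ℕ} (H : Matrix (Fin m) (Fin m) ℝ) (v : Fin k → Fin m → ℤ) {t : ℝ} (ht : 0 ≤ t)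
    (h : ∀ I, |mn H v I| ≤ t) : nm H v ≤ t := (pi_norm_le_iff_of_nonneg ht).2 h

lemma mn_not_inj {m k : ℕ} (H : Matrix (Fin m) (Fin m) ℝ) (v : Fin k → Fin m → ℤ) (I)
    (hI : ¬ Function.Injective I) : mn H v I = 0 := by
  simp only [Function.Injective, not_forall] at hI
  obtain ⟨a, b, hab, hne⟩ := hI
  refine Matrix.det_zero_of_row_eq hne ?_
  ext c
  simp [Matrix.submatrix_apply, hab]

lemma mn_cons {m k : ℕ} (H : Matrix (Fin m) (Fin m) ℝ) (v : Fin k → Fin m → ℤ) (P : Fin m → ℤ) :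
    nm H (Fin.cons P v : Fin (k+1) → Fin m → ℤ) ≤
      (k + 1) * ‖H.mulVec (fun j => (P j : ℝ))‖ * nm H v := by
  have h0 : 0 ≤ nm H v := norm_nonneg _
  refine nm_le _ _ (by positivity) fun I => ?_
  unfold mn
  rw [Matrix.det_succ_column_zero]
  refine (Finset.abs_sum_le_sum_abs _ _).trans ?_
  have : ∀ i : Fin (k+1), |(-1) ^ (i : ℕ) *
      ((H * castV ℝ (Fin.cons P v : Fin (k+1) → Fin m → ℤ)).submatrix I id) i 0 *
      (((H * castV ℝ (Fin.cons P v : Fin (k+1) → Fin m → ℤ)).submatrix I id).submatrix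
        i.succAbove Fin.succ).det| ≤ ‖H.mulVec (fun j => (P j : ℝ))‖ * nm H v := by
    intro i
    rw [abs_mul, abs_mul, abs_pow, abs_neg, abs_one, one_pow, one_mul]
    refine mul_le_mul ?_ ?_ (abs_nonneg _) (norm_nonneg _)
    · have := norm_le_pi_norm (H.mulVec (fun j => (P j : ℝ))) (I i)
      simpa [Matrix.mul_apply, castV, Matrix.mulVec, dotProduct] using this
    · have := mn_le_nm H v (I ∘ i.succAbove)
      refine le_trans (le_of_eq ?_) this
      unfold mn
      congr 2
  calc _ ≤ ∑ _i : Fin (k+1), ‖H.mulVec (fun j => (P j : ℝ))‖ * nm H v :=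
        Finset.sum_le_sum fun i _ => this i
    _ = _ := by simp; ring

/-! polynomial version -/
open Polynomial in
lemma det_natDegree_le {k : ℕ} (M : Matrix (Fin k) (Fin k) ℝ[X]) (d : Fin k → ℕ)
    (h : ∀ r c, (M r c).natDegree ≤ d r) : M.det.natDegree ≤ ∑ r, d r := by
  rw [Matrix.det_apply]
  refine natDegree_sum_le_of_forall_le _ _ fun σ _ => ?_
  have h2 : (∏ i, M (σ i) i).natDegree ≤ ∑ r, d r := by
    refine (natDegree_prod_le _ _).trans ?_
    calc _ ≤ ∑ i, d (σ i) := Finset.sum_le_sum fun i _ => h _ _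
      _ = _ := Equiv.sum_comp σ d
  rcases Int.units_eq_one_or (Equiv.Perm.sign σ) with h1 | h1 <;> rw [h1]
  · simpa using h2
  · simpa using h2

open Polynomial in
noncomputable def Ump (n : ℕ) : Matrix (Fin (n+1)) (Fin (n+1)) ℝ[X] := Matrix.of fun i j =>
  if i.val = 0 then X ^ j.val else if i.val = 1 then C (j.val : ℝ) * X ^ (j.val - 1) else
    if i = j then 1 else 0

open Polynomial in
noncomputable def castVp {m k : ℕ} (v : Fin k → Fin m → ℤ) : Matrix (Fin m) (Fin k) ℝ[X] :=
  Matrix.of fun j c => C (v c j : ℝ)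

open Polynomial in
noncomputable def mnp {n k : ℕ} (v : Fin k → Fin (n+1) → ℤ) (I : Fin k → Fin (n+1)) : ℝ[X] :=
  ((Ump n * castVp v).submatrix I id).det

open Polynomial in
lemma mnp_eval {n k : ℕ} (v : Fin k → Fin (n+1) → ℤ) (I : Fin k → Fin (n+1)) (x : ℝ) :
    (mnp v I).eval x = mn (Um n x) v I := by
  unfold mnp mn
  rw [← coe_evalRingHom, RingHom.map_det]
  congr 1
  ext r c
  simp only [RingHom.mapMatrix_apply, Matrix.map_apply, Matrix.submatrix_apply, Matrix.mul_apply,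
    map_sum, map_mul]
  refine Finset.sum_congr rfl fun j _ => ?_
  congr 1
  · simp only [Ump, Um, Matrix.of_apply, coe_evalRingHom]
    split_ifs <;> simp
  · simp [castVp, castV]

open Polynomial in
lemma mnp_degree {n k : ℕ} (hn : 2 ≤ n) (v : Fin k → Fin (n+1) → ℤ) (I : Fin k → Fin (n+1)) :
    (mnp v I).natDegree ≤ 2 * (n - 1) := by
  by_cases hI : Function.Injective I
  swap
  · have : mnp v I = 0 := by
      apply Polynomial.funext
      intro x
      rw [mnp_eval, mn_not_inj _ _ _ hI, eval_zero]
    rw [this]; simp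
  have hmul : ∀ (A : Matrix (Fin (n+1)) (Fin (n+1)) ℝ[X]) (i c) (d : ℕ), (∀ j, (A i j).natDegree ≤ d) →
      ((A * castVp v) i c).natDegree ≤ d := by
    intro A i c d h
    rw [Matrix.mul_apply]
    refine natDegree_sum_le_of_forall_le _ _ fun j _ => ?_
    refine natDegree_mul_le.trans ?_
    simp only [castVp, Matrix.of_apply, natDegree_C, add_zero]
    exact h j
  have hU : ∀ i j, (Ump n i j).natDegree ≤ if i.val = 0 then n else if i.val = 1 then n - 1 else 0 := by
    intro i j
    have := j.2
    simp only [Ump, Matrix.of_apply]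
    split_ifs
    · simp; omega
    · refine (natDegree_C_mul_X_pow_le _ _).trans (by omega)
    · simp
    · simp
  by_cases h01 : (∃ r0, (I r0).val = 0) ∧ (∃ r1, (I r1).val = 1)
  · obtain ⟨⟨r0, h0⟩, ⟨r1, h1⟩⟩ := h01
    have hne : r0 ≠ r1 := by rintro rfl; omega
    set M := (Ump n * castVp v).submatrix I id with hM
    have hn0 : (n : ℝ) ≠ 0 := by positivity
    have e : M.det = (M.updateRow r0 (M r0 + (-(C (n:ℝ)⁻¹ * X)) • M r1)).det :=
      (Matrix.det_updateRow_add_smul_self M hne _).symm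
    have : mnp v I = M.det := rfl
    rw [this, e]
    refine (det_natDegree_le _ (fun r => if r = r0 then n - 1 else if r = r1 then n - 1 else 0) ?_).trans ?_
    · intro r c
      by_cases hr : r = r0
      · subst hr
        rw [Matrix.updateRow_self]
        simp only [if_true, Pi.add_apply, Pi.smul_apply, smul_eq_mul]
        have : M r c + (-(C (n:ℝ)⁻¹ * X)) * M r1 c =
            ∑ j : Fin (n+1), (C (1 - (n:ℝ)⁻¹ * j.val) * X ^ j.val) * castVp v j c := by
          simp only [hM, Matrix.submatrix_apply, id, Matrix.mul_apply, Finset.mul_sum]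
          rw [← Finset.sum_add_distrib]
          refine Finset.sum_congr rfl fun j _ => ?_
          simp only [Ump, Matrix.of_apply, h0, h1]
          simp only [if_true, one_ne_zero, if_false]
          rcases Nat.eq_zero_or_pos j.val with hj | hj
          · simp [hj]
          · have : (X : ℝ[X]) ^ j.val = X * X ^ (j.val - 1) := by
              rw [← pow_succ']; congr 1; omega
            rw [this]
            simp only [map_sub, map_mul, map_one]
            ring
        rw [this]
        refine natDegree_sum_le_of_forall_le _ _ fun j _ => ?_
        refine natDegree_mul_le.trans ?_
        simp only [castVp, Matrix.of_apply, natDegree_C, add_zero]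
        by_cases hj : j.val = n
        · rw [hj, inv_mul_cancel₀ hn0]; simp
        · refine (natDegree_C_mul_X_pow_le _ _).trans (by omega)
      · rw [Matrix.updateRow_ne hr, if_neg hr]
        have : (I r).val ≠ 0 := by
          intro h; exact hr (hI (Fin.ext (by rw [h, h0])))
        refine hmul (Ump n) (I r) c _ fun j => (hU _ _).trans ?_
        rw [if_neg this]
        by_cases hr1 : r = r1
        · rw [if_pos hr1]; split_ifs <;> omega
        · have : (I r).val ≠ 1 := by
            intro h; exact hr1 (hI (Fin.ext (by rw [h, h1])))
          simp [this]
    · rw [Finset.sum_ite, Finset.sum_ite]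
      simp only [Finset.sum_const, smul_eq_mul, mul_zero, add_zero]
      have a1 : (Finset.univ.filter (fun r => r = r0)).card = 1 := by
        rw [Finset.filter_eq']; simp
      have a2 : ((Finset.univ.filter (fun r => ¬ r = r0)).filter (fun r => r = r1)).card ≤ 1 := by
        rw [Finset.filter_eq']; split_ifs <;> simp
      rw [a1]
      nlinarith
  · refine (det_natDegree_le _ (fun r => if (I r).val = 0 then n else if (I r).val = 1 then n-1 else 0)
      fun r c => ?_).trans ?_
    · exact hmul (Ump n) (I r) c _ (hU _)
    · have hs : ∀ (a d : ℕ), (∑ r, if (I r).val = a then d else 0) ≤ d := by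
        intro a d
        rw [Finset.sum_ite]
        simp only [Finset.sum_const, smul_eq_mul, mul_zero, add_zero]
        have : (Finset.univ.filter (fun r => (I r).val = a)).card ≤ 1 := by
          refine Finset.card_le_one.2 ?_
          intro x hx y hy
          simp only [Finset.mem_filter, Finset.mem_univ, true_and] at hx hy
          exact hI (Fin.ext (by rw [hx, hy]))
        nlinarith
      rw [not_and_or] at h01
      push Not at h01
      rcases h01 with h | h
      · simp only [h, if_false]
        exact (hs 1 (n-1)).trans (by omega)
      · simp only [h, if_false]
        exact (hs 0 n).trans (by omega)

lemma exists_minor {K : Type*} [Field K] {m k : ℕ} (M : Matrix (Fin m) (Fin k) K)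
    (hM : LinearIndependent K M.col) (s : Set (Fin m)) (hs : LinearIndepOn K M.row s) :
    ∃ I : Fin k → Fin m, (M.submatrix I id).det ≠ 0 ∧ s ⊆ range I := by
  classical
  obtain ⟨b, -, hsb, hspan, hli⟩ := exists_linearIndepOn_extension hs (subset_univ s)
  have h1 : M.rank = k := by
    rw [Matrix.rank_eq_finrank_span_cols, finrank_span_eq_card hM, Fintype.card_fin]
  have h2 : Fintype.card b = k := by
    rw [← h1, Matrix.rank_eq_finrank_span_row, ← finrank_span_eq_card hli.linearIndependent]
    have hse : Submodule.span K (range fun x : b => M.row x) = Submodule.span K (range M.row) := by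
      apply le_antisymm
      · rw [Submodule.span_le]
        rintro _ ⟨x, rfl⟩
        exact Submodule.subset_span ⟨x, rfl⟩
      · rw [Submodule.span_le]
        rintro _ ⟨x, rfl⟩
        have := hspan ⟨x, mem_univ _, rfl⟩
        rw [image_eq_range] at this
        exact this
    rw [hse]
  let e : Fin k ≃ b := (Fintype.equivFinOfCardEq h2).symm
  refine ⟨fun r => (e r : Fin m), ?_, ?_⟩
  · have : LinearIndependent K (M.submatrix (fun r => (e r : Fin m)) id).row :=
      hli.linearIndependent.comp e e.injective
    rw [Matrix.linearIndependent_rows_iff_isUnit] at this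
    exact ((Matrix.isUnit_iff_isUnit_det _).1 this).ne_zero
  · intro x hx
    exact ⟨e.symm ⟨x, hsb hx⟩, by simp⟩

def Fam {m k : ℕ} (W : Submodule ℚ (Fin m → ℚ)) (v : Fin k → Fin m → ℤ) : Prop :=
  (∀ c, (fun j => (v c j : ℚ)) ∈ W) ∧ LinearIndependent ℚ (castV ℚ v).col

lemma exists_fam {m : ℕ} (W : Submodule ℚ (Fin m → ℚ)) :
    ∃ v : Fin (Module.finrank ℚ W) → Fin m → ℤ, Fam W v := by
  let b := Module.finBasis ℚ W
  have hb : LinearIndependent ℚ (fun c => (b c : Fin m → ℚ)) :=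
    b.linearIndependent.map' W.subtype (Submodule.ker_subtype _)
  let N : Fin (Module.finrank ℚ W) → ℕ := fun c => ∏ j, ((b c : Fin m → ℚ) j).den
  have hN : ∀ c, (N c : ℚ) ≠ 0 := by
    intro c
    simp only [N, Nat.cast_prod, Finset.prod_ne_zero_iff]
    intro j _
    simp
  have hex : ∀ c j, ∃ z : ℤ, (z : ℚ) = N c * (b c : Fin m → ℚ) j := by
    intro c j
    obtain ⟨d, hd⟩ : ((b c : Fin m → ℚ) j).den ∣ N c :=
      Finset.dvd_prod_of_mem (fun j => ((b c : Fin m → ℚ) j).den) (Finset.mem_univ j)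
    refine ⟨d * ((b c : Fin m → ℚ) j).num, ?_⟩
    rw [hd]
    push_cast
    rw [← Rat.mul_den_eq_num]
    ring
  choose v hv using hex
  refine ⟨v, fun c => ?_, ?_⟩
  · have : (fun j => (v c j : ℚ)) = (N c : ℚ) • (b c : Fin m → ℚ) := by
      ext j; simp [hv]
    rw [this]
    exact W.smul_mem _ (b c).2
  · have := hb.units_smul (fun c => Units.mk0 (N c : ℚ) (hN c))
    convert! this using 1
    ext c j
    simp [castV, hv, Matrix.col, Units.smul_def]

lemma fam_change {m : ℕ} (W : Submodule ℚ (Fin m → ℚ)) (v v' : Fin (Module.finrank ℚ W) → Fin m → ℤ)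
    (hv : Fam W v) (hv' : Fam W v') :
    ∃ A : Matrix (Fin (Module.finrank ℚ W)) (Fin (Module.finrank ℚ W)) ℚ,
      castV ℚ v' = castV ℚ v * A := by
  have hle : Submodule.span ℚ (range (castV ℚ v).col) ≤ W := by
    rw [Submodule.span_le]
    rintro _ ⟨c, rfl⟩
    exact hv.1 c
  have heq : Submodule.span ℚ (range (castV ℚ v).col) = W := by
    apply Submodule.eq_of_le_of_finrank_eq hle
    rw [finrank_span_eq_card hv.2, Fintype.card_fin]
  have : ∀ c, ∃ a : Fin (Module.finrank ℚ W) → ℚ, ∑ i, a i • (castV ℚ v).col i = (fun j => (v' c j : ℚ)) := by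
    intro c
    rw [← Submodule.mem_span_range_iff_exists_fun, heq]
    exact hv'.1 c
  choose a ha using this
  refine ⟨Matrix.of fun i c => a c i, ?_⟩
  ext j c
  have := congrFun (ha c) j
  simp only [Finset.sum_apply, Pi.smul_apply, smul_eq_mul, Matrix.col_apply] at this
  simp only [castV, Matrix.of_apply, Matrix.mul_apply] at this ⊢
  rw [← this]
  exact Finset.sum_congr rfl fun i _ => mul_comm _ _

lemma castV_map {m k : ℕ} (v : Fin k → Fin m → ℤ) :
    castV ℝ v = (castV ℚ v).map (Rat.castHom ℝ) := by
  ext j c; simp [castV]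

lemma fam_change_mn {m k : ℕ} (v v' : Fin k → Fin m → ℤ) (A : Matrix (Fin k) (Fin k) ℚ)
    (h : castV ℚ v' = castV ℚ v * A) (H : Matrix (Fin m) (Fin m) ℝ) (I) :
    mn H v' I = mn H v I * (A.det : ℝ) := by
  unfold mn
  rw [castV_map v', h, Matrix.map_mul, ← castV_map, ← Matrix.mul_assoc]
  rw [show (H * castV ℝ v * A.map ⇑(Rat.castHom ℝ)).submatrix I id =
    (H * castV ℝ v).submatrix I id * A.map ⇑(Rat.castHom ℝ) from ?_, Matrix.det_mul]
  · congr 1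
    rw [← RingHom.mapMatrix_apply, ← RingHom.map_det]; simp
  · ext; simp [Matrix.mul_apply, Matrix.submatrix_apply]

def costV {m k : ℕ} (v : Fin k → Fin m → ℤ) : ℕ :=
  ∑ I : Fin k → Fin m, (((castV ℤ v).submatrix I id).det).natAbs

lemma costV_real {m k : ℕ} (v : Fin k → Fin m → ℤ) :
    (costV v : ℝ) = ∑ I : Fin k → Fin m, |mn (1 : Matrix (Fin m) (Fin m) ℝ) v I| := by
  unfold costV
  push_cast
  refine Finset.sum_congr rfl fun I _ => ?_
  rw [Nat.cast_natAbs]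
  push_cast
  congr 1
  unfold mn
  rw [Matrix.one_mul]
  congr 1

lemma fam_minor {m k : ℕ} (v : Fin k → Fin m → ℤ) (hv : LinearIndependent ℚ (castV ℚ v).col) :
    ∃ I, mn (1 : Matrix (Fin m) (Fin m) ℝ) v I ≠ 0 := by
  obtain ⟨I, hI, -⟩ := exists_minor (castV ℚ v) hv ∅ (linearIndepOn_empty _ _)
  refine ⟨I, ?_⟩
  unfold mn
  rw [Matrix.one_mul, castV_map, Matrix.submatrix_map, ← RingHom.mapMatrix_apply, ← RingHom.map_det]
  simpa using hI

lemma exists_min_fam {m : ℕ} (W : Submodule ℚ (Fin m → ℚ)) :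
    ∃ v : Fin (Module.finrank ℚ W) → Fin m → ℤ, Fam W v ∧
      ∀ v' : Fin (Module.finrank ℚ W) → Fin m → ℤ, Fam W v' → ∀ H : Matrix (Fin m) (Fin m) ℝ, nm H v ≤ nm H v' := by
  classical
  have hne : ∃ c : ℕ, ∃ v : Fin (Module.finrank ℚ W) → Fin m → ℤ, Fam W v ∧ costV v = c := by
    obtain ⟨v, hv⟩ := exists_fam W
    exact ⟨_, v, hv, rfl⟩
  obtain ⟨v, hv, hc⟩ := Nat.find_spec hne
  refine ⟨v, hv, fun v' hv' H => ?_⟩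
  have hmin : costV v ≤ costV v' := by
    rw [hc]; exact Nat.find_min' hne ⟨v', hv', rfl⟩
  obtain ⟨A, hA⟩ := fam_change W v v' hv hv'
  have hpos : (0:ℝ) < costV v := by
    rw [costV_real]
    obtain ⟨I, hI⟩ := fam_minor v hv.2
    exact Finset.sum_pos' (fun _ _ => abs_nonneg _) ⟨I, Finset.mem_univ _, abs_pos.2 hI⟩
  have hcost : (costV v' : ℝ) = costV v * |(A.det : ℝ)| := by
    rw [costV_real, costV_real, Finset.sum_mul]
    refine Finset.sum_congr rfl fun I _ => ?_
    rw [fam_change_mn v v' A hA, abs_mul]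
  have hdet : 1 ≤ |(A.det : ℝ)| := by
    have : (costV v : ℝ) ≤ costV v * |(A.det : ℝ)| := by
      rw [← hcost]; exact_mod_cast hmin
    by_contra hcon
    push Not at hcon
    nlinarith
  refine nm_le _ _ (norm_nonneg _) fun I => ?_
  refine le_trans ?_ (mn_le_nm H v' I)
  rw [fam_change_mn v v' A hA, abs_mul]
  exact le_mul_of_one_le_right (abs_nonneg _) hdet

noncomputable def mfam {m : ℕ} (W : Submodule ℚ (Fin m → ℚ)) : Fin (Module.finrank ℚ W) → Fin m → ℤ :=
  Classical.choose (exists_min_fam W)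

lemma mfam_fam {m : ℕ} (W : Submodule ℚ (Fin m → ℚ)) : Fam W (mfam W) :=
  (Classical.choose_spec (exists_min_fam W)).1

lemma mfam_min {m k : ℕ} (W : Submodule ℚ (Fin m → ℚ)) (hk : k = Module.finrank ℚ W)
    (v' : Fin k → Fin m → ℤ) (h : Fam W v') (H : Matrix (Fin m) (Fin m) ℝ) :
    nm H (mfam W) ≤ nm H v' := by
  subst hk
  exact (Classical.choose_spec (exists_min_fam W)).2 v' h H

lemma fam_cons {m : ℕ} (U : Submodule ℚ (Fin m → ℚ)) (P : Fin m → ℤ)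
    (hP : (fun j => (P j : ℚ)) ∉ U) :
    Fam (U ⊔ Submodule.span ℚ {fun j => (P j : ℚ)})
      (Fin.cons P (mfam U) : Fin (Module.finrank ℚ U + 1) → Fin m → ℤ) ∧
    Module.finrank ℚ ↥(U ⊔ Submodule.span ℚ {fun j => (P j : ℚ)}) = Module.finrank ℚ U + 1 := by
  have hU := mfam_fam U
  have hspan : Submodule.span ℚ (range (castV ℚ (mfam U)).col) = U := by
    apply Submodule.eq_of_le_of_finrank_eq
    · rw [Submodule.span_le]
      rintro _ ⟨c, rfl⟩
      exact hU.1 c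
    · rw [finrank_span_eq_card hU.2, Fintype.card_fin]
  have hcol : (castV ℚ (Fin.cons P (mfam U) : Fin (Module.finrank ℚ U + 1) → Fin m → ℤ)).col =
      Fin.cons (fun j => (P j : ℚ)) (castV ℚ (mfam U)).col := by
    ext c j
    refine Fin.cases ?_ (fun c => ?_) c
    · rw [Fin.cons_zero]; simp [castV, Matrix.col]
    · rw [Fin.cons_succ]; simp [castV, Matrix.col]
  have hli : LinearIndependent ℚ
      (castV ℚ (Fin.cons P (mfam U) : Fin (Module.finrank ℚ U + 1) → Fin m → ℤ)).col := by
    rw [hcol, linearIndependent_finCons]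
    refine ⟨hU.2, ?_⟩
    rw [hspan]; exact hP
  refine ⟨⟨?_, hli⟩, ?_⟩
  · intro c
    refine Fin.cases ?_ (fun c => ?_) c
    · simp only [Fin.cons_zero]
      exact Submodule.mem_sup_right (Submodule.mem_span_singleton_self _)
    · simp only [Fin.cons_succ]
      exact Submodule.mem_sup_left (hU.1 c)
  · have := finrank_span_eq_card hli
    rw [Fintype.card_fin] at this
    rw [← this, hcol, Fin.range_cons, Submodule.span_insert, hspan, sup_comm]

def GoodM {m : ℕ} (H : Matrix (Fin m) (Fin m) ℝ) (κ : ℝ) : Prop :=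
  ∀ P : Fin m → ℤ, P ≠ 0 → κ ≤ ‖H.mulVec (fun j => (P j : ℝ))‖

lemma marked_good {m : ℕ} (H : ℝ → Matrix (Fin m) (Fin m) ℝ) (x ε : ℝ) (hε1 : ε ≤ 1)
    (hm : KMMarked (fun U W : Submodule ℚ (Fin m → ℚ) => U ≤ W ∨ W ≤ U)
      (fun W y => nm (H y) (mfam W)) ε {W | W ≠ ⊥} x) : GoodM (H x) (ε / m) := by
  classical
  intro P hP
  have hm0 : 0 < m := by
    rcases Nat.eq_zero_or_pos m with h | h
    · subst h; exact absurd (Subsingleton.elim _ _) hP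
    · exact h
  obtain ⟨F, hFT, hFc, hFb, hFt⟩ := hm
  set PQ : Fin m → ℚ := fun j => (P j : ℚ) with hPQ
  have hPQ0 : PQ ≠ 0 := by
    intro h; apply hP; ext j
    have := congrFun h j
    simpa [hPQ] using this
  -- maximal element
  have hex : ∃ U : Submodule ℚ (Fin m → ℚ), PQ ∉ U ∧ nm (H x) (mfam U) ≤ 1 ∧
      (∀ s ∈ F, s ≤ U ∨ U ≤ s) ∧ (∀ s ∈ F, PQ ∉ s → Module.finrank ℚ s ≤ Module.finrank ℚ U) := by
    by_cases hne : ∃ s ∈ F, PQ ∉ s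
    · let p : ℕ → Prop := fun r => ∃ s ∈ F, PQ ∉ s ∧ Module.finrank ℚ s = r
      have hb : ∀ r, p r → r ≤ m := by
        rintro r ⟨s, _, _, rfl⟩
        simpa using Submodule.finrank_le s
      obtain ⟨s, hs, hsP⟩ := hne
      have hsp := Nat.findGreatest_spec (P := p) (hb _ ⟨s, hs, hsP, rfl⟩) ⟨s, hs, hsP, rfl⟩
      obtain ⟨U, hU, hUP, hUr⟩ := hsp
      refine ⟨U, hUP, (hFb U hU).2, fun s hs => hFc s hs U hU, fun s hs hsP => ?_⟩
      rw [hUr]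
      exact Nat.le_findGreatest (hb _ ⟨s, hs, hsP, rfl⟩) ⟨s, hs, hsP, rfl⟩
    · push Not at hne
      refine ⟨⊥, by simpa using hPQ0, ?_, fun s _ => Or.inr bot_le, fun s hs hsP => absurd (hne s hs) hsP⟩
      refine nm_le _ _ zero_le_one fun I => ?_
      unfold mn
      have : Module.finrank ℚ (⊥ : Submodule ℚ (Fin m → ℚ)) = 0 := finrank_bot ℚ _
      have : IsEmpty (Fin (Module.finrank ℚ (⊥ : Submodule ℚ (Fin m → ℚ)))) := by
        rw [this]; infer_instance
      rw [Matrix.det_isEmpty]; simp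
  obtain ⟨U, hUP, hU1, hUc, hUr⟩ := hex
  obtain ⟨hfam, hrk⟩ := fam_cons U P hUP
  set W := U ⊔ Submodule.span ℚ {PQ} with hW
  have hPW : PQ ∈ W := Submodule.mem_sup_right (Submodule.mem_span_singleton_self _)
  have hWb : W ≠ ⊥ := by
    intro h; rw [h] at hPW; exact hPQ0 (by simpa using hPW)
  have hcomp : ∀ s ∈ F, s ≤ W ∨ W ≤ s := by
    intro s hs
    by_cases hPs : PQ ∈ s
    · right
      rcases hUc s hs with h | h
      · exact absurd (h hPs) hUP
      · refine sup_le h ?_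
        rw [Submodule.span_singleton_le_iff_mem]; exact hPs
    · left
      rcases hUc s hs with h | h
      · exact h.trans le_sup_left
      · have := Submodule.eq_of_le_of_finrank_le h (hUr s hs hPs)
        rw [← this]; exact le_sup_left
  have hεW : ε ≤ nm (H x) (mfam W) := by
    by_cases hWF : W ∈ F
    · exact (hFb W hWF).1
    · exact hε1.trans (hFt W hWb hWF hcomp)
  have h1 : nm (H x) (mfam W) ≤ _ := (mfam_min W hrk.symm _ hfam (H x)).trans (mn_cons _ _ _)
  have hk : (Module.finrank ℚ U + 1 : ℝ) ≤ m := by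
    have : Module.finrank ℚ W ≤ m := by simpa using Submodule.finrank_le W
    rw [hrk] at this
    exact_mod_cast this
  have h0 : 0 ≤ nm (H x) (mfam U) := norm_nonneg _
  have h2 : ε ≤ m * ‖(H x).mulVec (fun j => (P j : ℝ))‖ := by
    calc ε ≤ _ := hεW
      _ ≤ _ := h1
      _ ≤ (m * ‖(H x).mulVec (fun j => (P j : ℝ))‖) * 1 := by gcongr
      _ = _ := mul_one _
  rw [div_le_iff₀ (by positivity)]
  linarith

noncomputable def growK (n : ℕ) : ℝ :=
  ((2 * (n-1) : ℕ) + 1 : ℝ) * (2 * (2 * (n-1) : ℕ) + 1) ^ (2 * (n-1))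

lemma growK_pos (n : ℕ) : 0 < growK n := by unfold growK; positivity

lemma Hm_poly {n k : ℕ} (hn : 2 ≤ n) (w : Fin (n+1) → ℝ) (v : Fin k → Fin (n+1) → ℤ) (I) :
    ∃ p : Polynomial ℝ, p.natDegree ≤ 2 * (n-1) ∧ ∀ x, p.eval x = mn (Hm n w x) v I := by
  refine ⟨Polynomial.C (∏ r, w (I r)) * mnp v I, ?_, fun x => ?_⟩
  · exact (Polynomial.natDegree_C_mul_le _ _).trans (mnp_degree hn v I)
  · rw [Polynomial.eval_mul, Polynomial.eval_C, mnp_eval, mn_Hm]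

lemma nm_cont {n k : ℕ} (hn : 2 ≤ n) (w : Fin (n+1) → ℝ) (v : Fin k → Fin (n+1) → ℤ) :
    Continuous fun x => nm (Hm n w x) v := by
  refine Continuous.norm (continuous_pi fun I => ?_)
  obtain ⟨p, -, hp⟩ := Hm_poly hn w v I
  simp_rw [← hp]
  exact p.continuous

lemma nm_attained {m k : ℕ} (hm : 0 < m) (H : Matrix (Fin m) (Fin m) ℝ) (v : Fin k → Fin m → ℤ) :
    ∃ I, |mn H v I| = nm H v := by
  have : Nonempty (Fin m) := ⟨⟨0, hm⟩⟩
  obtain ⟨I, -, hI⟩ := Finset.exists_max_image (Finset.univ : Finset (Fin k → Fin m))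
    (fun I => |mn H v I|) Finset.univ_nonempty
  refine ⟨I, le_antisymm (mn_le_nm _ _ _) (nm_le _ _ (abs_nonneg _) fun J => hI J (Finset.mem_univ _))⟩

/-- comparison of sup of norms over interval with value at a point -/
lemma nm_growth {n k : ℕ} (hn : 2 ≤ n) (w : Fin (n+1) → ℝ) (v : Fin k → Fin (n+1) → ℤ)
    (E : Set ℝ) (a b m t : ℝ) (hE : E ⊆ Icc a b) (ht : ∀ x ∈ E, nm (Hm n w x) v ≤ t)
    (hm : 0 < m) (hv : ENNReal.ofReal m ≤ volume E) (x : ℝ) (hx : x ∈ Icc a b) :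
    nm (Hm n w x) v ≤ growK n * t * ((b - a) / m) ^ (2 * (n-1)) := by
  obtain ⟨I, hI⟩ := nm_attained (Nat.succ_pos n) (Hm n w x) v
  obtain ⟨p, hd, hp⟩ := Hm_poly hn w v I
  have := km_poly_growth (2 * (n-1)) p hd E a b m t hE
    (fun y hy => by rw [hp]; exact (mn_le_nm _ _ _).trans (ht y hy)) hm hv x hx
  rw [hp, hI] at this
  exact this

noncomputable def growG (n : ℕ) (ε : ℝ) : ℝ := (growK n * ε) ^ ((1:ℝ) / (2 * (n-1) : ℕ))

lemma nm_good {n k : ℕ} (hn : 2 ≤ n) (w : Fin (n+1) → ℝ) (v : Fin k → Fin (n+1) → ℤ) (ε : ℝ)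
    (hε : 0 < ε) (a b : ℝ) (hab : a < b) (h : ∃ x ∈ Icc a b, 1 ≤ nm (Hm n w x) v) :
    volume {x | x ∈ Icc a b ∧ nm (Hm n w x) v < ε} ≤ ENNReal.ofReal (growG n ε * (b - a)) := by
  set E := {x | x ∈ Icc a b ∧ nm (Hm n w x) v < ε} with hE
  have hK := growK_pos n
  have hG : 0 < growG n ε := Real.rpow_pos_of_pos (by positivity) _
  by_contra hcon
  push Not at hcon
  obtain ⟨x, hx, hx1⟩ := h
  have hfin : volume E ≠ ⊤ := by
    refine ne_top_of_le_ne_top ?_ (measure_mono (fun y hy => hy.1 : E ⊆ Icc a b))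
    simp
  have hm : growG n ε * (b - a) < (volume E).toReal := by
    rwa [← ENNReal.ofReal_lt_iff_lt_toReal _ hfin]
    have : 0 < b - a := by linarith
    positivity
  have hba : 0 < b - a := by linarith
  have hm0 : 0 < (volume E).toReal := lt_trans (by positivity) hm
  have h1 := nm_growth hn w v E a b (volume E).toReal ε (fun y hy => hy.1) (fun y hy => hy.2.le) hm0
    (by rw [ENNReal.ofReal_toReal hfin]) x hx
  have h2 : ((b - a) / (volume E).toReal) < 1 / growG n ε := by
    rw [div_lt_div_iff₀ hm0 hG]; linarith
  have hD : 2 * (n-1) ≠ 0 := by omega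
  have h3 : ((b - a) / (volume E).toReal) ^ (2 * (n-1)) < (1 / growG n ε) ^ (2 * (n-1)) :=
    pow_lt_pow_left₀ h2 (by positivity) hD
  have h4 : growG n ε ^ (2 * (n-1)) = growK n * ε := by
    unfold growG
    rw [← Real.rpow_natCast, ← Real.rpow_mul (by positivity), one_div,
      inv_mul_cancel₀ (by exact_mod_cast hD), Real.rpow_one]
  rw [div_pow 1, one_pow, h4] at h3
  have h5 : growK n * ε * ((b - a) / (volume E).toReal) ^ (2 * (n-1)) < growK n * ε * (1 / (growK n * ε)) := by
    gcongr
  rw [mul_one_div_cancel (by positivity)] at h5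
  linarith

theorem km_thm {n : ℕ} (hn : 2 ≤ n) (w : Fin (n+1) → ℝ) (a b : ℝ) (hab : a < b) (ε : ℝ)
    (hε : 0 < ε) (hε1 : ε ≤ 1)
    (hsup : ∀ W : Submodule ℚ (Fin (n+1) → ℚ), W ≠ ⊥ → ∃ x ∈ Icc a b, 1 ≤ nm (Hm n w x) (mfam W)) :
    volume {x | x ∈ Icc a b ∧ ¬ GoodM (Hm n w x) (ε / (n+1))} ≤
      ENNReal.ofReal (KMconst (n+2) * growG n ε * (b - a)) := by
  have hK := growK_pos n
  refine le_trans (measure_mono ?_) (km_abstract (S := Submodule ℚ (Fin (n+1) → ℚ))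
    (fun U W => U ≤ W ∨ W ≤ U) (fun s t h => h.symm)
    (fun s => Or.inl le_rfl) (fun W => Module.finrank ℚ W) ?_
    (fun W y => nm (Hm n w y) (mfam W)) (fun W => nm_cont hn w _) ε (growG n ε)
    (Real.rpow_nonneg (by positivity) _) (fun W a b hab h => nm_good hn w _ ε hε a b hab h)
    (n+2) {W | W ≠ ⊥} (Finset.range (n+2)) (by simp) ?_ a b hab hsup)
  · rintro x ⟨hx, hx2⟩
    refine ⟨hx, fun hm => hx2 ?_⟩
    have := marked_good (Hm n w) x ε hε1 hm
    exact_mod_cast this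
  · rintro s t (h | h) hne heq
    · exact hne (Submodule.eq_of_le_of_finrank_eq h heq)
    · exact hne (Submodule.eq_of_le_of_finrank_eq h heq.symm).symm
  · intro t _
    have := Submodule.finrank_le t
    simp at this ⊢
    omega

open Polynomial in
lemma wr_coeff (P Q : ℝ[X]) (h : 1 ≤ P.natDegree + Q.natDegree) :
    (P * derivative Q).coeff (P.natDegree + Q.natDegree - 1) =
      P.leadingCoeff * Q.leadingCoeff * Q.natDegree := by
  rcases Nat.eq_zero_or_pos Q.natDegree with h0 | h0
  · rw [h0, Polynomial.derivative_of_natDegree_zero h0]; simp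
  · rw [show P.natDegree + Q.natDegree - 1 = P.natDegree + (Q.natDegree - 1) by omega,
      coeff_mul_add_eq_of_natDegree_le le_rfl (natDegree_derivative_le Q), coeff_derivative,
      show Q.natDegree - 1 + 1 = Q.natDegree by omega]
    simp only [leadingCoeff]
    have : ((Q.natDegree - 1 : ℕ) : ℝ) + 1 = Q.natDegree := by
      rw [Nat.cast_sub h0]; simp
    rw [this]; ring

open Polynomial in
lemma wr_ne (P Q : ℝ[X]) (hP : P ≠ 0) (hQ : Q ≠ 0) (h : P.natDegree ≠ Q.natDegree) :
    P * derivative Q - Q * derivative P ≠ 0 := by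
  intro h0
  have := congrArg (fun p => p.coeff (P.natDegree + Q.natDegree - 1)) h0
  simp only [coeff_sub, coeff_zero] at this
  rw [wr_coeff P Q (by omega)] at this
  rw [add_comm P.natDegree, wr_coeff Q P (by omega)] at this
  have h1 : P.leadingCoeff * Q.leadingCoeff * ((Q.natDegree : ℝ) - P.natDegree) = 0 := by
    linarith
  have h2 : (Q.natDegree : ℝ) - P.natDegree ≠ 0 := by
    rw [sub_ne_zero]; exact_mod_cast h.symm
  simp_all

open Polynomial in
lemma wr_indep (P Q : ℝ[X]) (h : ∀ a b : ℝ, C a * P + C b * Q = 0 → a = 0 ∧ b = 0) :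
    ∃ x : ℝ, P.eval x * (derivative Q).eval x - Q.eval x * (derivative P).eval x ≠ 0 := by
  have hP : P ≠ 0 := by rintro rfl; simpa using h 1 0
  have hQ : Q ≠ 0 := by rintro rfl; simpa using h 0 1
  have : P * derivative Q - Q * derivative P ≠ 0 := by
    by_cases hd : P.natDegree = Q.natDegree
    · set R := C P.leadingCoeff * Q + C (-Q.leadingCoeff) * P with hR
      have hR0 : R ≠ 0 := by
        intro h0
        have := h (-Q.leadingCoeff) P.leadingCoeff (by rw [add_comm]; exact h0)
        simp [hP] at this
      by_cases hd2 : P.natDegree = R.natDegree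
      · exfalso
        have h1 : R.coeff R.natDegree = 0 := by
          rw [← hd2, hR]
          simp only [coeff_add, coeff_C_mul]
          nth_rewrite 2 [hd]
          simp only [leadingCoeff]
          rw [hd]; ring
        exact hR0 (leadingCoeff_eq_zero.1 h1)
      · intro h0
        apply wr_ne P R hP hR0 hd2
        have : P * derivative R - R * derivative P =
            C P.leadingCoeff * (P * derivative Q - Q * derivative P) := by
          rw [hR]; simp only [derivative_add, derivative_C_mul]; ring
        rw [this, h0, mul_zero]
    · exact wr_ne P Q hP hQ hd
  by_contra hcon
  push Not at hcon
  apply this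
  apply Polynomial.funext
  intro x
  simpa using hcon x

lemma Um_det (n : ℕ) (x : ℝ) : (Um n x).det = 1 := by
  rw [Matrix.det_of_isUpperTriangular]
  · refine Finset.prod_eq_one fun i _ => ?_
    simp only [Um, Matrix.of_apply]
    split_ifs with h h <;> simp [h]
  · intro i j hij
    simp only [id] at hij
    simp only [Um, Matrix.of_apply]
    have h2 : j.val < i.val := hij
    split_ifs with h h h
    · omega
    · have : j.val = 0 := by omega
      simp [this]
    · subst h; omega
    · rfl

lemma castV_inj {m k : ℕ} (v : Fin k → Fin m → ℤ) (hv : LinearIndependent ℚ (castV ℚ v).col)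
    (c : Fin k → ℝ) (hc : (castV ℝ v).mulVec c = 0) : c = 0 := by
  obtain ⟨I, hI⟩ := fam_minor v hv
  unfold mn at hI
  rw [Matrix.one_mul] at hI
  refine Matrix.eq_zero_of_mulVec_eq_zero hI ?_
  ext r
  exact congrFun hc (I r)

lemma Um_castV_col {n k : ℕ} (x : ℝ) (v : Fin k → Fin (n+1) → ℤ)
    (hv : LinearIndependent ℚ (castV ℚ v).col) : LinearIndependent ℝ (Um n x * castV ℝ v).col := by
  rw [← Matrix.mulVec_injective_iff]
  rw [← Matrix.coe_mulVecLin, ← LinearMap.ker_eq_bot, LinearMap.ker_eq_bot']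
  intro c hc
  rw [Matrix.mulVecLin_apply, ← Matrix.mulVec_mulVec] at hc
  apply castV_inj v hv
  exact Matrix.eq_zero_of_mulVec_eq_zero (by rw [Um_det]; norm_num) hc

lemma UmV_zero {n k : ℕ} (x : ℝ) (v : Fin k → Fin (n+1) → ℤ) (c : Fin k) (i : Fin (n+1))
    (hi : i.val = 0) : (Um n x * castV ℝ v) i c = ∑ j : Fin (n+1), x ^ j.val * v c j := by
  simp only [Matrix.mul_apply, Um, castV, Matrix.of_apply, hi, if_true, one_ne_zero, if_false]

lemma UmV_one {n k : ℕ} (x : ℝ) (v : Fin k → Fin (n+1) → ℤ) (c : Fin k) (i : Fin (n+1))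
    (hi : i.val = 1) :
    (Um n x * castV ℝ v) i c = ∑ j : Fin (n+1), (j.val * x ^ (j.val - 1)) * v c j := by
  simp only [Matrix.mul_apply, Um, castV, Matrix.of_apply, hi, if_true, one_ne_zero, if_false]

open Polynomial in
noncomputable def vpoly {m : ℕ} (v : Fin m → ℤ) : ℝ[X] := ∑ j : Fin m, C (v j : ℝ) * X ^ j.val

open Polynomial in
lemma vpoly_coeff {m : ℕ} (v : Fin m → ℤ) (i : Fin m) : (vpoly v).coeff i.val = v i := by
  unfold vpoly
  rw [finsetSum_coeff]
  rw [Finset.sum_eq_single i]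
  · simp
  · intro j _ hj
    simp only [coeff_C_mul, coeff_X_pow]
    rw [if_neg]; simp
    intro h; exact hj (Fin.ext h.symm)
  · simp

open Polynomial in
lemma vpoly_eval {m : ℕ} (v : Fin m → ℤ) (x : ℝ) : (vpoly v).eval x = ∑ j : Fin m, x ^ j.val * v j := by
  unfold vpoly
  rw [eval_finsetSum]
  exact Finset.sum_congr rfl fun j _ => by simp [mul_comm]

open Polynomial in
lemma vpoly_deriv {m : ℕ} (v : Fin m → ℤ) (x : ℝ) :
    (derivative (vpoly v)).eval x = ∑ j : Fin m, (j.val * x ^ (j.val - 1)) * v j := by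
  unfold vpoly
  rw [derivative_sum, eval_finsetSum]
  refine Finset.sum_congr rfl fun j _ => ?_
  simp only [derivative_C_mul, derivative_X_pow, eval_mul, eval_C, eval_pow, eval_X]
  ring

lemma exists_heavy_minor {n k : ℕ} (hn : 2 ≤ n) (hk : 1 ≤ k) (v : Fin k → Fin (n+1) → ℤ)
    (hv : LinearIndependent ℚ (castV ℚ v).col) (w : Fin (n+1) → ℝ) (hw : ∀ i, 0 < w i)
    (hw0 : ∀ i, i.val = 0 → 1 ≤ w i) (hw2 : ∀ i, 2 ≤ i.val → w i ≤ 1) (hprod : 1 ≤ ∏ i, w i) :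
    ∃ I, 1 ≤ ∏ r, w (I r) ∧ mnp v I ≠ 0 := by
  classical
  have i0 : Fin (n+1) := 0
  have hfin : ∀ x I, ((Um n x * castV ℝ v).submatrix I id).det ≠ 0 → mnp v I ≠ 0 := by
    intro x I h h0
    apply h
    have := mnp_eval v I x
    rw [h0, Polynomial.eval_zero] at this
    exact this.symm
  rcases Nat.lt_or_ge k 2 with hk2 | hk2
  · have : k = 1 := by omega
    subst this
    have hv0 : vpoly (v 0) ≠ 0 := by
      intro h0
      have hvz : castV ℚ v = 0 := by
        ext j c
        have := vpoly_coeff (v 0) j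
        rw [h0, Polynomial.coeff_zero] at this
        have : v 0 j = 0 := by exact_mod_cast this.symm
        simp [castV, Subsingleton.elim c 0, this]
      have := hv.ne_zero 0
      rw [hvz] at this
      exact this rfl
    obtain ⟨x, hx⟩ : ∃ x, (vpoly (v 0)).eval x ≠ 0 := by
      by_contra hcon
      push Not at hcon
      exact hv0 (Polynomial.funext fun x => by simpa using hcon x)
    refine ⟨fun _ => 0, by simpa using hw0 0 rfl, hfin x _ ?_⟩
    rw [Matrix.det_fin_one, Matrix.submatrix_apply, UmV_zero x v _ 0 rfl]
    rw [vpoly_eval] at hx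
    exact hx
  · set c0 : Fin k := ⟨0, by omega⟩
    set c1 : Fin k := ⟨1, by omega⟩
    have hc01 : c0 ≠ c1 := by simp [c0, c1]
    obtain ⟨x, hx⟩ := wr_indep (vpoly (v c0)) (vpoly (v c1)) (by
      intro a b hab
      have := castV_inj v hv (fun c => if c = c0 then a else if c = c1 then b else 0) (by
        ext j
        have h1 := congrArg (fun p => p.coeff j.val) hab
        simp only [Polynomial.coeff_add, Polynomial.coeff_C_mul, vpoly_coeff, Polynomial.coeff_zero] at h1
        simp only [Matrix.mulVec, dotProduct, castV, Matrix.of_apply, Pi.zero_apply, mul_ite, mul_zero]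
        rw [Finset.sum_eq_add c0 c1 hc01]
        · rw [if_pos rfl, if_neg hc01.symm, if_pos rfl]; linarith
        · rintro c - ⟨h1, h2⟩; simp [h1, h2]
        · simp
        · simp)
      have h0 := congrFun this c0
      have h1 := congrFun this c1
      simp [hc01.symm] at h0 h1
      exact ⟨h0, h1⟩)
    set M := Um n x * castV ℝ v with hM
    set r0 : Fin (n+1) := ⟨0, by omega⟩
    set r1 : Fin (n+1) := ⟨1, by omega⟩
    have hr : r0 ≠ r1 := by simp [r0, r1]
    have hrow : LinearIndepOn ℝ M.row {r0, r1} := by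
      rw [LinearIndepOn.pair_iff _ hr]
      intro a b hab
      have e0 := congrFun hab c0
      have e1 := congrFun hab c1
      simp only [Pi.add_apply, Pi.smul_apply, smul_eq_mul, Pi.zero_apply, Matrix.row_apply] at e0 e1
      rw [hM, UmV_zero x v _ r0 rfl, UmV_one x v _ r1 rfl, ← vpoly_eval, ← vpoly_deriv] at e0 e1
      generalize Polynomial.eval x (vpoly (v c0)) = p at *
      generalize Polynomial.eval x (vpoly (v c1)) = q at *
      generalize Polynomial.eval x (Polynomial.derivative (vpoly (v c0))) = p' at *
      generalize Polynomial.eval x (Polynomial.derivative (vpoly (v c1))) = q' at *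
      constructor
      · have : a * (p * q' - q * p') = 0 := by linear_combination q' * e0 - p' * e1
        exact (mul_eq_zero.1 this).resolve_right hx
      · have : b * (p * q' - q * p') = 0 := by linear_combination p * e1 - q * e0
        exact (mul_eq_zero.1 this).resolve_right hx
    obtain ⟨I, hI, hsub⟩ := exists_minor M (Um_castV_col x v hv) _ hrow
    refine ⟨I, ?_, hfin x I hI⟩
    have hinj : Function.Injective I := by
      by_contra hcon
      exact hI (mn_not_inj (Um n x) v I hcon)
    have e1 : ∏ r, w (I r) = ∏ i ∈ Finset.univ.image I, w i := by
      rw [Finset.prod_image (fun a _ b _ h => hinj h)]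
    have e2 : (∏ i ∈ Finset.univ.image I, w i) * (∏ i ∈ (Finset.univ.image I)ᶜ, w i) = ∏ i, w i :=
      Finset.prod_mul_prod_compl _ _
    have e3 : ∏ i ∈ (Finset.univ.image I)ᶜ, w i ≤ 1 := by
      refine Finset.prod_le_one (fun i _ => (hw i).le) fun i hi => hw2 i ?_
      simp only [Finset.mem_compl, Finset.mem_image, Finset.mem_univ, true_and] at hi
      by_contra hlt
      apply hi
      have : i = r0 ∨ i = r1 := by
        rcases (by omega : i.val = 0 ∨ i.val = 1) with h | h
        · left; exact Fin.ext h
        · right; exact Fin.ext h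
      exact hsub (by simpa using this)
    have e4 : 0 < ∏ i ∈ Finset.univ.image I, w i := Finset.prod_pos fun i _ => hw i
    rw [e1]
    nlinarith

lemma mn_int {n k : ℕ} (z : ℤ) (v : Fin k → Fin (n+1) → ℤ) (I) : ∃ t : ℤ, mn (Um n z) v I = t := by
  let UZ : Matrix (Fin (n+1)) (Fin (n+1)) ℤ := Matrix.of fun i j =>
    if i.val = 0 then z ^ j.val else if i.val = 1 then (j.val : ℤ) * z ^ (j.val - 1) else
      if i = j then 1 else 0
  refine ⟨((UZ * castV ℤ v).submatrix I id).det, ?_⟩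
  rw [Int.cast_det]
  unfold mn
  congr 1
  ext r c
  simp only [Matrix.submatrix_apply, Matrix.mul_apply, Matrix.map_apply, Int.cast_sum, Int.cast_mul]
  refine Finset.sum_congr rfl fun j _ => ?_
  simp only [Um, UZ, castV, Matrix.of_apply, id]
  split_ifs <;> simp

lemma mnp_ge_one {n k : ℕ} (hn : 2 ≤ n) (v : Fin k → Fin (n+1) → ℤ) (I) (h : mnp v I ≠ 0) :
    ∃ y ∈ Icc (0:ℝ) (2 * (n-1) : ℕ), 1 ≤ |(mnp v I).eval y| := by
  have : ∃ z ∈ (Finset.range (2 * (n-1) + 1)), (mnp v I).eval (z : ℝ) ≠ 0 := by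
    by_contra hcon
    push Not at hcon
    apply h
    refine Polynomial.eq_zero_of_natDegree_lt_card_of_eval_eq_zero' (mnp v I)
      ((Finset.range (2 * (n-1) + 1)).map ⟨(fun z : ℕ => (z:ℝ)), Nat.cast_injective⟩) ?_ ?_
    · intro i hi
      simp only [Finset.mem_map] at hi
      obtain ⟨z, hz, rfl⟩ := hi
      exact hcon z hz
    · rw [Finset.card_map, Finset.card_range]
      have := mnp_degree hn v I
      omega
  obtain ⟨z, hz, hz2⟩ := this
  rw [Finset.mem_range] at hz
  refine ⟨z, ⟨by positivity, by exact_mod_cast (by omega : z ≤ 2 * (n-1))⟩, ?_⟩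
  rw [mnp_eval] at hz2 ⊢
  obtain ⟨t, ht⟩ := mn_int (z : ℤ) v I
  rw [Int.cast_natCast] at ht
  rw [ht] at hz2 ⊢
  have : t ≠ 0 := by exact_mod_cast hz2
  exact_mod_cast Int.one_le_abs this

lemma finrank_pos_of_ne_bot {m : ℕ} (W : Submodule ℚ (Fin m → ℚ)) (hW : W ≠ ⊥) :
    1 ≤ Module.finrank ℚ W := by
  rw [Nat.one_le_iff_ne_zero]
  intro h
  exact hW (Submodule.finrank_eq_zero.1 h)

lemma km1_sup {n : ℕ} (hn : 2 ≤ n) (a b : ℝ) (hab : a < b) (ha : 0 ≤ a) (hb : b ≤ 1) :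
    ∃ c : ℝ, 0 < c ∧ c ≤ 1 ∧ ∀ w : Fin (n+1) → ℝ, (∀ i, 0 < w i) →
      (∀ i, i.val = 0 → 1 ≤ w i) → (∀ i, 2 ≤ i.val → w i ≤ 1) → (1 ≤ ∏ i, w i) →
      ∀ W : Submodule ℚ (Fin (n+1) → ℚ), W ≠ ⊥ → ∃ x ∈ Icc a b, c ≤ nm (Hm n w x) (mfam W) := by
  set D := 2 * (n-1) with hD
  have hK := growK_pos n
  have hba : 0 < b - a := by linarith
  set L : ℝ := growK n * (((D:ℝ) + 1 - 0) / (b - a)) ^ D with hL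
  have hLpos : 0 < L := by
    have : (0:ℝ) < (D:ℝ) + 1 - 0 := by rw [sub_zero]; positivity
    positivity
  refine ⟨min 1 (1 / (2 * L)), lt_min one_pos (by positivity), min_le_left _ _, ?_⟩
  intro w hw hw0 hw2 hprod W hW
  obtain ⟨I, hI1, hI2⟩ := exists_heavy_minor hn (finrank_pos_of_ne_bot W hW) (mfam W) (mfam_fam W).2
    w hw hw0 hw2 hprod
  obtain ⟨y, hy, hy1⟩ := mnp_ge_one hn (mfam W) I hI2
  by_contra hcon
  push Not at hcon
  have := km_poly_growth D (mnp (mfam W) I) (mnp_degree hn _ _) (Icc a b) 0 (D+1) (b - a)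
    (min 1 (1 / (2 * L)))
    (fun z hz => ⟨by linarith [hz.1], by have : (0:ℝ) ≤ D := by positivity
                                         linarith [hz.2]⟩)
    (fun z hz => by
      have h1 := (mn_le_nm _ _ I).trans (hcon z hz).le
      rw [mn_Hm, abs_mul, ← mnp_eval, abs_of_nonneg (by linarith)] at h1
      exact (le_mul_of_one_le_left (abs_nonneg _) hI1).trans h1) hba (by simp) y
    ⟨hy.1, by linarith [hy.2]⟩
  have h2 : growK n * min 1 (1 / (2 * L)) * (((D:ℝ) + 1 - 0) / (b - a)) ^ D =
    L * min 1 (1 / (2 * L)) := by rw [hL]; ring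
  have h3 : L * min 1 (1 / (2 * L)) ≤ 1 / 2 := by
    calc _ ≤ L * (1 / (2 * L)) := by gcongr; exact min_le_right _ _
      _ = 1 / 2 := by field_simp
  have h4 : |Polynomial.eval y (mnp (mfam W) I)| ≤
    growK n * min 1 (1 / (2 * L)) * (((D:ℝ) + 1 - 0) / (b - a)) ^ D := this
  linarith

lemma Hm_smul {n : ℕ} (w : Fin (n+1) → ℝ) (x s : ℝ) : Hm n (fun i => s * w i) x = s • Hm n w x := by
  ext i j; simp [Hm, mul_assoc]

lemma nm_smul {n k : ℕ} (w : Fin (n+1) → ℝ) (x s : ℝ) (hs : 0 ≤ s) (v : Fin k → Fin (n+1) → ℤ) :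
    nm (Hm n (fun i => s * w i) x) v = s ^ k * nm (Hm n w x) v := by
  unfold nm
  have : (fun I : Fin k → Fin (n+1) => mn (Hm n (fun i => s * w i) x) v I) =
      s ^ k • fun I : Fin k → Fin (n+1) => mn (Hm n w x) v I := by
    ext I
    simp only [mn_Hm, Finset.prod_mul_distrib, Finset.prod_const, Finset.card_univ, Fintype.card_fin,
      Pi.smul_apply, smul_eq_mul]
    ring
  rw [this, norm_smul, Real.norm_of_nonneg (by positivity)]

lemma good_smul {n : ℕ} (w : Fin (n+1) → ℝ) (x s κ : ℝ) (hs : 0 < s) :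
    GoodM (Hm n (fun i => s * w i) x) κ ↔ GoodM (Hm n w x) (κ / s) := by
  unfold GoodM
  refine forall_congr' fun P => forall_congr' fun _ => ?_
  rw [Hm_smul, Matrix.smul_mulVec, norm_smul, Real.norm_of_nonneg hs.le, div_le_iff₀ hs, mul_comm]

theorem km1 {n : ℕ} (hn : 2 ≤ n) (a b : ℝ) (hab : a < b) (ha : 0 ≤ a) (hb : b ≤ 1) :
    ∃ c : ℝ, 0 < c ∧ ∀ w : Fin (n+1) → ℝ, (∀ i, 0 < w i) →
      (∀ i, i.val = 0 → 1 ≤ w i) → (∀ i, 2 ≤ i.val → w i ≤ 1) → (1 ≤ ∏ i, w i) →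
      ∀ ε, 0 < ε → ε ≤ 1 → volume {x | x ∈ Icc a b ∧ ¬ GoodM (Hm n w x) (c * ε)} ≤
        ENNReal.ofReal (KMconst (n+2) * growG n ε * (b - a)) := by
  obtain ⟨c, hc, hc1, h⟩ := km1_sup hn a b hab ha hb
  refine ⟨c / (n+1), by positivity, ?_⟩
  intro w hw hw0 hw2 hprod ε hε hε1
  have := km_thm hn (fun i => c⁻¹ * w i) a b hab ε hε hε1 (by
    intro W hW
    obtain ⟨x, hx, hx2⟩ := h w hw hw0 hw2 hprod W hW
    refine ⟨x, hx, ?_⟩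
    rw [nm_smul _ _ _ (by positivity)]
    have hk := finrank_pos_of_ne_bot W hW
    have h1 : c⁻¹ ≤ c⁻¹ ^ (Module.finrank ℚ W) :=
      le_self_pow₀ (one_le_inv_iff₀.2 ⟨hc, hc1⟩) (by omega)
    calc (1:ℝ) = c⁻¹ * c := by field_simp
      _ ≤ _ := by gcongr)
  convert! this using 6
  rw [good_smul _ _ _ _ (by positivity)]
  congr! 1
  field_simp

lemma minkowski_forms {k : ℕ} (B : Matrix (Fin k) (Fin k) ℝ) (hB : B.det ≠ 0) (t : ℝ) (ht : 0 < t)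
    (h : |B.det| < t ^ k) : ∃ z : Fin k → ℤ, z ≠ 0 ∧ ‖B.mulVec (fun c => (z c : ℝ))‖ ≤ t := by
  set b := Pi.basisFun ℝ (Fin k)
  set f := Matrix.toLin' B
  have hf : LinearMap.det f = B.det := LinearMap.det_toLin' B
  have hF := ZSpan.isAddFundamentalDomain' b volume
  have hvol : volume (ZSpan.fundamentalDomain b) = 1 := by
    rw [ZSpan.volume_fundamentalDomain]
    simp [b]
    have : (Matrix.of ⇑(Pi.basisFun ℝ (Fin k))) = 1 := by
      ext i j
      simp [Matrix.one_apply, Pi.single_apply, eq_comm]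
    rw [this]; simp
  have hs : volume (f ⁻¹' Metric.ball (0 : Fin k → ℝ) t) =
      ENNReal.ofReal |(B.det)⁻¹| * ENNReal.ofReal ((2 * t) ^ k) := by
    rw [Measure.addHaar_preimage_linearMap _ (by rw [hf]; exact hB), hf, Real.volume_pi_ball _ ht]
    simp
  have : Countable (Submodule.span ℤ (range b)).toAddSubgroup :=
    inferInstanceAs (Countable (Submodule.span ℤ (range b)))
  obtain ⟨x, hx0, hx⟩ := exists_ne_zero_mem_lattice_of_measure_mul_two_pow_lt_measure
    (s := f ⁻¹' Metric.ball (0 : Fin k → ℝ) t) hF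
    (by intro x hx; simpa using hx)
    ((convex_ball _ _).linear_preimage f) (by
      rw [hvol, hs, ← ENNReal.ofReal_mul (abs_nonneg _)]
      simp only [Module.finrank_fintype_fun_eq_card, Fintype.card_fin, one_mul]
      rw [show (2 : ℝ≥0∞) = ENNReal.ofReal 2 by simp, ← ENNReal.ofReal_pow (by norm_num)]
      refine (ENNReal.ofReal_lt_ofReal_iff (by positivity)).2 ?_
      rw [mul_pow, abs_inv]
      have hp : 0 < |B.det| := abs_pos.2 hB
      rw [inv_mul_eq_div, lt_div_iff₀ hp]
      exact mul_lt_mul_of_pos_left h (by positivity))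
  have hxm := x.2
  have hxm' : (x : Fin k → ℝ) ∈ Submodule.span ℤ (range b) := hxm
  rw [b.mem_span_iff_repr_mem ℤ] at hxm'
  choose z hz using hxm'
  refine ⟨z, ?_, ?_⟩
  · rintro rfl
    refine hx0 ?_
    ext i
    have := hz i
    simp [b] at this
    simp [← this]
  · have : (fun c => (z c : ℝ)) = (x : Fin k → ℝ) := by
      ext i
      have := hz i
      simpa [b] using this
    rw [this]
    have h2 : f (x : Fin k → ℝ) ∈ Metric.ball (0 : Fin k → ℝ) t := hx
    rw [mem_ball_zero_iff] at h2
    exact h2.le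

lemma minor_coeff {m k : ℕ} (M : Matrix (Fin m) (Fin k) ℝ) (I : Fin k → Fin m)
    (hI : (M.submatrix I id).det ≠ 0)
    (hmax : ∀ J : Fin k → Fin m, |(M.submatrix J id).det| ≤ |(M.submatrix I id).det|)
    (z : Fin k → ℝ) (t : ℝ) (hz : ‖(M.submatrix I id).mulVec z‖ ≤ t) (i : Fin m) :
    |M.mulVec z i| ≤ k * t := by
  set B := M.submatrix I id
  have hc : ∀ c, ∑ r, B.transpose.cramer (M i) r * B r c = B.det * M i c := by
    intro c
    have := congrFun (Matrix.mulVec_cramer B.transpose (M i)) c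
    simp only [Matrix.mulVec, dotProduct, Matrix.transpose_apply, Pi.smul_apply, smul_eq_mul,
      Matrix.det_transpose] at this
    rw [← this]
    exact Finset.sum_congr rfl fun r _ => mul_comm _ _
  have hcr : ∀ r, |B.transpose.cramer (M i) r| ≤ |B.det| := by
    intro r
    rw [Matrix.cramer_transpose_apply]
    refine le_trans (le_of_eq ?_) (hmax (Function.update I r i))
    congr 2
    ext a c
    by_cases h : a = r
    · subst h; simp
    · simp [Matrix.updateRow_ne h, Function.update_of_ne h, B]
  have hB : 0 < |B.det| := abs_pos.2 hI
  have key : B.det * M.mulVec z i = ∑ r, B.transpose.cramer (M i) r * B.mulVec z r := by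
    simp only [Matrix.mulVec, dotProduct, Finset.mul_sum]
    rw [Finset.sum_comm]
    refine Finset.sum_congr rfl fun c _ => ?_
    rw [← mul_assoc, ← hc c, Finset.sum_mul]
    refine Finset.sum_congr rfl fun r _ => by ring
  have : |B.det| * |M.mulVec z i| ≤ |B.det| * (k * t) := by
    rw [← abs_mul, key]
    refine (Finset.abs_sum_le_sum_abs _ _).trans ?_
    have : ∀ r ∈ Finset.univ, |B.transpose.cramer (M i) r * B.mulVec z r| ≤ |B.det| * t := by
      intro r _
      rw [abs_mul]
      exact mul_le_mul (hcr r) ((norm_le_pi_norm (B.mulVec z) r).trans hz) (abs_nonneg _) hB.le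
    refine (Finset.sum_le_sum this).trans (le_of_eq ?_)
    simp; ring
  exact le_of_mul_le_mul_left this hB

lemma good_nm {m k : ℕ} (hm : 0 < m) (hk : 0 < k) (hkm : k ≤ m) (H : Matrix (Fin m) (Fin m) ℝ)
    (hH : H.det ≠ 0)
    (v : Fin k → Fin m → ℤ) (hv : LinearIndependent ℚ (castV ℚ v).col) (κ : ℝ) (hκ : 0 < κ)
    (hg : GoodM H κ) : (κ / (2 * m)) ^ k ≤ nm H v := by
  by_contra hlt
  push Not at hlt
  have hm' : (0:ℝ) < m := by exact_mod_cast hm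
  have hinj : ∀ c, (H * castV ℝ v).mulVec c = 0 → c = 0 := by
    intro c hc
    rw [← Matrix.mulVec_mulVec] at hc
    exact castV_inj v hv c (Matrix.eq_zero_of_mulVec_eq_zero hH hc)
  have hli : LinearIndependent ℝ (H * castV ℝ v).col := by
    rw [← Matrix.mulVec_injective_iff]
    intro a b hab
    have : (H * castV ℝ v).mulVec (a - b) = 0 := by
      rw [Matrix.mulVec_sub]; exact sub_eq_zero.2 hab
    exact sub_eq_zero.1 (hinj _ this)
  obtain ⟨I0, hI0, -⟩ := exists_minor (H * castV ℝ v) hli ∅ (linearIndepOn_empty _ _)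
  obtain ⟨I, hI⟩ := nm_attained hm H v
  have hpos : 0 < nm H v := lt_of_lt_of_le (abs_pos.2 hI0) (mn_le_nm H v I0)
  have hdet : ((H * castV ℝ v).submatrix I id).det ≠ 0 := by
    have : 0 < |mn H v I| := hI ▸ hpos
    exact abs_pos.1 this
  obtain ⟨z, hz0, hz⟩ := minkowski_forms _ hdet (κ / (2 * m)) (by positivity) (by
    change |mn H v I| < _
    rw [hI]; exact hlt)
  have hb := minor_coeff _ I hdet (fun J => by
    change |mn H v J| ≤ |mn H v I|
    rw [hI]; exact mn_le_nm H v J) _ _ hz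
  let P : Fin m → ℤ := fun j => ∑ c, v c j * z c
  have hP : (fun j => (P j : ℝ)) = (castV ℝ v).mulVec (fun c => (z c : ℝ)) := by
    ext j
    simp [P, Matrix.mulVec, dotProduct, castV]
  have hP0 : P ≠ 0 := by
    intro h0
    have : (castV ℝ v).mulVec (fun c => (z c : ℝ)) = 0 := by
      rw [← hP, h0]; ext; simp
    have := castV_inj v hv _ this
    apply hz0
    ext c
    have := congrFun this c
    simpa using this
  have h1 := hg P hP0
  rw [hP, Matrix.mulVec_mulVec] at h1
  have h2 : ‖(H * castV ℝ v).mulVec (fun c => (z c : ℝ))‖ ≤ κ / 2 := by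
    refine (pi_norm_le_iff_of_nonneg (by positivity)).2 fun i => ?_
    refine (hb i).trans ?_
    calc (k:ℝ) * (κ / (2 * m)) ≤ m * (κ / (2*m)) := by
          have : (k:ℝ) ≤ m := by exact_mod_cast hkm
          gcongr
      _ = κ / 2 := by field_simp
  linarith

lemma Hm_det {n : ℕ} (w : Fin (n+1) → ℝ) (x : ℝ) : (Hm n w x).det = ∏ i, w i := by
  unfold Hm
  rw [Matrix.det_mul_column, Um_det, mul_one]

lemma growK_one (n : ℕ) : 1 ≤ growK n := by
  unfold growK
  have h1 : (0:ℝ) ≤ (2 * (n-1) : ℕ) := by positivity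
  exact one_le_mul_of_one_le_of_one_le (by linarith) (one_le_pow₀ (by linarith))

theorem km2 {n : ℕ} (hn : 2 ≤ n) (w : Fin (n+1) → ℝ) (hw : ∀ i, 0 < w i) (x0 κ D a b M : ℝ)
    (hab : a < b) (ha : x0 - D ≤ a) (hb : b ≤ x0 + D) (hx0 : 0 ≤ D)
    (hg : GoodM (Hm n w x0) κ) (hM : n + 1 ≤ M)
    (hκ : growK n * (2 * (n+1)) * M * (2 * D / (b - a)) ^ (2 * (n-1)) < κ) :
    volume {x | x ∈ Icc a b ∧ ¬ GoodM (Hm n w x) 1} ≤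
      ENNReal.ofReal (KMconst (n+2) * growG n ((n+1) / M) * (b - a)) := by
  have hK := growK_pos n
  have hn1 : (0:ℝ) < n + 1 := by positivity
  have hMp : 0 < M := by linarith
  have hba : 0 < b - a := by linarith
  have hDba : 1 ≤ 2 * D / (b - a) := by
    rw [le_div_iff₀ hba]; linarith
  have hA : 1 ≤ (2 * D / (b - a)) ^ (2 * (n-1)) := one_le_pow₀ hDba
  have hκ0 : 0 < κ := lt_of_le_of_lt (by positivity) hκ
  have hg' : GoodM (Hm n (fun i => M⁻¹ * w i) x0) (κ / M) := by
    rw [good_smul w x0 M⁻¹ _ (by positivity)]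
    convert hg using 1
    field_simp
  have key := km_thm hn (fun i => M⁻¹ * w i) a b hab ((n+1)/M) (by positivity)
    ((div_le_one hMp).2 hM) (by
      intro W hW
      by_contra hcon
      push Not at hcon
      have hk := finrank_pos_of_ne_bot W hW
      have hkm : Module.finrank ℚ W ≤ n + 1 := by
        simpa using Submodule.finrank_le W
      have hgn := good_nm (Nat.succ_pos n) hk hkm (Hm n (fun i => M⁻¹ * w i) x0)
        (by rw [Hm_det]; exact (Finset.prod_pos fun i _ => mul_pos (inv_pos.2 hMp) (hw i)).ne')
        (mfam W) (mfam_fam W).2 (κ / M) (by positivity) hg'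
      have hgr := nm_growth hn (fun i => M⁻¹ * w i) (mfam W) (Icc a b) (x0 - D) (x0 + D) (b - a) 1
        (Icc_subset_Icc ha hb) (fun x hx => (hcon x hx).le) hba (by simp) x0 (by constructor <;> linarith)
      have e : x0 + D - (x0 - D) = 2 * D := by ring
      rw [e, mul_one] at hgr
      push_cast at hgn
      have hs : growK n * (2 * D / (b - a)) ^ (2 * (n-1)) < κ / M / (2 * (n+1)) := by
        rw [lt_div_iff₀ (by positivity), lt_div_iff₀ hMp]
        calc _ = growK n * (2 * (n+1)) * M * (2 * D / (b - a)) ^ (2 * (n-1)) := by ring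
          _ < κ := hκ
      have hK1 : 1 ≤ growK n := growK_one n
      have h1 : 1 ≤ κ / M / (2 * (n+1)) := by nlinarith
      have h2 := le_self_pow₀ h1 (Nat.one_le_iff_ne_zero.1 hk)
      linarith)
  refine le_trans (measure_mono ?_) key
  intro x hx
  refine ⟨hx.1, fun h => hx.2 ?_⟩
  rw [good_smul w x M⁻¹ _ (by positivity)] at h
  convert h using 1
  field_simp

open scoped RealInnerProductSpace in
lemma transfer_aux {E : Type*} [NormedAddCommGroup E] [InnerProductSpace ℝ E] [FiniteDimensional ℝ E]
    {A : Type*} [AddCommGroup A] (k : ℕ) :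
    ∀ (U : Submodule ℝ E) (_ : Module.finrank ℝ U ≤ k) (f : A →+ E) (χ : A →+ ℝ) (l : ℝ) (_ : 0 < l)
      (_ : ∀ a, f a ∈ U) (_ : ∀ a, f a ≠ 0 → l ≤ ‖f a‖) (_ : ∀ a, f a = 0 → ∃ c : ℤ, χ a = c) (y : E),
      ∃ z, z - y ∈ U ∧ ‖z - y‖ ≤ (2 ^ k - 1) / l ∧ ∀ a, ∃ c : ℤ, ⟪f a, z⟫ = χ a + c := by
  have triv : ∀ (U : Submodule ℝ E) (f : A →+ E) (χ : A →+ ℝ) (l : ℝ) (_ : 0 < l) (k : ℕ)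
      (_ : ∀ a, f a = 0) (_ : ∀ a, f a = 0 → ∃ c : ℤ, χ a = c) (y : E),
      ∃ z, z - y ∈ U ∧ ‖z - y‖ ≤ (2 ^ k - 1) / l ∧ ∀ a, ∃ c : ℤ, ⟪f a, z⟫ = χ a + c := by
    intro U f χ l hl k h0 h1 y
    refine ⟨y, by simp, by
      have : (1:ℝ) ≤ 2 ^ k := one_le_pow₀ (by norm_num)
      rw [sub_self, norm_zero]; exact div_nonneg (by linarith) hl.le, fun a => ?_⟩
    obtain ⟨c, hc⟩ := h1 a (h0 a)
    refine ⟨-c, by rw [h0 a, hc]; simp⟩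
  induction k with
  | zero =>
    intro U hU f χ l hl hfU hf hχ y
    have : U = ⊥ := Submodule.finrank_eq_zero.1 (Nat.le_zero.1 hU)
    subst this
    exact triv _ f χ l hl 0 (fun a => by simpa using hfU a) hχ y
  | succ k ih =>
    intro U hU f χ l hl hfU hf hχ y
    by_cases h0 : ∀ a, f a = 0
    · exact triv _ f χ l hl _ h0 hχ y
    push Not at h0
    obtain ⟨a0, ha0⟩ := h0
    -- near-minimal vector
    obtain ⟨a1, ha1, hmin⟩ : ∃ a1, f a1 ≠ 0 ∧ ∀ a, f a ≠ 0 → ‖f a1‖ ≤ 11 / 10 * ‖f a‖ := by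
      let S : Set ℝ := (fun a => ‖f a‖) '' {a | f a ≠ 0}
      have hSne : S.Nonempty := ⟨_, a0, ha0, rfl⟩
      have hSb : BddBelow S := ⟨0, by rintro _ ⟨a, -, rfl⟩; exact norm_nonneg _⟩
      have hpos : l ≤ sInf S := le_csInf hSne (by rintro _ ⟨a, h, rfl⟩; exact hf a h)
      obtain ⟨_, ⟨a1, h1, rfl⟩, h2⟩ := exists_lt_of_csInf_lt hSne
        (show sInf S < 11 / 10 * sInf S by linarith)
      refine ⟨a1, h1, fun a ha => h2.le.trans ?_⟩
      have : sInf S ≤ ‖f a‖ := csInf_le hSb ⟨a, ha, rfl⟩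
      linarith
    set d := f a1 with hd
    have hdn : 0 < ‖d‖ := norm_pos_iff.2 ha1
    have hld : l ≤ ‖d‖ := hf a1 ha1
    have hdd : ⟪d, d⟫ = ‖d‖ ^ 2 := real_inner_self_eq_norm_sq d
    let cf : E →ₗ[ℝ] ℝ := (‖d‖ ^ 2)⁻¹ • (innerₛₗ ℝ d)
    have hcf : ∀ v, cf v = (‖d‖ ^ 2)⁻¹ * ⟪d, v⟫ := fun v => by simp [cf]
    let π : E →ₗ[ℝ] E := LinearMap.id - cf.smulRight d
    have hπ : ∀ v, π v = v - cf v • d := fun v => by simp [π]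
    have hperp : ∀ v, ⟪d, π v⟫ = 0 := by
      intro v
      rw [hπ, inner_sub_right, inner_smul_right, hdd, hcf]
      field_simp
      ring
    -- choice of s
    let r : ℤ := round (⟪d, y⟫ - χ a1)
    let s : ℝ := χ a1 + r
    have hs : |s - ⟪d, y⟫| ≤ 1 / 2 := by
      have := abs_sub_round (⟪d, y⟫ - χ a1)
      rw [abs_sub_comm]
      have e : ⟪d, y⟫ - s = ⟪d, y⟫ - χ a1 - (round (⟪d, y⟫ - χ a1) : ℤ) := by
        change ⟪d, y⟫ - (χ a1 + (round (⟪d, y⟫ - χ a1) : ℤ)) = _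
        ring
      rw [e]; exact this
    let f' : A →+ E := π.toAddMonoidHom.comp f
    have hf' : ∀ a, f' a = π (f a) := fun a => rfl
    let χ' : A →+ ℝ := χ - (AddMonoidHom.mulRight s).comp (cf.toAddMonoidHom.comp f)
    have hχ' : ∀ a, χ' a = χ a - cf (f a) * s := fun a => by simp [χ']
    have hdecomp : ∀ a, f (a - round (cf (f a)) • a1) = π (f a) + (cf (f a) - round (cf (f a))) • d := by
      intro a
      rw [map_sub, map_zsmul, hπ, ← hd, sub_smul, Int.cast_smul_eq_zsmul]
      abel
    have hnorm : ∀ a, ‖f (a - round (cf (f a)) • a1)‖ ^ 2 =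
        ‖π (f a)‖ ^ 2 + (cf (f a) - round (cf (f a))) ^ 2 * ‖d‖ ^ 2 := by
      intro a
      rw [hdecomp, norm_add_sq_real, inner_smul_right, real_inner_comm, hperp, norm_smul, mul_pow,
        Real.norm_eq_abs, sq_abs]
      ring
    have hround : ∀ a, (cf (f a) - round (cf (f a))) ^ 2 ≤ 1 / 4 := by
      intro a
      have := abs_sub_round (cf (f a))
      have h3 := abs_le.1 this
      nlinarith
    have hbig : ∀ a, f (a - round (cf (f a)) • a1) ≠ 0 → ‖d‖ / 2 ≤ ‖π (f a)‖ := by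
      intro a ha
      have h1 := hmin _ ha
      have h2 := hnorm a
      have h3 := hround a
      have h4 : ‖d‖ ^ 2 ≤ (11/10)^2 * ‖f (a - round (cf (f a)) • a1)‖ ^ 2 := by
        rw [← mul_pow]; exact pow_le_pow_left₀ hdn.le h1 2
      by_contra h5
      push Not at h5
      have h6 : ‖π (f a)‖ ^ 2 ≤ (‖d‖/2) ^ 2 := pow_le_pow_left₀ (norm_nonneg _) h5.le 2
      have h7 : 0 < ‖d‖ ^ 2 := by positivity
      nlinarith
    let U' : Submodule ℝ E := U ⊓ LinearMap.ker (innerₛₗ ℝ d)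
    have hlt : Module.finrank ℝ U' < Module.finrank ℝ U := by
      apply Submodule.finrank_lt_finrank_of_lt
      refine lt_of_le_of_ne inf_le_left fun h => ?_
      have : d ∈ U' := by rw [h]; exact hfU a1
      have h2 : ⟪d, d⟫ = 0 := by simpa [U'] using this.2
      rw [hdd] at h2
      have : 0 < ‖d‖ ^ 2 := by positivity
      linarith
    obtain ⟨z', hz1, hz2, hz3⟩ := ih U' (by omega) f' χ' (l / 2) (by positivity)
      (by
        intro a
        refine ⟨?_, ?_⟩
        · rw [hf', hπ]; exact U.sub_mem (hfU a) (U.smul_mem _ (hfU a1))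
        · show innerₛₗ ℝ d (f' a) = 0
          simpa [hf'] using hperp (f a))
      (by
        intro a ha
        rw [hf'] at ha ⊢
        refine le_trans (by linarith) (hbig a ?_)
        intro h
        have := hnorm a
        rw [h] at this
        simp only [norm_zero, ne_eq, OfNat.ofNat_ne_zero, not_false_eq_true, zero_pow] at this
        have h1 : 0 < ‖π (f a)‖ ^ 2 := by have := norm_pos_iff.2 ha; positivity
        have h2 : 0 ≤ (cf (f a) - round (cf (f a))) ^ 2 * ‖d‖ ^ 2 := by positivity
        linarith)
      (by
        intro a ha
        rw [hf'] at ha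
        have h0 : f (a - round (cf (f a)) • a1) = 0 := by
          by_contra h
          have := hbig a h
          rw [ha, norm_zero] at this
          linarith
        obtain ⟨c, hc⟩ := hχ _ h0
        have h1 := hnorm a
        rw [h0, ha] at h1
        simp only [norm_zero, ne_eq, OfNat.ofNat_ne_zero, not_false_eq_true, zero_pow, zero_add] at h1
        have h2 : cf (f a) - round (cf (f a)) = 0 := by
          rcases mul_eq_zero.1 h1.symm with h | h
          · exact pow_eq_zero_iff (two_ne_zero) |>.1 h
          · exact absurd h (by positivity)
        rw [map_sub, map_zsmul, zsmul_eq_mul] at hc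
        refine ⟨c - round (cf (f a)) * r, ?_⟩
        have h3 : cf (f a) = round (cf (f a)) := by linarith
        rw [hχ', h3]
        simp only [round_intCast, s]
        push_cast
        linarith)
      y
    have hz4 : ⟪d, z'⟫ = ⟪d, y⟫ := by
      have : ⟪d, z' - y⟫ = 0 := by simpa using hz1.2
      rw [inner_sub_right] at this
      linarith
    refine ⟨z' + ((s - ⟪d, y⟫) * (‖d‖^2)⁻¹) • d, ?_, ?_, ?_⟩
    · rw [add_sub_right_comm]
      exact U.add_mem hz1.1 (U.smul_mem _ (hfU a1))
    · rw [add_sub_right_comm]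
      refine (norm_add_le _ _).trans ?_
      have h1 : ‖((s - ⟪d, y⟫) * (‖d‖^2)⁻¹) • d‖ ≤ 1 / (2 * l) := by
        rw [norm_smul, norm_mul, Real.norm_eq_abs, norm_inv, norm_pow, norm_norm]
        calc |s - ⟪d, y⟫| * (‖d‖^2)⁻¹ * ‖d‖ ≤ 1 / 2 * (‖d‖^2)⁻¹ * ‖d‖ := by gcongr
          _ = 1 / (2 * ‖d‖) := by field_simp
          _ ≤ _ := by gcongr
      calc _ ≤ (2 ^ k - 1) / (l / 2) + 1 / (2 * l) := add_le_add hz2 h1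
        _ = (2 ^ (k+1) - 3 / 2) / l := by rw [pow_succ]; field_simp; ring
        _ ≤ _ := by gcongr; norm_num
    · intro a
      obtain ⟨c, hc⟩ := hz3 a
      refine ⟨c, ?_⟩
      rw [hf', hχ'] at hc
      have e : f a = π (f a) + cf (f a) • d := by rw [hπ]; abel
      have h5 : ⟪d, z' + ((s - ⟪d, y⟫) * (‖d‖^2)⁻¹) • d⟫ = s := by
        rw [inner_add_right, inner_smul_right, hdd, hz4]
        field_simp
        ring
      have h6 : ⟪π (f a), z' + ((s - ⟪d, y⟫) * (‖d‖^2)⁻¹) • d⟫ = ⟪π (f a), z'⟫ := by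
        rw [inner_add_right, inner_smul_right, real_inner_comm d, hperp]
        simp
      calc ⟪f a, z' + ((s - ⟪d, y⟫) * (‖d‖^2)⁻¹) • d⟫
          = ⟪π (f a) + cf (f a) • d, z' + ((s - ⟪d, y⟫) * (‖d‖^2)⁻¹) • d⟫ := by rw [← e]
        _ = χ a + c := by
          rw [inner_add_left, real_inner_smul_left, h5, h6, hc]
          ring

/-- Transference: a good matrix makes the dual lattice dense. -/
lemma good_cover {m : ℕ} (H : Matrix (Fin m) (Fin m) ℝ) (κ : ℝ) (hκ : 0 < κ) (hg : GoodM H κ)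
    (t : Fin m → ℝ) : ∃ (k : Fin m → ℤ) (z : Fin m → ℝ), (∀ i, |z i| ≤ 2 ^ m / κ) ∧
      ∀ j, (k j : ℝ) - t j = ∑ i, H i j * z i := by
  let g : (Fin m → ℤ) →+ (Fin m → ℝ) :=
    (H.mulVecLin.toAddMonoidHom).comp ((Int.castAddHom ℝ).compLeft (Fin m))
  have hgd : ∀ P, g P = H.mulVec (fun j => (P j : ℝ)) := fun P => rfl
  let f : (Fin m → ℤ) →+ EuclideanSpace ℝ (Fin m) :=
    ((WithLp.linearEquiv 2 ℝ (Fin m → ℝ)).symm.toLinearMap.toAddMonoidHom).comp g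
  have hf : ∀ P i, f P i = ∑ j, H i j * P j := fun P i => rfl
  let χ : (Fin m → ℤ) →+ ℝ := AddMonoidHom.mk' (fun P => - ∑ j, (P j : ℝ) * t j) (by
    intro a b
    simp only [Pi.add_apply, Int.cast_add, add_mul, Finset.sum_add_distrib]
    ring)
  have hχ : ∀ P, χ P = - ∑ j, (P j : ℝ) * t j := fun P => rfl
  have hfn : ∀ P, P ≠ 0 → κ ≤ ‖f P‖ := by
    intro P hP
    refine (hg P hP).trans ?_
    refine (pi_norm_le_iff_of_nonneg (norm_nonneg _)).2 fun i => ?_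
    exact PiLp.norm_apply_le (f P) i
  obtain ⟨z, -, hz, hz2⟩ := transfer_aux (E := EuclideanSpace ℝ (Fin m)) m ⊤ (by simp) f χ κ hκ
    (by simp) (fun P hP => hfn P (by rintro rfl; simp at hP))
    (fun P hP => by
      have : P = 0 := by
        by_contra h
        have := hfn P h
        rw [hP, norm_zero] at this
        linarith
      exact ⟨0, by rw [this]; simp⟩) 0
  choose c hc using hz2
  refine ⟨fun j => c (Pi.single j 1), fun i => z i, fun i => ?_, fun j => ?_⟩
  · refine (PiLp.norm_apply_le z i).trans ?_
    rw [sub_zero] at hz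
    refine hz.trans ?_
    gcongr
    linarith
  · have := hc (Pi.single j 1)
    rw [hχ, PiLp.inner_apply] at this
    simp only [hf, RCLike.inner_apply, conj_trivial] at this
    simp only [Pi.single_apply, Int.cast_ite, Int.cast_one, Int.cast_zero, mul_ite, mul_one, mul_zero, ite_mul, one_mul, zero_mul,
      Finset.sum_ite_eq', Finset.mem_univ, if_true] at this
    rw [show (∑ i, H i j * z i) = ∑ i, z i * H i j from Finset.sum_congr rfl fun _ _ => mul_comm _ _, this]
    ring

open scoped Pointwise in
lemma good_count {m : ℕ} (H : Matrix (Fin m) (Fin m) ℝ) (hH : H.det ≠ 0) (κ : ℝ) (hκ : 0 < κ)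
    (hg : GoodM H κ)
    (t : Fin m → ℝ) (R : ℝ) (hR : 0 ≤ R) (S : Finset (Fin m → ℤ))
    (hS : ∀ k ∈ S, ∃ z : Fin m → ℝ, (∀ i, |z i| ≤ R) ∧ ∀ j, (k j : ℝ) - t j = ∑ i, H i j * z i) :
    (S.card : ℝ) ≤ |H.det| * (2 * (R + 2 ^ m / κ)) ^ m := by
  set b := Pi.basisFun ℝ (Fin m)
  set f := Matrix.toLin' H.transpose
  have hfd : ∀ z j, f z j = ∑ i, H i j * z i := fun z j => rfl
  have hf : LinearMap.det f = H.det := by rw [LinearMap.det_toLin', Matrix.det_transpose]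
  set L := (Submodule.span ℤ (range b)).toAddSubgroup
  set F := ZSpan.fundamentalDomain b
  have hF : IsAddFundamentalDomain L F volume := ZSpan.isAddFundamentalDomain' b volume
  have hvol : volume F = 1 := by
    rw [ZSpan.volume_fundamentalDomain]
    have : (Matrix.of ⇑(Pi.basisFun ℝ (Fin m))) = 1 := by
      ext i j
      simp [Matrix.one_apply, Pi.single_apply, eq_comm]
    rw [this]; simp
  have : Countable L := inferInstanceAs (Countable (Submodule.span ℤ (range b)))
  set R' := R + 2 ^ m / κ
  have hR' : 0 ≤ R' := by positivity
  set T := f '' Metric.closedBall (0 : Fin m → ℝ) R'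
  have hTm : MeasurableSet T :=
    ((isCompact_closedBall _ _).image f.continuous_of_finiteDimensional).measurableSet
  have hTv : volume T = ENNReal.ofReal (|H.det| * (2 * R') ^ m) := by
    rw [Measure.addHaar_image_linearMap, hf, Real.volume_pi_closedBall _ hR',
      ← ENNReal.ofReal_mul (abs_nonneg _)]
    simp
  have hmem : ∀ k : Fin m → ℤ, (fun j => (k j : ℝ)) ∈ L := by
    intro k
    change (fun j => (k j : ℝ)) ∈ Submodule.span ℤ (range b)
    rw [b.mem_span_iff_repr_mem ℤ]
    intro i
    exact ⟨k i, by simp [b]⟩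
  have hTneg : ∀ v, v ∈ T → -v ∈ T := by
    rintro _ ⟨z, hz, rfl⟩
    exact ⟨-z, by simpa using hz, by simp⟩
  -- pointwise count
  have hpt : ∀ s : Fin m → ℝ, (S.card : ℝ≥0∞) ≤ ∑' g : L, (g +ᵥ T).indicator 1 s := by
    intro s
    obtain ⟨k0, z0, hz0, hk0⟩ := good_cover H κ hκ hg (fun j => s j - t j)
    let ι : (Fin m → ℤ) → L := fun k => ⟨fun j => ((k + k0) j : ℝ), by exact_mod_cast hmem (k + k0)⟩
    have hι : Function.Injective ι := by
      intro k k' h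
      have := congrArg Subtype.val h
      ext j
      have := congrFun this j
      simpa [ι] using this
    calc (S.card : ℝ≥0∞) = ∑ k ∈ S, (1:ℝ≥0∞) := by simp
      _ = ∑ k ∈ S, ((ι k) +ᵥ T).indicator 1 s := by
          refine Finset.sum_congr rfl fun k hk => ?_
          rw [indicator_of_mem]
          · rfl
          obtain ⟨z, hz, hkz⟩ := hS k hk
          refine Set.mem_vadd_set.2 ⟨-(f (z + z0)), hTneg _ ⟨z + z0, ?_, rfl⟩, ?_⟩
          · rw [mem_closedBall_zero_iff]
            refine (pi_norm_le_iff_of_nonneg hR').2 fun i => ?_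
            exact (abs_add_le _ _).trans (add_le_add (hz i) (hz0 i))
          · ext j
            have h1 := hkz j
            have h2 := hk0 j
            change ((k + k0) j : ℝ) + -(f (z + z0) j) = s j
            have h3 : f (z + z0) j = f z j + f z0 j := by rw [map_add]; rfl
            rw [h3, hfd, hfd, ← h1, ← h2, Pi.add_apply]
            push_cast
            ring
      _ = ∑ g ∈ S.map ⟨ι, hι⟩, (g +ᵥ T).indicator 1 s := by rw [Finset.sum_map]; rfl
      _ ≤ _ := ENNReal.sum_le_tsum _
  have hmain : (S.card : ℝ≥0∞) ≤ volume T := by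
    calc (S.card : ℝ≥0∞) = ∫⁻ s in F, (S.card : ℝ≥0∞) := by
          rw [lintegral_const, Measure.restrict_apply_univ, hvol, mul_one]
      _ ≤ ∫⁻ s in F, ∑' g : L, (g +ᵥ T).indicator 1 s := lintegral_mono fun s => hpt s
      _ = ∑' g : L, ∫⁻ s in F, (g +ᵥ T).indicator 1 s :=
          lintegral_tsum fun g => (measurable_one.indicator (hTm.const_vadd g)).aemeasurable
      _ = ∑' g : L, volume ((g +ᵥ T) ∩ F) := by
          refine tsum_congr fun g => ?_
          rw [lintegral_indicator_one (hTm.const_vadd g), Measure.restrict_apply (hTm.const_vadd g)]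
      _ = volume T := (hF.measure_eq_tsum T).symm
  rw [hTv] at hmain
  have : ENNReal.ofReal (S.card : ℝ) ≤ ENNReal.ofReal (|H.det| * (2 * R') ^ m) := by simpa using hmain
  exact (ENNReal.ofReal_le_ofReal_iff (by positivity)).1 this

noncomputable def E (t : ℝ) : ℝ := (2 : ℝ) ^ t

lemma E_pos (t : ℝ) : 0 < E t := Real.rpow_pos_of_pos two_pos t
lemma E_add (s t : ℝ) : E (s + t) = E s * E t := Real.rpow_add two_pos s t
lemma E_zero : E 0 = 1 := Real.rpow_zero _
lemma E_one : E 1 = 2 := Real.rpow_one _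
lemma E_le {s t : ℝ} : E s ≤ E t ↔ s ≤ t := Real.rpow_le_rpow_left_iff one_lt_two
lemma E_lt {s t : ℝ} : E s < E t ↔ s < t := Real.rpow_lt_rpow_left_iff one_lt_two
lemma E_nat (a : ℕ) : E a = 2 ^ a := Real.rpow_natCast _ _
lemma E_pow (t : ℝ) (k : ℕ) : E t ^ k = E (k * t) := by
  unfold E; rw [← Real.rpow_natCast, ← Real.rpow_mul two_pos.le, mul_comm]
lemma E_rpow (t s : ℝ) : E t ^ s = E (s * t) := by
  unfold E; rw [← Real.rpow_mul two_pos.le, mul_comm]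
lemma E_neg (t : ℝ) : E (-t) = (E t)⁻¹ := Real.rpow_neg two_pos.le t
lemma E_sub (s t : ℝ) : E (s - t) = E s / E t := Real.rpow_sub two_pos s t

/-- weights -/
noncomputable def wE (n : ℕ) (lam a b : ℝ) : Fin (n+1) → ℝ := fun i =>
  if i.val = 0 then E a else if i.val = 1 then E (a - b) else E (-(lam * a))

lemma wE_pos (n : ℕ) (lam a b : ℝ) (i) : 0 < wE n lam a b i := by
  unfold wE; split_ifs <;> exact E_pos _

lemma wE_prod {n : ℕ} (hn : 1 ≤ n) (lam a b : ℝ) :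
    ∏ i, wE n lam a b i = E ((2 - (n-1) * lam) * a - b) := by
  obtain ⟨k, rfl⟩ : ∃ k, n = k + 1 := ⟨n - 1, by omega⟩
  rw [Fin.prod_univ_succ, Fin.prod_univ_succ]
  have : ∀ i : Fin k, wE (k+1) lam a b i.succ.succ = E (-(lam * a)) := by
    intro i; simp [wE]
  simp only [this, Finset.prod_const, Finset.card_univ, Fintype.card_fin]
  have h0 : wE (k+1) lam a b 0 = E a := by simp [wE]
  have h1 : wE (k+1) lam a b (Fin.succ 0) = E (a - b) := by simp [wE]
  rw [h0, h1, E_pow, ← E_add, ← E_add]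
  congr 1
  push_cast
  ring

lemma taylor_pow (x y : ℝ) (hx : x ∈ Icc (0:ℝ) 1) (hy : y ∈ Icc (0:ℝ) 1) (j : ℕ) :
    |y ^ j - x ^ j - j * x ^ (j-1) * (y - x)| ≤ j ^ 2 * (y - x) ^ 2 := by
  induction j with
  | zero => simp
  | succ j ih =>
    have hxj : |x ^ (j-1)| ≤ 1 := by
      rw [abs_of_nonneg (pow_nonneg hx.1 _)]; exact pow_le_one₀ hx.1 hx.2
    have e : y ^ (j+1) - x ^ (j+1) - ((j+1:ℕ):ℝ) * x ^ (j+1-1) * (y - x) =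
        y * (y ^ j - x ^ j - j * x ^ (j-1) * (y - x)) + j * x ^ (j-1) * (y - x) ^ 2 := by
      rcases j with _ | j
      · simp
      · simp only [Nat.add_sub_cancel]; push_cast; ring
    rw [e]
    refine (abs_add_le _ _).trans ?_
    rw [abs_mul, abs_mul, abs_mul, abs_of_nonneg hy.1, abs_of_nonneg (sq_nonneg (y-x)), Nat.abs_cast]
    have h1 : y * |y ^ j - x ^ j - j * x ^ (j-1) * (y - x)| ≤ 1 * (j ^ 2 * (y - x) ^ 2) :=
      mul_le_mul hy.2 ih (abs_nonneg _) zero_le_one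
    have h2 : (j:ℝ) * |x ^ (j-1)| * (y-x)^2 ≤ j * 1 * (y-x)^2 := by gcongr
    push_cast
    have : 0 ≤ ((j:ℝ) + 1) * (y-x)^2 := by positivity
    nlinarith

lemma pow_lip (x y : ℝ) (hx : x ∈ Icc (0:ℝ) 1) (hy : y ∈ Icc (0:ℝ) 1) (j : ℕ) :
    |y ^ j - x ^ j| ≤ j * |y - x| := by
  induction j with
  | zero => simp
  | succ j ih =>
    have e : y ^ (j+1) - x ^ (j+1) = y * (y ^ j - x ^ j) + x ^ j * (y - x) := by ring
    rw [e]
    refine (abs_add_le _ _).trans ?_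
    rw [abs_mul, abs_mul, abs_of_nonneg hy.1, abs_of_nonneg (pow_nonneg hx.1 j)]
    have h1 : y * |y ^ j - x ^ j| ≤ 1 * (j * |y - x|) := mul_le_mul hy.2 ih (abs_nonneg _) zero_le_one
    have h2 : x ^ j * |y - x| ≤ 1 * |y-x| := by
      gcongr; exact pow_le_one₀ hx.1 hx.2
    push_cast
    linarith

/-- coordinates of a transposed product -/
lemma HmT {n : ℕ} (hn : 1 ≤ n) (w : Fin (n+1) → ℝ) (x : ℝ) (z : Fin (n+1) → ℝ) (j : Fin (n+1)) :
    ∑ i, Hm n w x i j * z i = w 0 * z 0 * x ^ j.val +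
      w 1 * z 1 * (j.val * x ^ (j.val - 1)) + if 2 ≤ j.val then w j * z j else 0 := by
  obtain ⟨k, rfl⟩ : ∃ k, n = k + 1 := ⟨n - 1, by omega⟩
  rw [Fin.sum_univ_succ, Fin.sum_univ_succ, ← add_assoc]
  congr 1
  · simp [Hm, Um]; ring
  · have : ∀ i : Fin k, Hm (k+1) w x i.succ.succ j * z i.succ.succ =
        if i.succ.succ = j then w j * z j else 0 := by
      intro i
      by_cases h : i.succ.succ = j
      · subst h; simp [Hm, Um]
      · simp [Hm, Um, h]
    simp only [this]
    by_cases h : 2 ≤ j.val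
    · rw [if_pos h, Finset.sum_eq_single ⟨j.val - 2, by omega⟩]
      · rw [if_pos]; ext; simp; omega
      · intro i _ hi
        rw [if_neg]
        rintro rfl
        exact hi (by ext; simp)
      · simp
    · rw [if_neg h]
      refine Finset.sum_eq_zero fun i _ => ?_
      rw [if_neg]
      rintro rfl
      simp at h

/-- integer point attached to `(p,q)` -/
def ipt {n : ℕ} (p : Fin n → ℤ) (q : ℕ) : Fin (n+1) → ℤ := Fin.cons (q : ℤ) p

noncomputable def ith {n : ℕ} (θ : Fin n → ℝ) : Fin (n+1) → ℝ := Fin.cons 0 (fun i => - θ i)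

lemma local_box {n : ℕ} (hn : 2 ≤ n) (lam a b : ℝ) (θ : Fin n → ℝ) (x y : ℝ) (hx : x ∈ Icc (0:ℝ) 1)
    (hy : y ∈ Icc (0:ℝ) 1) (hxy : |y - x| ≤ E (-b)) (p : Fin n → ℤ) (q : ℕ) (hq : (q:ℝ) ≤ 2 * E a)
    (hb1 : b ≤ (1 + lam) * a) (hb2 : (1 + lam) * a ≤ 2 * b)
    (hc : ∀ i : Fin n, |(p i + θ i) - q * y ^ (i.val + 1)| ≤ E (-(lam * a))) :
    ∃ z : Fin (n+1) → ℝ, (∀ i, |z i| ≤ 4 * n ^ 2) ∧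
      ∀ j, (ipt p q j : ℝ) - ith θ j = ∑ i, Hm n (wE n lam a b) x i j * z i := by
  set S := E (-(lam * a)) with hS
  have hSpos : 0 < S := E_pos _
  have hn' : (2:ℝ) ≤ n := by exact_mod_cast hn
  have hq0 : (0:ℝ) ≤ q := Nat.cast_nonneg q
  have hQ := E_pos a
  have hS1 : S ≤ E (a - b) := E_le.2 (by linarith)
  have hab : E a * E (-b) = E (a - b) := by rw [← E_add]; rfl
  have hS2 : E a * E (-b) ^ 2 ≤ S := by
    rw [E_pow, ← E_add]; exact E_le.2 (by push_cast; linarith)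
  have i0 : 0 < n := by omega
  set u : ℝ := (p ⟨0, i0⟩ + θ ⟨0, i0⟩) - q * x with hu
  have hu1 : |u - q * (y - x)| ≤ S := by
    have := hc ⟨0, i0⟩
    simp only [zero_add, pow_one] at this
    convert this using 2
    rw [hu]; ring
  have hqyx : |q * (y - x)| ≤ 2 * E (a - b) := by
    rw [abs_mul, abs_of_nonneg hq0, ← hab]
    calc q * |y - x| ≤ (2 * E a) * E (-b) := mul_le_mul hq hxy (abs_nonneg _) (by positivity)
      _ = _ := by ring
  have hu2 : |u| ≤ 3 * E (a - b) := by
    have := abs_add_le (u - q * (y - x)) (q * (y - x))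
    rw [sub_add_cancel] at this
    linarith
  let rem : Fin (n+1) → ℝ := fun j => (ipt p q j : ℝ) - ith θ j - q * x ^ j.val - u * (j.val * x ^ (j.val - 1))
  refine ⟨fun j => if j.val = 0 then q / E a else if j.val = 1 then u / E (a - b) else rem j / S, ?_, ?_⟩
  · intro j
    have hbase : (3:ℝ) ≤ 4 * n ^ 2 := by nlinarith
    simp only
    split_ifs with h0 h1
    · rw [abs_of_nonneg (by positivity), div_le_iff₀ hQ]
      nlinarith
    · rw [abs_div, abs_of_pos (E_pos _), div_le_iff₀ (E_pos _)]
      refine hu2.trans ?_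
      have := E_pos (a - b)
      nlinarith
    · rw [abs_div, abs_of_pos hSpos, div_le_iff₀ hSpos]
      obtain ⟨i, rfl⟩ : ∃ i : Fin n, j = i.succ := ⟨j.pred (by rintro rfl; simp at h0), by simp⟩
      have e : rem i.succ = ((p i + θ i) - q * y ^ (i.val+1)) +
          q * (y ^ (i.val+1) - x ^ (i.val+1) - ((i.val + 1 : ℕ):ℝ) * x ^ (i.val+1-1) * (y - x))
          - ((i.val+1:ℕ):ℝ) * x ^ (i.val+1-1) * (u - q * (y - x)) := by
        simp only [rem, ipt, ith, Fin.cons_succ, Fin.val_succ]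
        push_cast
        ring
      rw [e]
      have hi : (((i.val+1:ℕ)):ℝ) ≤ n := by exact_mod_cast i.2
      have t1 := hc i
      have t2 : |q * (y ^ (i.val+1) - x ^ (i.val+1) - ((i.val + 1 : ℕ):ℝ) * x ^ (i.val+1-1) * (y - x))|
          ≤ 2 * n ^ 2 * S := by
        rw [abs_mul, abs_of_nonneg hq0]
        have hsq : (y - x) ^ 2 ≤ E (-b) ^ 2 := by
          rw [← sq_abs]; exact pow_le_pow_left₀ (abs_nonneg _) hxy 2
        calc _ ≤ (2 * E a) * ((n:ℝ) ^ 2 * E (-b) ^ 2) := by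
              refine mul_le_mul hq ((taylor_pow x y hx hy _).trans ?_) (abs_nonneg _) (by positivity)
              gcongr
          _ = 2 * n ^ 2 * (E a * E (-b) ^ 2) := by ring
          _ ≤ _ := by gcongr
      have t3 : |((i.val+1:ℕ):ℝ) * x ^ (i.val+1-1) * (u - q * (y - x))| ≤ n * S := by
        rw [abs_mul, abs_mul, Nat.abs_cast, abs_of_nonneg (pow_nonneg hx.1 _)]
        have : x ^ (i.val+1-1) ≤ 1 := pow_le_one₀ hx.1 hx.2
        calc _ ≤ (n:ℝ) * 1 * S := by
              refine mul_le_mul (mul_le_mul hi this (pow_nonneg hx.1 _) (by positivity)) hu1 (abs_nonneg _) (by positivity)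
          _ = _ := by ring
      have := abs_sub (((p i + θ i) - q * y ^ (i.val+1)) +
          q * (y ^ (i.val+1) - x ^ (i.val+1) - ((i.val + 1 : ℕ):ℝ) * x ^ (i.val+1-1) * (y - x)))
          (((i.val+1:ℕ):ℝ) * x ^ (i.val+1-1) * (u - q * (y - x)))
      have h4 := abs_add_le ((p i + θ i) - q * y ^ (i.val+1)) (q * (y ^ (i.val+1) - x ^ (i.val+1) - ((i.val + 1 : ℕ):ℝ) * x ^ (i.val+1-1) * (y - x)))
      have h5 : S + 2 * n ^ 2 * S + n * S ≤ 4 * n ^ 2 * S := by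
        have : 0 ≤ (2 * (n:ℝ) ^ 2 - n - 1) * S := by
          apply mul_nonneg _ hSpos.le; nlinarith
        nlinarith
      linarith
  · intro j
    rw [HmT (by omega)]
    have w0 : wE n lam a b 0 = E a := by simp [wE]
    have h1v : ((1 : Fin (n+1)) : ℕ) = 1 := by
      rw [Fin.val_one']; exact Nat.mod_eq_of_lt (by omega)
    have w1 : wE n lam a b 1 = E (a - b) := by
      simp only [wE, h1v]; norm_num
    rw [w0, w1]
    simp only [h1v, Fin.val_zero, if_true, one_ne_zero, if_false]
    rw [mul_div_cancel₀ _ hQ.ne', mul_div_cancel₀ _ (E_pos _).ne']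
    split_ifs with h2 h0 h1
    · omega
    · omega
    · have : wE n lam a b j = S := by simp [wE, h0, h1, hS]
      rw [this, mul_div_cancel₀ _ hSpos.ne']
      simp only [rem]; ring
    · have : j.val = 0 ∨ j.val = 1 := by omega
      rcases this with h | h
      · have : j = 0 := Fin.ext h
        subst this
        simp [ipt, ith]
      · have : j = Fin.succ ⟨0, i0⟩ := Fin.ext (by simpa using h)
        subst this
        simp only [ipt, ith, Fin.cons_succ, Fin.val_succ, hu]
        push_cast
        ring

def Cl (n : ℕ) (θ : Fin n → ℝ) (τ y : ℝ) (p : Fin n → ℤ) (q : ℕ) : Prop :=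
  ∀ i : Fin n, |y ^ (i.val + 1) - (p i + θ i) / q| ≤ (q:ℝ) ^ (-τ) / q

def Wc (n : ℕ) (θ : Fin n → ℝ) (τ : ℝ) (a : ℕ) : Set ℝ :=
  {y | ∃ p : Fin n → ℤ, ∃ q : ℕ, 2 ^ a ≤ q ∧ q < 2 ^ (a+1) ∧ Cl n θ τ y p q}

lemma Cl_mul {n : ℕ} {θ : Fin n → ℝ} {τ y : ℝ} {p : Fin n → ℤ} {q : ℕ} (hq : 0 < q)
    (h : Cl n θ τ y p q) (i : Fin n) : |(p i + θ i) - q * y ^ (i.val + 1)| ≤ (q:ℝ) ^ (-τ) := by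
  have hq' : (0:ℝ) < q := by exact_mod_cast hq
  have := h i
  rw [le_div_iff₀ hq'] at this
  rw [abs_sub_comm]
  have e : |q * y ^ (i.val+1) - (p i + θ i)| = |y ^ (i.val + 1) - (p i + θ i) / q| * q := by
    nth_rewrite 3 [← abs_of_pos hq']
    rw [← abs_mul]
    congr 1
    field_simp
  rw [e]; exact this

lemma q_rpow_le {τ : ℝ} (hτ : 0 ≤ τ) {a q : ℕ} (h : 2 ^ a ≤ q) : (q:ℝ) ^ (-τ) ≤ E (-(τ * a)) := by
  have h2 : E a ≤ q := by rw [E_nat]; exact_mod_cast h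
  have : E (-(τ * a)) = (E a) ^ (-τ) := by rw [E_rpow]; congr 1; ring
  rw [this]
  exact Real.rpow_le_rpow_of_nonpos (E_pos _) h2 (by linarith)

noncomputable def cnt (n : ℕ) (κ : ℝ) : ℝ := (2 * (4 * n ^ 2 + 2 ^ (n+1) / κ)) ^ (n+1)

lemma finite_of_card_le {α : Type*} (Z : Set α) (K : ℝ) (h : ∀ S : Finset α, (S : Set α) ⊆ Z → (S.card : ℝ) ≤ K) :
    ∃ T : Finset α, (T : Set α) = Z ∧ (T.card : ℝ) ≤ K := by
  have hfin : Z.Finite := by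
    by_contra hinf
    obtain ⟨k, hk⟩ := exists_nat_gt K
    obtain ⟨S, hS, hc⟩ := Set.Infinite.exists_subset_card_eq hinf k
    have := h S hS
    rw [hc] at this
    linarith
  exact ⟨hfin.toFinset, by simp, h _ (by simp)⟩

lemma CL1 {n : ℕ} (hn : 2 ≤ n) (lam b τ D0 κ : ℝ) (hlam : 0 ≤ lam) (hτ : lam ≤ τ) (a : ℕ) (θ : Fin n → ℝ) (x : ℝ)
    (hx : x ∈ Icc (0:ℝ) 1) (hκ : 0 < κ) (hg : GoodM (Hm n (wE n lam a b) x) κ) (hD : 0 ≤ D0)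
    (hb1 : b ≤ (1 + lam) * a) (hb2 : (1 + lam) * a ≤ 2 * b) :
    volume {u | ∃ y ∈ Icc (0:ℝ) 1, |y - x| ≤ E (-b) ∧ |u - y| ≤ D0 ∧ y ∈ Wc n θ τ a} ≤
      ENNReal.ofReal (cnt n κ * E ((2 - (n-1) * lam) * a - b) * (2 * (D0 + E (-((1+τ) * a))))) := by
  let Z : Set (Fin (n+1) → ℤ) := {k | ∃ p : Fin n → ℤ, ∃ q : ℕ, ∃ y ∈ Icc (0:ℝ) 1, |y - x| ≤ E (-b) ∧
    2 ^ a ≤ q ∧ q < 2 ^ (a+1) ∧ Cl n θ τ y p q ∧ k = ipt p q}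
  have hpw : (0:ℝ) < 2 ^ a := by positivity
  have hdet : (Hm n (wE n lam a b) x).det = E ((2 - (n-1) * lam) * a - b) := by
    rw [Hm_det, wE_prod (by omega)]
  obtain ⟨T, hT, hTc⟩ := finite_of_card_le Z (cnt n κ * E ((2 - (n-1) * lam) * a - b)) (by
    intro S hS
    have := good_count (Hm n (wE n lam a b) x) (by rw [hdet]; exact (E_pos _).ne') κ hκ hg (ith θ)
      (4 * n ^ 2) (by positivity) S (by
        intro k hk
        obtain ⟨p, q, y, hy, hyx, hq1, hq2, hcl, rfl⟩ := hS hk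
        have hq0 : 0 < q := lt_of_lt_of_le (by positivity) hq1
        refine local_box hn lam a b θ x y hx hy hyx p q ?_ hb1 hb2 ?_
        · rw [E_nat, ← pow_succ']; exact_mod_cast hq2.le
        · intro i
          refine (Cl_mul hq0 hcl i).trans ((q_rpow_le (hlam.trans hτ) hq1).trans (E_le.2 ?_))
          have : (0:ℝ) ≤ a := Nat.cast_nonneg a
          nlinarith)
    rw [hdet, abs_of_pos (E_pos _)] at this
    unfold cnt
    linarith)
  set h := D0 + E (-((1+τ) * a)) with hh
  have i0 : 0 < n := by omega
  let c : (Fin (n+1) → ℤ) → ℝ := fun k => (k (Fin.succ ⟨0, i0⟩) + θ ⟨0, i0⟩) / k 0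
  calc _ ≤ volume (⋃ k ∈ T, Icc (c k - h) (c k + h)) := by
        refine measure_mono ?_
        rintro u ⟨y, hy, hyx, huy, p, q, hq1, hq2, hcl⟩
        have hmem : ipt p q ∈ T := by
          have : ipt p q ∈ (T : Set _) := by
            rw [hT]; exact ⟨p, q, y, hy, hyx, hq1, hq2, hcl, rfl⟩
          exact this
        refine mem_biUnion hmem ?_
        have h1 := hcl ⟨0, i0⟩
        have hc : c (ipt p q) = (p ⟨0, i0⟩ + θ ⟨0, i0⟩) / q := by
          simp only [c, ipt, Fin.cons_succ, Fin.cons_zero]; push_cast; rfl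
        have hq' : (0:ℝ) < q := by
          have : 0 < q := lt_of_lt_of_le (by positivity) hq1
          exact_mod_cast this
        have h2 : (q:ℝ) ^ (-τ) / q ≤ E (-((1+τ) * a)) := by
          have e : E (-((1+τ) * a)) = E (-(τ * a)) / E a := by
            rw [← E_sub]; congr 1; ring
          rw [e]
          refine div_le_div₀ (E_pos _).le (q_rpow_le (hlam.trans hτ) hq1) (E_pos _) ?_
          rw [E_nat]; exact_mod_cast hq1
        simp only [zero_add, pow_one] at h1
        rw [← hc] at h1
        have h3 := abs_sub_le u y (c (ipt p q))
        have h4 : |u - c (ipt p q)| ≤ h := by rw [hh]; linarith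
        have := abs_le.1 h4
        constructor <;> linarith
    _ ≤ ∑ k ∈ T, volume (Icc (c k - h) (c k + h)) := measure_biUnion_finset_le _ _
    _ = T.card * ENNReal.ofReal (2 * h) := by
        have : ∀ k ∈ T, volume (Icc (c k - h) (c k + h)) = ENNReal.ofReal (2 * h) := by
          intro k _; rw [Real.volume_Icc]; congr 1; ring
        rw [Finset.sum_congr rfl this]; simp
    _ ≤ _ := by
        have h0 : 0 ≤ h := by have := E_pos (-((1+τ) * a)); positivity
        rw [← ENNReal.ofReal_natCast, ← ENNReal.ofReal_mul (by positivity)]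
        exact ENNReal.ofReal_le_ofReal (mul_le_mul_of_nonneg_right hTc (by positivity))

lemma CLg {n : ℕ} (hn : 2 ≤ n) (lam b τ D0 κ : ℝ) (hlam : 0 ≤ lam) (hτ : lam ≤ τ) (a : ℕ) (θ : Fin n → ℝ)
    (hκ : 0 < κ) (hD : 0 ≤ D0)
    (hb1 : b ≤ (1 + lam) * a) (hb2 : (1 + lam) * a ≤ 2 * b) (α β K : ℝ) (hα : 0 ≤ α) (hβ : β ≤ 1) (hαβ : α < β)
    (hD2 : D0 ≤ E (-b) / 2) (hK : E (-b) ≤ K * (β - α)) :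
    volume {u | u ∈ Icc α β ∧ GoodM (Hm n (wE n lam a b) u) κ ∧ ∃ y ∈ Icc (0:ℝ) 1, |u - y| ≤ D0 ∧ y ∈ Wc n θ τ a} ≤
      ENNReal.ofReal (cnt n κ * (2 + 2 * K) * (β - α) *
        (E ((2 - (n-1) * lam) * a) * (2 * (D0 + E (-((1+τ) * a)))))) := by
  set ρ := E (-b) with hρ
  have hρ0 : 0 < ρ := E_pos _
  set N := ⌈2 * (β - α) / ρ⌉₊ with hN
  have hNle : (N:ℝ) + 1 ≤ (2 + 2 * K) * (β - α) / ρ := by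
    have h1 := (Nat.ceil_lt_add_one (show 0 ≤ 2 * (β - α) / ρ from
      div_nonneg (by linarith) hρ0.le)).le
    refine (add_le_add_left h1 1).trans ?_
    rw [div_add_one hρ0.ne', div_add_one hρ0.ne']
    gcongr
    linarith
  set G := {u | u ∈ Icc α β ∧ GoodM (Hm n (wE n lam a b) u) κ ∧ ∃ y ∈ Icc (0:ℝ) 1, |u - y| ≤ D0 ∧ y ∈ Wc n θ τ a}
  set B := cnt n κ * E ((2 - (n-1) * lam) * a - b) * (2 * (D0 + E (-((1+τ) * a)))) with hB
  have hB0 : 0 ≤ B := by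
    have := E_pos ((2 - (n-1) * lam) * a - b)
    have := E_pos (-((1+τ) * a))
    unfold B cnt; positivity
  let P : ℕ → Set ℝ := fun k => G ∩ Icc (α + k * (ρ/2)) (α + (k+1) * (ρ/2))
  have hcov : G ⊆ ⋃ k ∈ Finset.range (N+1), P k := by
    intro u hu
    have hu1 := hu.1
    have h0 : 0 ≤ (u - α) / (ρ / 2) := div_nonneg (by linarith [hu1.1]) (by positivity)
    have hfl := Nat.floor_le h0
    have hlt := Nat.lt_floor_add_one ((u - α) / (ρ / 2))
    rw [le_div_iff₀ (by positivity)] at hfl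
    rw [div_lt_iff₀ (by positivity)] at hlt
    refine mem_biUnion (x := ⌊(u - α) / (ρ / 2)⌋₊) ?_ ⟨hu, by linarith, by linarith⟩
    simp only [Finset.coe_range, mem_Iio]
    refine Nat.lt_succ_of_le ?_
    refine (Nat.floor_le_ceil _).trans (Nat.ceil_mono ?_)
    rw [div_le_div_iff₀ (by positivity) hρ0]
    nlinarith [hu1.2]
  have hP : ∀ k, volume (P k) ≤ ENNReal.ofReal B := by
    intro k
    rcases (P k).eq_empty_or_nonempty with h | ⟨x, hx⟩
    · rw [h]; simp
    · refine le_trans (measure_mono ?_) (CL1 hn lam b τ D0 κ hlam hτ a θ x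
        ⟨hα.trans hx.1.1.1, hx.1.1.2.trans hβ⟩ hκ hx.1.2.1 hD hb1 hb2)
      rintro u ⟨⟨-, -, y, hy, huy, hyW⟩, hu⟩
      refine ⟨y, hy, ?_, huy, hyW⟩
      have h1 := abs_sub_le y u x
      have h2 : |u - x| ≤ ρ / 2 := by
        rw [abs_le]; constructor <;> linarith [hu.1, hu.2, hx.2.1, hx.2.2]
      rw [abs_sub_comm y u] at h1
      linarith
  calc volume G ≤ volume (⋃ k ∈ Finset.range (N+1), P k) := measure_mono hcov
    _ ≤ ∑ k ∈ Finset.range (N+1), volume (P k) := measure_biUnion_finset_le _ _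
    _ ≤ ∑ k ∈ Finset.range (N+1), ENNReal.ofReal B := Finset.sum_le_sum fun k _ => hP k
    _ = ENNReal.ofReal ((N + 1) * B) := by
        rw [Finset.sum_const, Finset.card_range, nsmul_eq_mul, ← Nat.cast_succ,
          ENNReal.ofReal_mul (p := ((N.succ:ℕ):ℝ)) (Nat.cast_nonneg _), ENNReal.ofReal_natCast]
    _ ≤ _ := by
        refine ENNReal.ofReal_le_ofReal ?_
        refine (mul_le_mul_of_nonneg_right hNle hB0).trans (le_of_eq ?_)
        have e : E ((2 - (n-1) * lam) * a - b) = E ((2 - (n-1) * lam) * a) * ρ := by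
          rw [hρ, ← E_add]; rfl
        rw [hB, e]
        field_simp

lemma GoodM.mono {m : ℕ} {H : Matrix (Fin m) (Fin m) ℝ} {κ κ' : ℝ} (h : GoodM H κ) (hk : κ' ≤ κ) :
    GoodM H κ' := fun P hP => hk.trans (h P hP)

lemma growG_E {n : ℕ} (hn : 2 ≤ n) (c s : ℝ) (hc : 0 ≤ c) :
    growG n (c * E (-s)) = growG n c * E (-(s / (2 * (n - 1)))) := by
  unfold growG
  rw [← mul_assoc, Real.mul_rpow (mul_nonneg (growK_pos n).le hc) (E_pos _).le, E_rpow]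
  congr 2
  push_cast [Nat.cast_sub (show 1 ≤ n by omega)]
  ring

lemma growG_nonneg (n : ℕ) {c : ℝ} (hc : 0 ≤ c) : 0 ≤ growG n c :=
  Real.rpow_nonneg (mul_nonneg (growK_pos n).le hc) _

lemma E_tendsto {δ : ℝ} (hδ : 0 < δ) : Tendsto (fun A : ℝ => E (-(δ * A))) atTop (nhds 0) := by
  have h1 : Tendsto (fun A : ℝ => δ * A) atTop atTop := tendsto_id.const_mul_atTop hδ
  have h2 := (tendsto_rpow_atTop_of_base_lt_one (1/2 : ℝ) (by norm_num) (by norm_num)).comp h1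
  refine h2.congr fun A => ?_
  simp only [Function.comp, E]
  rw [Real.rpow_neg two_pos.le, one_div, Real.inv_rpow two_pos.le]

lemma E_ev (δ C t : ℝ) (hδ : 0 < δ) (ht : 0 < t) : ∀ᶠ A : ℝ in atTop, C * E (-(δ * A)) < t := by
  have h := (E_tendsto hδ).const_mul C
  rw [mul_zero] at h
  exact h.eventually (gt_mem_nhds ht)

theorem km1E {n : ℕ} (hn : 2 ≤ n) (lam : ℝ) (hlam : 0 ≤ lam) (α β : ℝ) (hαβ : α < β) (hα : 0 ≤ α) (hβ : β ≤ 1)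
    (e : ℝ) (he : 0 < e) : ∃ C δ : ℝ, 0 ≤ C ∧ 0 < δ ∧ ∃ a0 : ℕ, ∀ a : ℕ, a0 ≤ a → ∀ b : ℝ, 0 ≤ b → b ≤ 2 * a →
      volume {x | x ∈ Icc α β ∧ ¬ GoodM (Hm n (wE n lam a b) x)
        (E (((2 - (n-1) * lam) * a - b) / (n+1) - e * a))} ≤ ENNReal.ofReal (C * E (-(δ * a))) := by
  obtain ⟨c, hc, hkm⟩ := km1 hn α β hαβ hα hβ
  have hev := (E_ev (e/2) 1 c (by linarith) hc).natCast_atTop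
  obtain ⟨a0, ha0⟩ := eventually_atTop.1 hev
  have hn' : (2:ℝ) ≤ n := by exact_mod_cast hn
  refine ⟨KMconst (n+2) * growG n 1 * (β - α), e / 2 / (2 * (n - 1)), ?_, ?_, a0, ?_⟩
  · exact mul_nonneg (mul_nonneg (KMconst_nonneg _) (growG_nonneg n zero_le_one)) (by linarith)
  · apply div_pos (by linarith); linarith
  intro a haa b hb0 hb2
  set v := ((2 - (n-1) * lam) * a - b) / (n+1) with hv
  have ha : (0:ℝ) ≤ a := Nat.cast_nonneg a
  have hm : (0:ℝ) < n + 1 := by linarith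
  have hla : 0 ≤ lam * a := by positivity
  have hvm : v * (n+1) = (2 - (n-1) * lam) * a - b := by rw [hv]; field_simp
  have hv1 : v ≤ a := by
    rw [hv, div_le_iff₀ hm]
    nlinarith
  have hv2 : -(lam * a) ≤ v := by
    rw [hv, le_div_iff₀ hm]
    nlinarith
  have := hkm (fun i => E (-v) * wE n lam a b i) (fun i => mul_pos (E_pos _) (wE_pos _ _ _ _ _))
    (by
      intro i hi
      simp only [wE, hi, if_true]
      rw [← E_add, ← E_zero]; exact E_le.2 (by linarith))
    (by
      intro i hi
      simp only [wE, show i.val ≠ 0 by omega, show i.val ≠ 1 by omega, if_false]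
      rw [← E_add, ← E_zero]; exact E_le.2 (by linarith))
    (by
      rw [Finset.prod_mul_distrib, wE_prod (by omega), Finset.prod_const, E_pow, ← E_add, ← hvm]
      refine le_of_eq ?_
      refine Eq.symm (Eq.trans ?_ E_zero)
      congr 1
      simp
      ring)
    (E (-(e / 2 * a))) (E_pos _) (by rw [← E_zero]; exact E_le.2 (by have : 0 ≤ e / 2 * a := by positivity
                                                                     linarith))
  have eg : growG n (E (-(e / 2 * a))) = growG n 1 * E (-(e / 2 / (2 * (n - 1)) * a)) := by
    have := growG_E hn 1 (e / 2 * a) zero_le_one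
    rw [one_mul] at this
    rw [this]; congr 3; ring
  rw [eg] at this
  refine le_trans (measure_mono ?_) (this.trans (ENNReal.ofReal_le_ofReal (le_of_eq (by ring))))
  rintro x ⟨hx, hg⟩
  refine ⟨hx, fun h => hg ?_⟩
  rw [good_smul _ _ _ _ (E_pos _)] at h
  refine h.mono ?_
  have h1 := ha0 a haa
  rw [one_mul] at h1
  rw [le_div_iff₀ (E_pos _), ← E_add]
  calc E (v - e * a + -v) = E (-(e/2 * a)) * E (-(e / 2 * a)) := by rw [← E_add]; congr 1; ring
    _ ≤ c * E (-(e/2*a)) := mul_le_mul_of_nonneg_right h1.le (E_pos _).le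

lemma tail_sum (C δ t : ℝ) (hC : 0 ≤ C) (hδ : 0 < δ) (ht : 0 < t) : ∀ᶠ N : ℕ in atTop,
    ∑' k : ℕ, ENNReal.ofReal (C * E (-(δ * (N + k : ℕ)))) ≤ ENNReal.ofReal t := by
  have hr : E (-δ) < 1 := by rw [← E_zero]; exact E_lt.2 (by linarith)
  have hs : Summable (fun k : ℕ => E (-δ) ^ k) := summable_geometric_of_lt_one (E_pos _).le hr
  have key : ∀ N : ℕ, ∑' k : ℕ, ENNReal.ofReal (C * E (-(δ * (N + k : ℕ)))) =
      ENNReal.ofReal ((C * ∑' k : ℕ, E (-δ) ^ k) * E (-(δ * N))) := by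
    intro N
    have e : ∀ k : ℕ, C * E (-(δ * (N + k : ℕ))) = C * E (-(δ * N)) * E (-δ) ^ k := by
      intro k; rw [E_pow, mul_assoc, ← E_add]; congr 2; push_cast; ring
    have hs2 : Summable (fun k : ℕ => C * E (-(δ * (N + k : ℕ)))) := by
      simp only [e]; exact hs.mul_left _
    rw [← ENNReal.ofReal_tsum_of_nonneg (fun k => mul_nonneg hC (E_pos _).le) hs2]
    simp only [e]
    rw [tsum_mul_left]
    congr 1; ring
  have := (E_ev δ (C * ∑' k : ℕ, E (-δ) ^ k) t hδ ht).natCast_atTop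
  filter_upwards [this] with N hN
  rw [key N]
  exact ENNReal.ofReal_le_ofReal hN.le

lemma union_tail {S : ℕ → Set ℝ} {C δ : ℝ} {N : ℕ} {t : ℝ≥0∞}
    (h : ∀ a, N ≤ a → volume (S a) ≤ ENNReal.ofReal (C * E (-(δ * a))))
    (ht : ∑' k : ℕ, ENNReal.ofReal (C * E (-(δ * (N + k : ℕ)))) ≤ t) :
    volume (⋃ a ∈ {a | N ≤ a}, S a) ≤ t := by
  refine le_trans ?_ ht
  have : (⋃ a ∈ {a | N ≤ a}, S a) = ⋃ k : ℕ, S (N + k) := by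
    ext x
    simp only [mem_iUnion, exists_prop]
    constructor
    · rintro ⟨a, ha, hx⟩
      obtain ⟨k, rfl⟩ := Nat.exists_eq_add_of_le ha
      exact ⟨k, hx⟩
    · rintro ⟨k, hx⟩
      exact ⟨N + k, Nat.le_add_right _ _, hx⟩
  rw [this]
  refine (measure_iUnion_le _).trans (ENNReal.tsum_le_tsum fun k => h _ (Nat.le_add_right _ _))

structure Par (n : ℕ) (lam g σ ε e : ℝ) : Prop where
  hn : 3 ≤ n
  hg : g = n * lam - 1
  hg0 : 0 ≤ g
  hlam : 0 ≤ lam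
  hlam1 : lam ≤ 1
  hσ : 0 < σ
  hσg : σ = 1 + lam - (2 * n ^ 2 + 2) * g
  hε : 0 < ε
  hε1 : ε ≤ σ / 16
  hε2 : ε ≤ 1 / 100
  he : 0 < e
  he1 : 8 * (n + 1) * e ≤ ε
  he2 : 32 * (n + 1) * (4 * n * (n + 1) + 1) * e ≤ σ

lemma Par.v {n : ℕ} {lam g σ ε e : ℝ} (h : Par n lam g σ ε e) : 2 - ((n:ℝ) - 1) * lam = 1 + lam - g := by
  rw [h.hg]; ring

lemma Par.g20 {n : ℕ} {lam g σ ε e : ℝ} (h : Par n lam g σ ε e) : 20 * g ≤ 1 + lam := by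
  have h1 := h.hσg
  have h2 := h.hσ
  have h3 := h.hg0
  have h4 : (3:ℝ) ≤ n := by exact_mod_cast h.hn
  nlinarith [mul_le_mul_of_nonneg_right (show (20:ℝ) ≤ 2 * n ^ 2 + 2 by nlinarith) h3]

def bb0 (n : ℕ) (lam g e A : ℝ) : ℝ := (1 + lam - g - 2 * (n + 1) * e) * A
def bb1 (lam g ε A : ℝ) : ℝ := (1 + lam - g - 4 * ε) * A
noncomputable def bb2 (lam A a : ℝ) : ℝ := max ((1 + lam) * A) ((1 + lam) * a / 2)

lemma stepC1 {n : ℕ} {lam g σ ε e : ℝ} (h : Par n lam g σ ε e) (e2 : ℝ) (he2 : 32 * ε ≤ e2)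
    (θ : Fin n → ℝ) (A a : ℕ) (x0 α β : ℝ) (hA1 : 2 ≤ ε * A) (hA2 : 100 ≤ e2 * A)
    (ha : (1 - ε) * A - 1 ≤ a) (hab : (1 + lam) * a ≤ 2 * bb1 lam g ε A) (hx0 : x0 ∈ Icc (0:ℝ) 1)
    (hgood : GoodM (Hm n (wE n lam a (bb1 lam g ε A)) x0) 1)
    (hJ0 : 0 ≤ α) (hJ1 : β ≤ 1) (hJ2 : x0 - 2 * E (-(bb0 n lam g e A)) ≤ α)
    (hJ3 : β ≤ x0 + 2 * E (-(bb0 n lam g e A))) (hJ : 4 * n * (β - α) = E (-((1 + lam) * A))) :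
    volume (Icc α β ∩ Wc n θ (lam + e2) a) ≤ ENNReal.ofReal (β - α) *
      ENNReal.ofReal (8 * n * cnt n 1 * E (-(e2 / 2 * a))) := by
  have hn := h.hn
  have hε := h.hε
  have hε2 := h.hε2
  have hg0 := h.hg0
  have hg20 := h.g20
  have hlam := h.hlam
  have hlam1 := h.hlam1
  have hn' : (3:ℝ) ≤ n := by exact_mod_cast hn
  have hAp : (0:ℝ) ≤ A := Nat.cast_nonneg A
  have hgA : 0 ≤ g * A := by positivity
  have hgA2 : g * A * 20 ≤ (1 + lam) * A := by nlinarith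
  have hlA : 0 ≤ lam * A := by positivity
  have hlA2 : lam * A ≤ A := by nlinarith
  have hb1 : bb1 lam g ε A ≤ (1 + lam) * a := by
    unfold bb1
    have : (1 + lam) * ((1 - ε) * A - 1) ≤ (1 + lam) * a := mul_le_mul_of_nonneg_left ha (by linarith)
    have h2 : lam * (ε * A) ≤ 1 * (ε * A) := mul_le_mul_of_nonneg_right hlam1 (by positivity)
    linarith
  have hc := CL1 (by omega : 2 ≤ n) lam (bb1 lam g ε A) (lam + e2) 0 1 hlam (by linarith) a θ x0 hx0 one_pos hgood
    le_rfl hb1 hab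
  have hd : 2 * E (-(bb0 n lam g e A)) ≤ E (-(bb1 lam g ε A)) := by
    nth_rewrite 1 [← E_one]
    rw [← E_add]
    refine E_le.2 ?_
    unfold bb0 bb1
    have := mul_le_mul_of_nonneg_right h.he1 hAp
    linarith
  have hcnt : 0 ≤ cnt n 1 := by unfold cnt; positivity
  refine (measure_mono ?_).trans (hc.trans ?_)
  · rintro u ⟨hu, hw⟩
    refine ⟨u, ⟨hJ0.trans hu.1, hu.2.trans hJ1⟩, ?_, by simp, hw⟩
    rw [abs_le]
    constructor
    · linarith [hu.1]
    · linarith [hu.2]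
  · have hba : 0 ≤ β - α := by
      have : 0 < 4 * n * (β - α) := by rw [hJ]; exact E_pos _
      by_contra hneg
      push Not at hneg
      nlinarith
    rw [← ENNReal.ofReal_mul hba]
    refine ENNReal.ofReal_le_ofReal ?_
    have e1 : (β - α) * (8 * n * cnt n 1 * E (-(e2 / 2 * a))) =
      2 * cnt n 1 * (E (-((1 + lam) * A)) * E (-(e2 / 2 * a))) := by rw [← hJ]; ring
    rw [e1, h.v, zero_add, mul_assoc, mul_left_comm (E _) 2, ← mul_assoc, mul_comm (cnt n 1) 2, ← E_add, ← E_add]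
    refine mul_le_mul_of_nonneg_left (E_le.2 ?_) (by positivity)
    unfold bb1
    have h1 : g * ((1 - ε) * A - 1) ≤ g * a := mul_le_mul_of_nonneg_left ha hg0
    have h2 : e2 * ((1 - ε) * A - 1) ≤ e2 * a := mul_le_mul_of_nonneg_left ha (by linarith)
    have h3 : g * (ε * A) ≤ 1 * (ε * A) := mul_le_mul_of_nonneg_right (by linarith) (by positivity)
    have h4 : 32 * ε * A ≤ e2 * A := mul_le_mul_of_nonneg_right he2 hAp
    have h5 : ε * (e2 * A) ≤ 1 / 100 * (e2 * A) := mul_le_mul_of_nonneg_right hε2 (by linarith)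
    have h6 : e2 * 200 ≤ e2 * A := by
      refine mul_le_mul_of_nonneg_left ?_ (by linarith)
      nlinarith
    linarith

lemma case2_arith {n : ℕ} {lam g σ ε e : ℝ} (h : Par n lam g σ ε e) (A a : ℝ) (hA : 0 ≤ A)
    (hab : 2 * bb1 lam g ε A ≤ (1 + lam) * a) :
    A ≤ a ∧ bb2 lam A a + (2 * n ^ 2 - 2) * g * A + σ / 4 * a ≤ (1 + lam - g) * a := by
  have hε := h.hε
  have hε1 := h.hε1
  have hg0 := h.hg0
  have hg20 := h.g20
  have hlam := h.hlam
  have hσ := h.hσ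
  have hσg := h.hσg
  have hlam1 := h.hlam1
  have hn' : (3:ℝ) ≤ n := by exact_mod_cast h.hn
  unfold bb1 at hab
  have hG : 0 ≤ (2 * (n:ℝ) ^ 2 + 2) * g := by positivity
  have hAa : A ≤ a := by
    by_contra hc
    push Not at hc
    have h1 : (1 + lam) * a ≤ (1 + lam) * A := mul_le_mul_of_nonneg_left hc.le (by linarith)
    have hA0 : 0 < A := by
      rcases hA.lt_or_eq with h | h
      · exact h
      · subst h
        nlinarith
    have : 0 < (1 + lam - 2 * g - 8 * ε) * A := mul_pos (by linarith) hA0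
    nlinarith
  refine ⟨hAa, ?_⟩
  have ha : 0 ≤ a := hA.trans hAa
  rcases le_total a (2 * A) with hc | hc
  · have e1 : bb2 lam A a = (1 + lam) * A := by
      unfold bb2; rw [max_eq_left]; nlinarith
    rw [e1]
    have h1 : (g + σ / 4) * a ≤ (g + σ / 4) * (2 * A) := mul_le_mul_of_nonneg_left hc (by linarith)
    have h2 : ε * A ≤ σ / 16 * A := mul_le_mul_of_nonneg_right hε1 hA
    have h3 : σ * A = (1 + lam) * A - (2 * n ^ 2 + 2) * g * A := by rw [hσg]; ring
    nlinarith
  · have e1 : bb2 lam A a = (1 + lam) * a / 2 := by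
      unfold bb2; rw [max_eq_right]; nlinarith
    rw [e1]
    have h1 : (2 * (n:ℝ) ^ 2 - 2) * g * (2 * A) ≤ (2 * (n:ℝ) ^ 2 - 2) * g * a :=
      mul_le_mul_of_nonneg_left hc (mul_nonneg (by nlinarith) hg0)
    have h3 : σ * a = (1 + lam) * a - (2 * n ^ 2 + 2) * g * a := by rw [hσg]; ring
    have h4 : 0 ≤ σ * a := by positivity
    nlinarith

set_option maxHeartbeats 1000000 in
lemma stepC2 {n : ℕ} {lam g σ ε e : ℝ} (h : Par n lam g σ ε e) (e2 : ℝ) (he2 : 0 < e2) (θ : Fin n → ℝ) :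
    ∃ C δ : ℝ, 0 ≤ C ∧ 0 < δ ∧ ∃ a0 : ℕ, ∀ A a : ℕ, a0 ≤ a → 2 * bb1 lam g ε A ≤ (1 + lam) * a →
    ∀ x0 α β : ℝ, 
    GoodM (Hm n (wE n lam a (bb2 lam A a)) x0) (E (((2 - (n-1) * lam) * a - bb2 lam A a) / (n+1) - e * a)) →
    0 ≤ α → β ≤ 1 → x0 - 2 * E (-(bb0 n lam g e A)) ≤ α → 
    β ≤ x0 + 2 * E (-(bb0 n lam g e A)) → 4 * n * (β - α) = E (-((1 + lam) * A)) →
    volume (Icc α β ∩ Wc n θ (lam + e2) a) ≤ ENNReal.ofReal (β - α) *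
      ENNReal.ofReal (C * E (-(δ * a))) := by
  have hn := h.hn
  have hn' : (3:ℝ) ≤ n := by exact_mod_cast hn
  have hg0 := h.hg0
  have hσ := h.hσ
  have hm : (0:ℝ) < n + 1 := by linarith
  set e4 := σ / (32 * (n+1)) with he4
  have he4p : 0 < e4 := by positivity
  set K0 := growK n * (2 * (n+1)) * (16 * n) ^ (2 * (n-1)) with hK0
  have ev1 := (E_ev e4 (n+1) 1 he4p one_pos).natCast_atTop
  have ev2 := (E_ev (σ / (8 * (n+1))) K0 1 (by positivity) one_pos).natCast_atTop
  obtain ⟨a0, ha0⟩ := eventually_atTop.1 (ev1.and ev2)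
  have hcnt : 0 ≤ cnt n 1 := by unfold cnt; positivity
  set δ := min (e4 / (2 * (n-1))) (g + e2) with hδ
  have hδ1 : 0 < e4 / (2 * ((n:ℝ)-1)) := by apply div_pos he4p; linarith
  set C1 := KMconst (n+2) * growG n (n+1) with hC1
  set C2 := cnt n 1 * (2 + 2 * (4 * n)) * 2 with hC2
  have hC1p : 0 ≤ C1 := mul_nonneg (KMconst_nonneg _) (growG_nonneg n (by linarith))
  have hC2p : 0 ≤ C2 := by positivity
  refine ⟨C1 + C2, δ, by linarith, lt_min hδ1 (by linarith), a0, ?_⟩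
  intro A a ha hab x0 α β hgood hα hβ hJ2 hJ3 hJ
  have hAp : (0:ℝ) ≤ A := Nat.cast_nonneg A
  have hap : (0:ℝ) ≤ a := Nat.cast_nonneg a
  obtain ⟨hAa, hF⟩ := case2_arith h A a hAp hab
  obtain ⟨hM, hK⟩ := ha0 a ha
  have hba : 0 < β - α := by
    have : 0 < 4 * n * (β - α) := by rw [hJ]; exact E_pos _
    by_contra hneg
    push Not at hneg
    nlinarith
  have hM' : (n:ℝ) + 1 ≤ E (e4 * a) := by
    rw [E_neg, mul_inv_lt_iff₀ (E_pos _)] at hM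
    linarith
  have hD : 2 * (2 * E (-(bb0 n lam g e A))) / (β - α) = 16 * n * E ((g + 2 * (n+1) * e) * A) := by
    have : β - α = E (-((1 + lam) * A)) / (4 * n) := by rw [← hJ]; field_simp
    rw [this, div_div_eq_mul_div, div_eq_iff (E_pos _).ne', mul_assoc (16 * (n:ℝ)), ← E_add]
    have : (g + 2 * (n+1) * e) * A + -((1 + lam) * A) = -(bb0 n lam g e A) := by unfold bb0; ring
    rw [this]; ring
  have hkap : growK n * (2 * (n+1)) * E (e4 * a) * (2 * (2 * E (-(bb0 n lam g e A))) / (β - α)) ^ (2 * (n-1)) <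
      E (((2 - (n-1) * lam) * a - bb2 lam A a) / (n+1) - e * a) := by
    rw [hD, mul_pow, E_pow]
    have : growK n * (2 * (n+1)) * E (e4 * a) * ((16 * n) ^ (2 * (n-1)) * E ((2 * (n-1) : ℕ) * ((g + 2 * (n+1) * e) * A)))
      = K0 * E (e4 * a + 2 * (n-1) * ((g + 2 * (n+1) * e) * A)) := by
      rw [E_add, hK0]
      push_cast [Nat.cast_sub (show 1 ≤ n by omega)]
      ring
    rw [this]
    rw [E_neg, mul_inv_lt_iff₀ (E_pos _), one_mul] at hK
    refine (mul_lt_mul_of_pos_right hK (E_pos _)).trans_le ?_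
    rw [← E_add]
    refine E_le.2 ?_
    rw [h.v]
    have hq : bb2 lam A a / (n+1) + 2 * (n-1) * (g * A) + σ / (4 * (n+1)) * a ≤ (1 + lam - g) * a / (n+1) := by
      rw [← sub_nonneg]
      have : (1 + lam - g) * a / (n+1) - (bb2 lam A a / (n+1) + 2 * (n-1) * (g * A) + σ / (4 * (n+1)) * a) =
        ((1 + lam - g) * a - (bb2 lam A a + (2 * n ^ 2 - 2) * g * A + σ / 4 * a)) / (n+1) := by
        field_simp; ring
      rw [this]
      exact div_nonneg (by linarith) hm.le
    have h5 : (4 * n * (n+1) + 1) * e ≤ e4 := by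
      rw [he4, le_div_iff₀ (by positivity)]
      linarith [h.he2]
    have h6 := mul_le_mul_of_nonneg_right h5 hap
    have h7 : 4 * (n-1) * (n+1) * e * A ≤ 4 * (n-1) * (n+1) * e * (a:ℝ) :=
      mul_le_mul_of_nonneg_left hAa (mul_nonneg (mul_nonneg (by linarith) hm.le) h.he.le)
    have h8 : 0 ≤ (n+1) * e * (a:ℝ) := mul_nonneg (mul_nonneg hm.le h.he.le) hap
    have h9 : σ / (8 * (n+1)) * a = 4 * (e4 * a) := by rw [he4]; field_simp; ring
    have h10 : σ / (4 * (n+1)) * a = 8 * (e4 * a) := by rw [he4]; field_simp; ring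
    have h11 : 0 ≤ e4 * a := by positivity
    rw [h9]; rw [h10] at hq
    rw [sub_div]
    linarith
  have hbad := km2 (by omega : 2 ≤ n) (wE n lam a (bb2 lam A a)) (wE_pos _ _ _ _) x0 _ (2 * E (-(bb0 n lam g e A)))
    α β (E (e4 * a)) (by linarith) hJ2 hJ3 (by have := E_pos (-(bb0 n lam g e A)); linarith) hgood hM' hkap
  have hb1 : bb2 lam A a ≤ (1 + lam) * a := by
    have hl := h.hlam
    unfold bb2
    refine max_le (mul_le_mul_of_nonneg_left hAa (by linarith)) ?_
    have : 0 ≤ (1 + lam) * a := by positivity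
    linarith
  have hb2 : (1 + lam) * a ≤ 2 * bb2 lam A a := by
    have := le_max_right ((1 + lam) * (A:ℝ)) ((1 + lam) * a / 2)
    unfold bb2; linarith
  have hcl := CLg (by omega : 2 ≤ n) lam (bb2 lam A a) (lam + e2) 0 1 h.hlam (by linarith) a θ one_pos le_rfl
    hb1 hb2 α β (4 * n) hα hβ (by linarith) (by have := E_pos (-(bb2 lam A a)); linarith) (by
      rw [hJ]; refine E_le.2 (neg_le_neg (le_max_left _ _)))
  have hsub : Icc α β ∩ Wc n θ (lam + e2) a ⊆ {x | x ∈ Icc α β ∧ ¬ GoodM (Hm n (wE n lam a (bb2 lam A a)) x) 1} ∪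
     {u | u ∈ Icc α β ∧ GoodM (Hm n (wE n lam a (bb2 lam A a)) u) 1 ∧ ∃ y ∈ Icc (0:ℝ) 1, |u - y| ≤ 0 ∧ y ∈ Wc n θ (lam + e2) a} := by
    rintro u ⟨hu, hw⟩
    by_cases hG : GoodM (Hm n (wE n lam a (bb2 lam A a)) u) 1
    · exact Or.inr ⟨hu, hG, u, ⟨hα.trans hu.1, hu.2.trans hβ⟩, by simp, hw⟩
    · exact Or.inl ⟨hu, hG⟩
  refine (measure_mono hsub).trans ((measure_union_le _ _).trans ((add_le_add hbad hcl).trans ?_))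
  rw [← ENNReal.ofReal_mul hba.le]
  have hG1 : growG n ((n+1) / E (e4 * a)) = growG n (n+1) * E (-(e4 / (2 * (n-1)) * a)) := by
    rw [div_eq_mul_inv, ← E_neg, growG_E (by omega) _ _ (by linarith)]
    congr 3; ring
  have hd1 : E (-(e4 / (2 * (n-1)) * a)) ≤ E (-(δ * a)) :=
    E_le.2 (neg_le_neg (mul_le_mul_of_nonneg_right (min_le_left _ _) hap))
  have hd2 : E (-((g + e2) * a)) ≤ E (-(δ * a)) :=
    E_le.2 (neg_le_neg (mul_le_mul_of_nonneg_right (min_le_right _ _) hap))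
  rw [← ENNReal.ofReal_add]
  · refine ENNReal.ofReal_le_ofReal ?_
    rw [hG1, h.v, zero_add]
    have e3 : E ((1 + lam - g) * a) * (2 * E (-((1 + (lam + e2)) * a))) = 2 * E (-((g + e2) * a)) := by
      rw [mul_left_comm, ← E_add]; congr 2; ring
    rw [e3]
    have i1 := mul_le_mul_of_nonneg_left hd1 (mul_nonneg hC1p hba.le)
    have i2 := mul_le_mul_of_nonneg_left hd2 (mul_nonneg hC2p hba.le)
    calc _ = C1 * (β - α) * E (-(e4 / (2 * (n-1)) * a)) + C2 * (β - α) * E (-((g + e2) * a)) := by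
          rw [hC1, hC2]; ring
      _ ≤ C1 * (β - α) * E (-(δ * a)) + C2 * (β - α) * E (-(δ * a)) := add_le_add i1 i2
      _ = _ := by ring
  · exact mul_nonneg (mul_nonneg (KMconst_nonneg _) (growG_nonneg n (div_nonneg (by linarith) (E_pos _).le))) hba.le
  · have h1 := E_pos ((2 - ((n:ℝ)-1) * lam) * a)
    have h2 := E_pos (-((1 + (lam + e2)) * a))
    have : 0 ≤ E ((2 - ((n:ℝ)-1) * lam) * a) * (2 * (0 + E (-((1 + (lam + e2)) * a)))) := by
      rw [zero_add]; positivity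
    have h3 : 0 ≤ cnt n 1 * (2 + 2 * (4 * n)) * (β - α) := mul_nonneg (by positivity) hba.le
    exact mul_nonneg h3 this

set_option maxHeartbeats 1000000 in
lemma stepB_core {n : ℕ} (hn : 2 ≤ n) (lam b κ : ℝ) (A : ℕ) (θ : Fin n → ℝ) (x0 : ℝ) (hx0 : x0 ∈ Icc (1/4:ℝ) (3/4))
    (hlam : 0 ≤ lam) (hlam1 : lam ≤ 1)
    (hκ : 0 < κ) (hκ2 : 2 ^ (n+1) / κ ≤ 1 / (16 * n)) (hg : GoodM (Hm n (wE n lam A b) x0) κ)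
    (hb1 : b ≤ (1 + lam) * A) (hb2 : (1 + lam) * A ≤ 2 * b) (hd : 2 * E (-b) ≤ 1/4) :
    ∃ xk : ℝ, ∃ p : Fin n → ℤ, ∃ q : ℕ, 2 ^ A ≤ q ∧ |xk - x0| ≤ E (-b) ∧
      ∀ y, |y - xk| ≤ E (-((1 + lam) * A)) / (8 * n) → Cl n θ lam y p q := by
  have hn' : (2:ℝ) ≤ n := by exact_mod_cast hn
  set S := E (-(lam * A)) with hS
  set Q := E (A:ℝ) with hQ
  have hSp : 0 < S := E_pos _
  have hQp : 0 < Q := E_pos _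
  have hx01 : x0 ∈ Icc (0:ℝ) 1 := ⟨by linarith [hx0.1], by linarith [hx0.2]⟩
  have hQS : Q * E (-((1 + lam) * A)) = S := by rw [hQ, ← E_add, hS]; congr 1; ring
  have hdS : Q * E (-b) ^ 2 ≤ S := by
    rw [E_pow, ← E_add]; exact E_le.2 (by push_cast; linarith)
  obtain ⟨k, z, hz, hk⟩ := good_cover (Hm n (wE n lam A b) x0) κ hκ hg
    (fun j => 3 / 2 * Q * x0 ^ j.val + ith θ j)
  set η : ℝ := 1 / (16 * n) with hη
  have hηp : 0 < η := by positivity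
  have hηn : η * n = 1 / 16 := by rw [hη]; field_simp
  have hη1 : η ≤ 1 / 32 := by nlinarith
  have hz' : ∀ i, |z i| ≤ η := fun i => (hz i).trans hκ2
  have h0 := hk 0
  rw [HmT (by omega)] at h0
  have hw0 : wE n lam A b 0 = Q := by simp [wE, hQ]
  have hv1 : ((1 : Fin (n+1)) : ℕ) = 1 := by
    rw [Fin.val_one', Nat.mod_eq_of_lt (by omega)]
  have hw1 : wE n lam A b 1 = Q * E (-b) := by
    simp only [wE, hv1]
    simp [hQ, ← E_add, sub_eq_add_neg]
  simp [ith, hw0] at h0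
  have hz0 := abs_le.1 (hz' 0)
  have hk0 : (k 0 : ℝ) = Q * (3 / 2 + z 0) := by linarith
  have hk0p : (0:ℝ) < k 0 := by rw [hk0]; apply mul_pos hQp; linarith
  obtain ⟨q, hq⟩ := Int.eq_ofNat_of_zero_le (show 0 ≤ k 0 by exact_mod_cast hk0p.le)
  have hqk : (q:ℝ) = Q * (3 / 2 + z 0) := by rw [← hk0, hq]; simp
  have hq1 : Q ≤ q := by rw [hqk]; nlinarith
  have hq2 : (q:ℝ) ≤ 2 * Q := by rw [hqk]; nlinarith
  have hqp : (0:ℝ) < q := by linarith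
  set d := E (-b) with hdd
  have hdp : 0 < d := E_pos _
  set s := Q * d * z 1 / q with hs
  have hsd : |s| ≤ η * d := by
    rw [hs, abs_div, abs_mul, abs_of_pos hqp, abs_of_pos (by positivity : 0 < Q * d), div_le_iff₀ hqp]
    calc Q * d * |z 1| ≤ Q * d * η := mul_le_mul_of_nonneg_left (hz' 1) (by positivity)
      _ = η * d * Q := by ring
      _ ≤ _ := mul_le_mul_of_nonneg_left hq1 (by positivity)
  have hsd' : |s| ≤ d := hsd.trans (by nlinarith)
  have hEb : E (-((1 + lam) * A)) ≤ d := E_le.2 (by linarith)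
  have hxk : x0 + s ∈ Icc (0:ℝ) 1 := by
    have := abs_le.1 hsd'
    constructor
    · linarith [hx0.1]
    · linarith [hx0.2]
  refine ⟨x0 + s, fun i => k i.succ, q, ?_, by simpa using hsd', ?_⟩
  · have : ((2 ^ A : ℕ) : ℝ) ≤ q := by push_cast; rw [← E_nat]; exact hq1
    exact_mod_cast this
  intro y hy
  have hyI : y ∈ Icc (0:ℝ) 1 := by
    have h1 := abs_le.1 hsd'
    have h2 : E (-((1 + lam) * A)) / (8 * n) ≤ d := by
      refine (div_le_self (E_pos _).le (by linarith)).trans hEb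
    have h3 := abs_le.1 (hy.trans h2)
    constructor
    · linarith [hx0.1]
    · linarith [hx0.2]
  intro i
  have hin : ((i.val + 1 : ℕ) : ℝ) ≤ n := by exact_mod_cast i.isLt
  have hki := hk i.succ
  rw [HmT (by omega), hw0, hw1] at hki
  simp only [ith, Fin.cons_succ, Fin.val_succ] at hki
  have hrem : |if 2 ≤ i.val + 1 then wE n lam A b i.succ * z i.succ else 0| ≤ S * η := by
    split_ifs with h2
    · have : wE n lam A b i.succ = S := by
        simp only [wE, Fin.val_succ, show i.val + 1 ≠ 0 by omega, show i.val + 1 ≠ 1 by omega, if_false]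
        rfl
      rw [this, abs_mul, abs_of_pos hSp]
      exact mul_le_mul_of_nonneg_left (hz' _) hSp.le
    · simp; positivity
  set R := (if 2 ≤ i.val + 1 then wE n lam A b i.succ * z i.succ else 0) with hR
  have hqs : q * s = Q * d * z 1 := by rw [hs]; field_simp
  have hkt : (k i.succ : ℝ) + θ i = q * x0 ^ (i.val+1) + q * s * ((i.val + 1 : ℕ) * x0 ^ (i.val + 1 - 1)) + R := by
    rw [hqs, hqk]; linarith
  have ht := taylor_pow x0 (x0 + s) hx01 hxk (i.val+1)
  rw [add_sub_cancel_left] at ht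
  have hl := pow_lip (x0 + s) y hxk hyI (i.val+1)
  have ht2 : q * |(x0+s) ^ (i.val+1) - x0 ^ (i.val+1) - (i.val+1 : ℕ) * x0 ^ (i.val+1-1) * s| ≤ S / 128 := by
    have hs2 : s ^ 2 ≤ (η * d) ^ 2 := by rw [← sq_abs s]; exact pow_le_pow_left₀ (abs_nonneg _) hsd 2
    have hn2 : ((i.val + 1 : ℕ) : ℝ) ^ 2 ≤ n ^ 2 := pow_le_pow_left₀ (by positivity) hin 2
    calc _ ≤ (2 * Q) * (n ^ 2 * (η * d) ^ 2) :=
          mul_le_mul hq2 (ht.trans (mul_le_mul hn2 hs2 (by positivity) (by positivity))) (abs_nonneg _) (by positivity)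
      _ = 2 * (η * n) ^ 2 * (Q * d ^ 2) := by ring
      _ = 1 / 128 * (Q * d ^ 2) := by rw [hηn]; ring
      _ ≤ _ := by linarith
  have hl2 : q * |y ^ (i.val+1) - (x0+s) ^ (i.val+1)| ≤ S / 4 := by
    calc _ ≤ (2 * Q) * (n * (E (-((1 + lam) * A)) / (8 * n))) :=
          mul_le_mul hq2 (hl.trans (mul_le_mul hin hy (abs_nonneg _) (by positivity))) (abs_nonneg _) (by positivity)
      _ = (Q * E (-((1 + lam) * A))) / 4 := by field_simp; ring
      _ = _ := by rw [hQS]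
  have htot : |q * y ^ (i.val+1) - (k i.succ + θ i)| ≤ S / 2 := by
    have e1 : q * y ^ (i.val+1) - (k i.succ + θ i) = q * (y ^ (i.val+1) - (x0+s) ^ (i.val+1)) +
       q * ((x0+s) ^ (i.val+1) - x0 ^ (i.val+1) - (i.val+1 : ℕ) * x0 ^ (i.val+1-1) * s) - R := by
      rw [hkt]; ring
    rw [e1]
    have h1 := abs_sub (q * (y ^ (i.val+1) - (x0+s) ^ (i.val+1)) +
       q * ((x0+s) ^ (i.val+1) - x0 ^ (i.val+1) - (i.val+1 : ℕ) * x0 ^ (i.val+1-1) * s)) R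
    have h2 := abs_add_le (q * (y ^ (i.val+1) - (x0+s) ^ (i.val+1)))
       (q * ((x0+s) ^ (i.val+1) - x0 ^ (i.val+1) - (i.val+1 : ℕ) * x0 ^ (i.val+1-1) * s))
    rw [abs_mul, abs_mul (q:ℝ) ((x0+s) ^ (i.val+1) - x0 ^ (i.val+1) - _), abs_of_pos hqp] at h2
    have h3 : S * η ≤ S * (1 / 32) := mul_le_mul_of_nonneg_left hη1 hSp.le
    linarith
  have hqr : S / 2 ≤ (q:ℝ) ^ (-lam) := by
    have h1 : (2 * Q) ^ (-lam) ≤ (q:ℝ) ^ (-lam) := Real.rpow_le_rpow_of_nonpos hqp hq2 (by linarith)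
    refine le_trans ?_ h1
    have e1 : 2 * Q = E (A + 1) := by rw [E_add, E_one, hQ]; ring
    rw [e1, E_rpow]
    have e2 : S / 2 = E (-(lam * A) - 1) := by rw [E_sub, E_one]
    rw [e2]
    exact E_le.2 (by linarith)
  rw [le_div_iff₀ hqp]
  have e2 : |y ^ (i.val + 1) - (k i.succ + θ i) / q| * q = |q * y ^ (i.val+1) - (k i.succ + θ i)| := by
    nth_rewrite 2 [← abs_of_pos hqp]
    rw [← abs_mul]
    congr 1
    field_simp
  rw [e2]
  exact htot.trans hqr

lemma half_good {n : ℕ} {lam g σ ε e : ℝ} (h : Par n lam g σ ε e) (α β : ℝ) (hαβ : α < β) (hα : 0 ≤ α) (hβ : β ≤ 1) :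
    ∃ C δ : ℝ, 0 ≤ C ∧ 0 < δ ∧ ∃ a0 : ℕ, ∀ a : ℕ, a0 ≤ a →
      volume {x | x ∈ Icc α β ∧ ¬ GoodM (Hm n (wE n lam a ((1 + lam) * a / 2)) x) 1} ≤
        ENNReal.ofReal (C * E (-(δ * a))) := by
  have hn' : (3:ℝ) ≤ n := by exact_mod_cast h.hn
  have hlam := h.hlam
  have hlam1 := h.hlam1
  have hg20 := h.g20
  have hep : 0 < ((1 + lam) / 2 - g) / (n + 1) := div_pos (by linarith) (by linarith)
  obtain ⟨C, δ, hC, hδ, a0, H⟩ := km1E (by have := h.hn; omega : 2 ≤ n) lam hlam α β hαβ hα hβ _ hep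
  refine ⟨C, δ, hC, hδ, a0, fun a ha => ?_⟩
  have hap : (0:ℝ) ≤ a := Nat.cast_nonneg a
  have := H a ha ((1 + lam) * a / 2) (by positivity) (by nlinarith)
  have e1 : ((2 - (n-1) * lam) * a - (1 + lam) * a / 2) / (n+1) - ((1 + lam) / 2 - g) / (n + 1) * a = 0 := by
    rw [h.v]; field_simp; ring
  rw [e1, E_zero] at this
  exact this

lemma W_small {n : ℕ} {lam g σ ε e : ℝ} (h : Par n lam g σ ε e) (e1 : ℝ) (he1 : 0 < e1) (θ : Fin n → ℝ)
    (α β : ℝ) (hαβ : α < β) (hα : 0 ≤ α) (hβ : β ≤ 1) :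
    ∃ C δ : ℝ, 0 ≤ C ∧ 0 < δ ∧ ∃ a0 : ℕ, ∀ a : ℕ, a0 ≤ a → ∀ D0 : ℝ, 0 ≤ D0 →
      D0 ≤ E (-((1 + lam) * a / 2)) / 2 →
      volume {u | u ∈ Icc α β ∧ ∃ y ∈ Icc (0:ℝ) 1, |u - y| ≤ D0 ∧ y ∈ Wc n θ (lam + e1) a} ≤
        ENNReal.ofReal (C * (E (-(δ * a)) + E ((1 + lam - g) * a) * D0)) := by
  have hn' : (3:ℝ) ≤ n := by exact_mod_cast h.hn
  have hlam := h.hlam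
  have hg0 := h.hg0
  obtain ⟨C, δ, hC, hδ, a0, H⟩ := half_good h α β hαβ hα hβ
  have hcnt : 0 ≤ cnt n 1 := by unfold cnt; positivity
  have hba : 0 < β - α := by linarith
  set C2 := cnt n 1 * (2 + 2 * (1 / (β - α))) * (β - α) * 2 with hC2
  have hC2p : 0 ≤ C2 := by positivity
  refine ⟨C + C2, min δ (g + e1), by linarith, lt_min hδ (by linarith), a0, fun a ha D0 hD0 hD => ?_⟩
  have hap : (0:ℝ) ≤ a := Nat.cast_nonneg a
  have h1 := H a ha
  have hLa : 0 ≤ (1 + lam) * a := by positivity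
  have h2 := CLg (by have := h.hn; omega : 2 ≤ n) lam ((1 + lam) * a / 2) (lam + e1) D0 1 hlam (by linarith) a θ one_pos hD0
    (by linarith) (by linarith) α β (1 / (β - α)) hα hβ hαβ hD (by
      rw [div_mul_cancel₀ _ hba.ne']
      refine le_trans ?_ E_zero.le
      exact E_le.2 (by linarith))
  have hsub : {u | u ∈ Icc α β ∧ ∃ y ∈ Icc (0:ℝ) 1, |u - y| ≤ D0 ∧ y ∈ Wc n θ (lam + e1) a} ⊆
     {x | x ∈ Icc α β ∧ ¬ GoodM (Hm n (wE n lam a ((1 + lam) * a / 2)) x) 1} ∪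
     {u | u ∈ Icc α β ∧ GoodM (Hm n (wE n lam a ((1 + lam) * a / 2)) u) 1 ∧
        ∃ y ∈ Icc (0:ℝ) 1, |u - y| ≤ D0 ∧ y ∈ Wc n θ (lam + e1) a} := by
    rintro u ⟨hu, hw⟩
    by_cases hG : GoodM (Hm n (wE n lam a ((1 + lam) * a / 2)) u) 1
    · exact Or.inr ⟨hu, hG, hw⟩
    · exact Or.inl ⟨hu, hG⟩
  refine (measure_mono hsub).trans ((measure_union_le _ _).trans ((add_le_add h1 h2).trans ?_))
  have hd1 : E (-(δ * a)) ≤ E (-(min δ (g + e1) * a)) :=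
    E_le.2 (neg_le_neg (mul_le_mul_of_nonneg_right (min_le_left _ _) hap))
  have hd2 : E (-((g + e1) * a)) ≤ E (-(min δ (g + e1) * a)) :=
    E_le.2 (neg_le_neg (mul_le_mul_of_nonneg_right (min_le_right _ _) hap))
  set X := E (-(min δ (g + e1) * a)) with hX
  have e3 : E ((1 + lam - g) * a) * E (-((1 + (lam + e1)) * a)) = E (-((g + e1) * a)) := by
    rw [← E_add]; congr 1; ring
  have e4 : cnt n 1 * (2 + 2 * (1 / (β - α))) * (β - α) * (E ((2 - (n-1) * lam) * a) * (2 * (D0 + E (-((1 + (lam + e1)) * a)))))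
    = C2 * (E ((1 + lam - g) * a) * D0 + E (-((g + e1) * a))) := by
    rw [h.v, ← e3, hC2]; ring
  rw [e4]
  have p1 := E_pos ((1 + lam - g) * a)
  have p2 := E_pos (-((g + e1) * a))
  have p3 := E_pos (-(δ * a))
  rw [← ENNReal.ofReal_add (by positivity) (by positivity)]
  refine ENNReal.ofReal_le_ofReal ?_
  have i1 := mul_le_mul_of_nonneg_left hd1 hC
  have i2 := mul_le_mul_of_nonneg_left hd2 hC2p
  have i3 : 0 ≤ C * (E ((1 + lam - g) * a) * D0) := by positivity
  linarith

lemma W_base {n : ℕ} {lam g σ ε e : ℝ} (h : Par n lam g σ ε e) (e1 : ℝ) (he1 : 0 < e1) (θ : Fin n → ℝ)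
    (α β : ℝ) (hαβ : α < β) (hα : 0 ≤ α) (hβ : β ≤ 1) :
    ∃ u : ℕ, 1 ≤ u ∧ volume (Icc α β ∩ ⋃ a ∈ {a | u ≤ a}, Wc n θ (lam + e1) a) ≤ ENNReal.ofReal ((β - α) / 4) := by
  obtain ⟨C, δ, hC, hδ, a0, H⟩ := W_small h e1 he1 θ α β hαβ hα hβ
  obtain ⟨u, hu⟩ := ((tail_sum C δ ((β - α) / 4) hC hδ (by linarith)).and (eventually_ge_atTop (max 1 a0))).exists
  refine ⟨u, (le_max_left _ _).trans hu.2, ?_⟩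
  refine le_trans (measure_mono ?_) (union_tail (S := fun a => {v | v ∈ Icc α β ∧ ∃ y ∈ Icc (0:ℝ) 1, |v - y| ≤ 0 ∧ y ∈ Wc n θ (lam + e1) a}) (C := C) (δ := δ) ?_ hu.1)
  · rintro x ⟨hx, hw⟩
    simp only [mem_iUnion, exists_prop] at hw ⊢
    obtain ⟨a, ha, hxa⟩ := hw
    exact ⟨a, ha, hx, x, ⟨hα.trans hx.1, hx.2.trans hβ⟩, by simp, hxa⟩
  · intro a ha
    have := H a ((le_max_right _ _).trans (hu.2.trans ha)) 0 le_rfl (by have := E_pos (-((1 + lam) * a / 2)); linarith)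
    simpa using this

lemma W_iv {n : ℕ} {lam g σ ε e : ℝ} (h : Par n lam g σ ε e) (e1 : ℝ) (he1 : 0 < e1) (θ : Fin n → ℝ)
    (α β : ℝ) (hαβ : α < β) (hα : 0 ≤ α) (hβ : β ≤ 1) :
    ∃ C δ : ℝ, 0 ≤ C ∧ 0 < δ ∧ ∃ a0 : ℕ, ∀ A a : ℕ, a0 ≤ a → a ≤ (1 - ε) * A → 
      volume {u | u ∈ Icc α β ∧ ∃ y ∈ Icc (0:ℝ) 1, |u - y| ≤ 2 * E (-(bb0 n lam g e A)) ∧ y ∈ Wc n θ (lam + e1) a} ≤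
        ENNReal.ofReal (C * E (-(δ * a))) := by
  have hn' : (3:ℝ) ≤ n := by exact_mod_cast h.hn
  have hlam := h.hlam
  have hlam1 := h.hlam1
  have hg0 := h.hg0
  have hg20 := h.g20
  have hε := h.hε
  have hε2 := h.hε2
  have he1' := h.he1
  have hep := h.he
  obtain ⟨C, δ, hC, hδ, a0, H⟩ := W_small h e1 he1 θ α β hαβ hα hβ
  refine ⟨3 * C, min δ (ε / 2), by linarith, lt_min hδ (by linarith), max a0 10, fun A a ha haA => ?_⟩
  have hap : (10:ℝ) ≤ a := by exact_mod_cast (le_max_right _ _).trans ha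
  have hAa : (1 + ε) * a ≤ A := by
    have h1 : (1 + ε) * a ≤ (1 + ε) * ((1 - ε) * A) := mul_le_mul_of_nonneg_left haA (by linarith)
    have : 0 ≤ ε ^ 2 * (A:ℝ) := by positivity
    nlinarith
  set s := 1 + lam - g - 2 * (n+1) * e with hs
  have hs1 : (1 + lam - g) - ε / 4 ≤ s := by rw [hs]; nlinarith
  have hs2 : (0.9:ℝ) ≤ s := by linarith
  have hbb : bb0 n lam g e A = s * A := rfl
  have hAs : s * ((1 + ε) * a) ≤ s * A := mul_le_mul_of_nonneg_left hAa (by linarith)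
  have hsa : ((1 + lam - g) - ε / 4) * ((1 + ε) * a) ≤ s * ((1 + ε) * a) :=
    mul_le_mul_of_nonneg_right hs1 (by positivity)
  have hεa : 0 ≤ ε * a := by positivity
  have key : (1 + lam - g) * a + ε / 2 * a ≤ s * A := by
    refine le_trans ?_ (hsa.trans hAs)
    have i1 : 0.9 * (ε * a) ≤ (1 + lam - g) * (ε * a) := mul_le_mul_of_nonneg_right (by linarith) hεa
    have i2 : ε * (ε * a) ≤ 1 / 100 * (ε * a) := mul_le_mul_of_nonneg_right hε2 hεa
    linarith
  have hD : 2 * E (-(bb0 n lam g e A)) ≤ E (-((1 + lam) * a / 2)) / 2 := by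
    have : E (-(bb0 n lam g e A)) ≤ E (-((1 + lam) * a / 2) - 2) := by
      refine E_le.2 ?_
      rw [hbb]
      have : 0.4 * (a:ℝ) ≤ ((1 + lam) / 2 - g) * a := mul_le_mul_of_nonneg_right (by linarith) (by linarith)
      nlinarith
    rw [E_sub] at this
    have e2 : E 2 = 4 := by
      have := E_add 1 1
      rw [E_one] at this
      norm_num at this
      exact this
    rw [e2] at this
    linarith
  have := H a ((le_max_left _ _).trans ha) (2 * E (-(bb0 n lam g e A))) (by have := E_pos (-(bb0 n lam g e A)); linarith) hD
  refine this.trans (ENNReal.ofReal_le_ofReal ?_)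
  have hd1 : E (-(δ * a)) ≤ E (-(min δ (ε / 2) * a)) :=
    E_le.2 (neg_le_neg (mul_le_mul_of_nonneg_right (min_le_left _ _) (by linarith)))
  have hd2 : E (-(ε / 2 * a)) ≤ E (-(min δ (ε / 2) * a)) :=
    E_le.2 (neg_le_neg (mul_le_mul_of_nonneg_right (min_le_right _ _) (by linarith)))
  have hd3 : E ((1 + lam - g) * a) * E (-(bb0 n lam g e A)) ≤ E (-(ε / 2 * a)) := by
    rw [← E_add, hbb]; exact E_le.2 (by linarith)
  have : E (-(δ * a)) + E ((1 + lam - g) * a) * (2 * E (-(bb0 n lam g e A))) ≤ 3 * E (-(min δ (ε / 2) * a)) := by linarith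
  calc _ ≤ C * (3 * E (-(min δ (ε / 2) * a))) := mul_le_mul_of_nonneg_left this hC
    _ = _ := by ring

lemma Cl_mono {n : ℕ} {θ : Fin n → ℝ} {τ τ' y : ℝ} (h : τ ≤ τ') {p : Fin n → ℤ} {q : ℕ} (hq : 1 ≤ q)
    (hc : Cl n θ τ' y p q) : Cl n θ τ y p q := by
  intro i
  refine (hc i).trans (div_le_div_of_nonneg_right ?_ (Nat.cast_nonneg q))
  exact Real.rpow_le_rpow_of_exponent_le (by exact_mod_cast hq) (by linarith)

lemma Wc_mono {n : ℕ} {θ : Fin n → ℝ} {τ τ' : ℝ} (h : τ ≤ τ') {a : ℕ} : Wc n θ τ' a ⊆ Wc n θ τ a := by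
  rintro y ⟨p, q, h1, h2, hc⟩
  exact ⟨p, q, h1, h2, Cl_mono h (Nat.one_le_two_pow.trans h1) hc⟩

lemma Wc_near {n : ℕ} {θ : Fin n → ℝ} (lam e1 : ℝ) (hlam : 0 ≤ lam) (he1 : 0 < e1) (a a1 : ℕ) (ha : 1 ≤ a) (ha1 : a < a1)
    (x y d : ℝ) (hx : x ∈ Icc (0:ℝ) 1) (hy : y ∈ Icc (0:ℝ) 1) (hxy : |x - y| ≤ d)
    (hd : n * d ≤ E (-((1 + lam + e1) * a1)) * (1 - E (-e1)))
    (hw : y ∈ Wc n θ (lam + 2 * e1) a) : x ∈ Wc n θ (lam + e1) a := by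
  obtain ⟨p, q, h1, h2, hc⟩ := hw
  refine ⟨p, q, h1, h2, fun i => ?_⟩
  have hq2 : (2:ℝ) ≤ q := by
    have : 2 ^ 1 ≤ 2 ^ a := Nat.pow_le_pow_right (by norm_num) ha
    exact_mod_cast (by omega : 2 ≤ q)
  have hqp : (0:ℝ) < q := by linarith
  have hqa : (q:ℝ) ≤ E a1 := by
    rw [E_nat]
    have : 2 ^ (a+1) ≤ 2 ^ a1 := Nat.pow_le_pow_right (by norm_num) ha1
    exact_mod_cast (by omega : q ≤ 2 ^ a1)
  have hin : ((i.val + 1 : ℕ) : ℝ) ≤ n := by exact_mod_cast i.isLt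
  have hl := pow_lip y x hy hx (i.val + 1)
  have hl2 : |x ^ (i.val+1) - y ^ (i.val+1)| ≤ n * d :=
    hl.trans (mul_le_mul hin hxy (abs_nonneg _) (Nat.cast_nonneg _))
  have hci := hc i
  have htri := abs_add_le (x ^ (i.val+1) - y ^ (i.val+1)) (y ^ (i.val+1) - (p i + θ i) / q)
  rw [sub_add_sub_cancel] at htri
  refine htri.trans ((add_le_add hl2 hci).trans ?_)
  have e1' : (q:ℝ) ^ (-(lam + 2 * e1)) / q = (q:ℝ) ^ (-(1 + lam + e1)) * (q:ℝ) ^ (-e1) := by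
    rw [← Real.rpow_add hqp, eq_comm, eq_div_iff hqp.ne', ← Real.rpow_add_one hqp.ne']
    congr 1; ring
  have e2' : (q:ℝ) ^ (-(lam + e1)) / q = (q:ℝ) ^ (-(1 + lam + e1)) := by
    rw [eq_comm, eq_div_iff hqp.ne', ← Real.rpow_add_one hqp.ne']
    congr 1; ring
  rw [e1', e2']
  have i1 : (q:ℝ) ^ (-e1) ≤ E (-e1) := Real.rpow_le_rpow_of_nonpos two_pos hq2 (by linarith)
  have i2 : E (-((1 + lam + e1) * a1)) ≤ (q:ℝ) ^ (-(1 + lam + e1)) := by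
    have : E (-((1 + lam + e1) * a1)) = E a1 ^ (-(1 + lam + e1)) := by rw [E_rpow]; congr 1; ring
    rw [this]
    exact Real.rpow_le_rpow_of_nonpos hqp hqa (by linarith)
  have i3 : 0 ≤ 1 - E (-e1) := by
    have : E (-e1) ≤ E 0 := E_le.2 (by linarith)
    rw [E_zero] at this; linarith
  have i4 : 0 ≤ (q:ℝ) ^ (-(1 + lam + e1)) := by positivity
  have i5 := mul_le_mul_of_nonneg_right i2 i3
  have i6 := mul_le_mul_of_nonneg_left i1 i4
  linarith

lemma case1_arith {n : ℕ} {lam g σ ε e : ℝ} (h : Par n lam g σ ε e) (A a : ℝ) (hA : 0 ≤ A) (hA1 : 2 ≤ ε * A)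
    (ha : (1 - ε) * A - 1 ≤ a) (hab : (1 + lam) * a ≤ 2 * bb1 lam g ε A) :
    0 ≤ bb1 lam g ε A ∧ bb1 lam g ε A ≤ (1 + lam) * a ∧
    0 ≤ ((2 - (n-1) * lam) * a - bb1 lam g ε A) / (n+1) - e * a := by
  have hn' : (3:ℝ) ≤ n := by exact_mod_cast h.hn
  have hε := h.hε
  have hε2 := h.hε2
  have hg0 := h.hg0
  have hg20 := h.g20
  have hlam := h.hlam
  have hlam1 := h.hlam1
  have hgA : 0 ≤ g * A := by positivity
  have hb0 : 0 ≤ bb1 lam g ε A := by unfold bb1; exact mul_nonneg (by linarith) hA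
  have h2 : lam * (ε * A) ≤ 1 * (ε * A) := mul_le_mul_of_nonneg_right hlam1 (by positivity)
  refine ⟨hb0, ?_, ?_⟩
  · unfold bb1
    have : (1 + lam) * ((1 - ε) * A - 1) ≤ (1 + lam) * a := mul_le_mul_of_nonneg_left ha (by linarith)
    nlinarith
  · have ha2 : a ≤ 2 * A := by
      by_contra hc
      push Not at hc
      have : (1 + lam) * (2 * A) < (1 + lam) * a := mul_lt_mul_of_pos_left hc (by linarith)
      unfold bb1 at hab
      have : 0 ≤ (g + 4 * ε) * A := mul_nonneg (by linarith) hA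
      nlinarith
    have h3 : ε * A ≤ (1 + lam - g) * a - bb1 lam g ε A := by
      unfold bb1
      have : (1 + lam - g) * ((1 - ε) * A - 1) ≤ (1 + lam - g) * a := mul_le_mul_of_nonneg_left ha (by linarith)
      have h4 : (1 + lam - g) * (ε * A) ≤ 2 * (ε * A) := mul_le_mul_of_nonneg_right (by linarith) (by linarith)
      nlinarith
    rw [h.v, sub_nonneg, le_div_iff₀ (by linarith)]
    have h5 : (n+1) * e * a ≤ (n+1) * e * (2 * A) :=
      mul_le_mul_of_nonneg_left ha2 (mul_nonneg (by linarith) h.he.le)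
    have h6 := mul_le_mul_of_nonneg_right h.he1 hA
    linarith

lemma pick_pt {α β : ℝ} (hαβ : α < β) {B1 B2 B3 B4 : Set ℝ} (h1 : volume B1 ≤ ENNReal.ofReal ((β - α) / 4))
    (h2 : volume B2 ≤ ENNReal.ofReal ((β - α) / 16)) (h3 : volume B3 ≤ ENNReal.ofReal ((β - α) / 16))
    (h4 : volume B4 ≤ ENNReal.ofReal ((β - α) / 16)) :
    ∃ x ∈ Icc (α + (β - α) / 4) (β - (β - α) / 4), x ∉ B1 ∧ x ∉ B2 ∧ x ∉ B3 ∧ x ∉ B4 := by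
  by_contra hc
  push Not at hc
  have hsub : Icc (α + (β - α) / 4) (β - (β - α) / 4) ⊆ ((B1 ∪ B2) ∪ B3) ∪ B4 := by
    intro x hx
    have := hc x hx
    simp only [mem_union]
    tauto
  have hp : 0 ≤ (β - α) / 16 := by linarith
  have hp4 : 0 ≤ (β - α) / 4 := by linarith
  have := (measure_mono hsub).trans ((measure_union_le _ _).trans (add_le_add ((measure_union_le _ _).trans
    (add_le_add ((measure_union_le _ _).trans (add_le_add h1 h2)) h3)) h4))
  rw [Real.volume_Icc, ← ENNReal.ofReal_add hp4 hp, ← ENNReal.ofReal_add (by linarith) hp,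
    ← ENNReal.ofReal_add (by linarith) hp, ENNReal.ofReal_le_ofReal_iff (by linarith)] at this
  linarith

lemma union_tail' {S : ℕ → Set ℝ} {C δ : ℝ} {N : ℕ} {r t : ℝ≥0∞}
    (h : ∀ a, N ≤ a → volume (S a) ≤ r * ENNReal.ofReal (C * E (-(δ * a))))
    (ht : ∑' k : ℕ, ENNReal.ofReal (C * E (-(δ * (N + k : ℕ)))) ≤ t) :
    volume (⋃ a ∈ {a | N ≤ a}, S a) ≤ r * t := by
  have : (⋃ a ∈ {a | N ≤ a}, S a) = ⋃ k : ℕ, S (N + k) := by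
    ext x
    simp only [mem_iUnion, exists_prop]
    constructor
    · rintro ⟨a, ha, hx⟩
      obtain ⟨k, rfl⟩ := Nat.exists_eq_add_of_le ha
      exact ⟨k, hx⟩
    · rintro ⟨k, hx⟩
      exact ⟨N + k, Nat.le_add_right _ _, hx⟩
  rw [this]
  refine (measure_iUnion_le _).trans ((ENNReal.tsum_le_tsum fun k => h _ (Nat.le_add_right _ _)).trans ?_)
  rw [ENNReal.tsum_mul_left]
  gcongr

noncomputable def bbf (lam g ε A a : ℝ) : ℝ :=
  if (1 + lam) * a ≤ 2 * bb1 lam g ε A then bb1 lam g ε A else bb2 lam A a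

lemma stepC {n : ℕ} {lam g σ ε e : ℝ} (h : Par n lam g σ ε e) (e2 : ℝ) (he2 : 32 * ε ≤ e2) (θ : Fin n → ℝ) :
    ∃ C δ : ℝ, 0 ≤ C ∧ 0 < δ ∧ ∃ a0 : ℕ, ∀ A a : ℕ, a0 ≤ a → 2 ≤ ε * A → 100 ≤ e2 * A → (1 - ε) * A - 1 ≤ a →
    ∀ x0 α β : ℝ, x0 ∈ Icc (0:ℝ) 1 →
    GoodM (Hm n (wE n lam a (bbf lam g ε A a)) x0) (E (((2 - (n-1) * lam) * a - bbf lam g ε A a) / (n+1) - e * a)) →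
    0 ≤ α → β ≤ 1 → x0 - 2 * E (-(bb0 n lam g e A)) ≤ α → 
    β ≤ x0 + 2 * E (-(bb0 n lam g e A)) → 4 * n * (β - α) = E (-((1 + lam) * A)) →
    volume (Icc α β ∩ Wc n θ (lam + e2) a) ≤ ENNReal.ofReal (β - α) *
      ENNReal.ofReal (C * E (-(δ * a))) := by
  have hε := h.hε
  obtain ⟨C, δ, hC, hδ, a0, H⟩ := stepC2 h e2 (by linarith) θ
  have hcnt : 0 ≤ cnt n 1 := by unfold cnt; positivity
  refine ⟨C + 8 * n * cnt n 1, min δ (e2 / 2), by positivity, lt_min hδ (by linarith), a0, ?_⟩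
  intro A a ha hA1 hA2 haA x0 α β hx0 hg hα hβ h2 h3 hJ
  have hap : (0:ℝ) ≤ a := Nat.cast_nonneg a
  have hAp : (0:ℝ) ≤ A := Nat.cast_nonneg A
  have hd1 : E (-(δ * a)) ≤ E (-(min δ (e2 / 2) * a)) :=
    E_le.2 (neg_le_neg (mul_le_mul_of_nonneg_right (min_le_left _ _) hap))
  have hd2 : E (-(e2 / 2 * a)) ≤ E (-(min δ (e2 / 2) * a)) :=
    E_le.2 (neg_le_neg (mul_le_mul_of_nonneg_right (min_le_right _ _) hap))
  have hXp := E_pos (-(min δ (e2 / 2) * a))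
  by_cases hc : (1 + lam) * a ≤ 2 * bb1 lam g ε A
  · have hb : bbf lam g ε A a = bb1 lam g ε A := if_pos hc
    rw [hb] at hg
    obtain ⟨-, -, h0⟩ := case1_arith h A a hAp hA1 haA hc
    have hg1 : GoodM (Hm n (wE n lam a (bb1 lam g ε A)) x0) 1 := hg.mono (E_zero.symm.le.trans (E_le.2 h0))
    refine (stepC1 h e2 he2 θ A a x0 α β hA1 hA2 haA hc hx0 hg1 hα hβ h2 h3 hJ).trans ?_
    refine mul_le_mul' le_rfl (ENNReal.ofReal_le_ofReal ?_)
    have i1 := mul_le_mul_of_nonneg_left hd2 (show 0 ≤ 8 * n * cnt n 1 by positivity)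
    have i2 := mul_nonneg hC hXp.le
    linarith
  · have hb : bbf lam g ε A a = bb2 lam A a := if_neg hc
    rw [hb] at hg
    refine (H A a ha (by linarith) x0 α β hg hα hβ h2 h3 hJ).trans ?_
    refine mul_le_mul' le_rfl (ENNReal.ofReal_le_ofReal ?_)
    have i1 := mul_le_mul_of_nonneg_left hd1 hC
    have i2 := mul_nonneg (show 0 ≤ 8 * n * cnt n 1 by positivity) hXp.le
    linarith

lemma bbf_bd {n : ℕ} {lam g σ ε e : ℝ} (h : Par n lam g σ ε e) (A a : ℕ) (hA1 : 2 ≤ ε * A)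
    (ha : (1 - ε) * A - 1 ≤ a) : 0 ≤ bbf lam g ε A a ∧ bbf lam g ε A a ≤ 2 * a := by
  have hap : (0:ℝ) ≤ a := Nat.cast_nonneg a
  have hAp : (0:ℝ) ≤ A := Nat.cast_nonneg A
  have hlam := h.hlam
  have hla : (1 + lam) * a ≤ 2 * a := mul_le_mul_of_nonneg_right (by linarith [h.hlam1]) hap
  unfold bbf
  split_ifs with hc
  · obtain ⟨h1, h2, -⟩ := case1_arith h A a hAp hA1 ha hc
    exact ⟨h1, by linarith⟩
  · obtain ⟨h1, -⟩ := case2_arith h A a hAp (by linarith)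
    unfold bb2
    refine ⟨le_max_of_le_left (by positivity), max_le ?_ ?_⟩
    · exact (mul_le_mul_of_nonneg_left h1 (by linarith)).trans hla
    · have : 0 ≤ (1 + lam) * a := by positivity
      linarith

set_option maxHeartbeats 2000000 in
theorem step {n : ℕ} {lam g σ ε e : ℝ} (h : Par n lam g σ ε e) (e1 e2 : ℝ) (he1 : 0 < e1) (he2 : 32 * ε ≤ e2)
    (θ : Fin n → ℝ) (α β : ℝ) (hαβ : α < β) (hα : 1/4 ≤ α) (hβ : β ≤ 3/4) (u : ℕ) (hu : 1 ≤ u)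
    (hvol : volume (Icc α β ∩ ⋃ a ∈ {a | u ≤ a}, Wc n θ (lam + e1) a) ≤ ENNReal.ofReal ((β - α) / 4)) :
    ∃ (α' β' : ℝ) (v : ℕ), α ≤ α' ∧ α' < β' ∧ β' ≤ β ∧ u < v ∧
      (∀ a, u ≤ a → a < v → ∀ y ∈ Icc α' β', y ∉ Wc n θ (lam + 2 * e1) a) ∧
      volume (Icc α' β' ∩ ⋃ a ∈ {a | v ≤ a}, Wc n θ (lam + e2) a) ≤ ENNReal.ofReal ((β' - α') / 4) ∧
      ∃ (p : Fin n → ℤ) (q : ℕ), 2 ^ v ≤ q ∧ ∀ y ∈ Icc α' β', Cl n θ lam y p q := by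
  have hn := h.hn
  have hn' : (3:ℝ) ≤ n := by exact_mod_cast h.hn
  have hlam := h.hlam
  have hlam1 := h.hlam1
  have hg0 := h.hg0
  have hg20 := h.g20
  have hε := h.hε
  have hε2 := h.hε2
  have he1' := h.he1
  have hep := h.he
  have hα0 : 0 ≤ α := by linarith
  have hβ1 : β ≤ 1 := by linarith
  have hba : 0 < β - α := by linarith
  obtain ⟨C4, δ4, hC4, hδ4, a4, H4⟩ := W_iv h e1 he1 θ α β hαβ hα0 hβ1
  obtain ⟨a1, ha1t, ha1⟩ := ((tail_sum C4 δ4 ((β - α) / 16) hC4 hδ4 (by linarith)).and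
    (eventually_ge_atTop a4)).exists
  obtain ⟨C5, δ5, hC5, hδ5, a5, H5⟩ := km1E (by omega : 2 ≤ n) lam hlam α β hαβ hα0 hβ1 e hep
  obtain ⟨C6, δ6, hC6, hδ6, a6, H6⟩ := stepC h e2 he2 θ
  set s := 1 + lam - g - 2 * (n+1) * e with hs
  have hs2 : (0.9:ℝ) ≤ s := by rw [hs]; linarith
  have hbb : ∀ A : ℝ, bb0 n lam g e A = s * A := fun _ => rfl
  have hEe1 : 0 < 1 - E (-e1) := by
    have : E (-e1) < E 0 := E_lt.2 (by linarith)
    rw [E_zero] at this; linarith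
  set c0 := E (-((1 + lam + e1) * a1)) * (1 - E (-e1)) with hc0
  have hc0p : 0 < c0 := mul_pos (E_pos _) hEe1
  have hV : Tendsto (fun A : ℕ => ⌊(1 - ε) * (A:ℝ)⌋₊) atTop atTop :=
    tendsto_nat_floor_atTop.comp ((tendsto_natCast_atTop_atTop (R := ℝ)).const_mul_atTop (by linarith))
  have ev1 := hV.eventually (tail_sum C5 δ5 ((β - α) / 16) hC5 hδ5 (by linarith))
  have ev2 := hV.eventually (tail_sum C6 δ6 (1/4) hC6 hδ6 (by norm_num))
  have ev3 := hV.eventually (eventually_ge_atTop (max (max a5 a6) (u+1)))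
  have ev4 := (E_ev δ5 C5 ((β - α) / 16) hδ5 (by linarith)).natCast_atTop
  have ev5 := (E_ev s 2 ((β - α) / 4) (by linarith) (by linarith)).natCast_atTop
  have ev6 := (E_ev s (n * 2) c0 (by linarith) hc0p).natCast_atTop
  have ev7 := (E_ev e (2 ^ (n+1)) (1 / (16 * n)) hep (by positivity)).natCast_atTop
  have ev8 : ∀ᶠ A : ℕ in atTop, 2 / ε ≤ A := (eventually_ge_atTop (2 / ε)).natCast_atTop
  have ev9 : ∀ᶠ A : ℕ in atTop, 100 / e2 ≤ A := (eventually_ge_atTop (100 / e2)).natCast_atTop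
  obtain ⟨A, E1, E2, E3, E4, E5, E6, E7, E8, E9⟩ := (ev1.and (ev2.and (ev3.and (ev4.and (ev5.and (ev6.and
    (ev7.and (ev8.and ev9)))))))).exists
  have hAp : (0:ℝ) ≤ A := Nat.cast_nonneg A
  rw [div_le_iff₀ hε, mul_comm] at E8
  rw [div_le_iff₀ (by linarith), mul_comm] at E9
  set V := ⌊(1 - ε) * (A:ℝ)⌋₊ with hVd
  have hVle : (V:ℝ) ≤ (1 - ε) * A := Nat.floor_le (mul_nonneg (by linarith) hAp)
  have hVge : (1 - ε) * A - 1 ≤ V := by have := Nat.lt_floor_add_one ((1 - ε) * (A:ℝ)); linarith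
  have hVA : V ≤ A := by
    have : (V:ℝ) ≤ A := by linarith [mul_nonneg hε.le hAp]
    exact_mod_cast this
  have hVa5 : a5 ≤ V := (le_max_left _ _).trans ((le_max_left _ _).trans E3)
  have hVa6 : a6 ≤ V := (le_max_right _ _).trans ((le_max_left _ _).trans E3)
  have hVu : u < V := (le_max_right _ _).trans E3
  set d := E (-(bb0 n lam g e A)) with hd
  have hdp : 0 < d := E_pos _
  have hd1 : 2 * d < (β - α) / 4 := E5
  have hd2 : n * 2 * d < c0 := E6
  have hb0le : bb0 n lam g e A ≤ (1 + lam) * A := by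
    rw [hbb]; refine mul_le_mul_of_nonneg_right ?_ hAp
    have : 0 ≤ 2 * (n+1) * e := by positivity
    linarith
  have hb0ge : (1 + lam) * A ≤ 2 * bb0 n lam g e A := by
    rw [hbb, ← mul_assoc]; refine mul_le_mul_of_nonneg_right ?_ hAp
    rw [hs]; linarith
  have B2 : volume {x | x ∈ Icc α β ∧ ¬ GoodM (Hm n (wE n lam A (bb0 n lam g e A)) x)
        (E (((2 - (n-1) * lam) * A - bb0 n lam g e A) / (n+1) - e * A))} ≤ ENNReal.ofReal ((β - α) / 16) := by
    refine (H5 A (hVa5.trans hVA) _ (by linarith [mul_nonneg (by linarith : 0 ≤ 1 + lam) hAp]) ?_).trans (ENNReal.ofReal_le_ofReal E4.le)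
    linarith [mul_le_mul_of_nonneg_right hlam1 hAp]
  have B3 := union_tail (S := fun a : ℕ => {x | x ∈ Icc α β ∧ ¬ GoodM (Hm n (wE n lam a (bbf lam g ε A a)) x)
        (E (((2 - (n-1) * lam) * a - bbf lam g ε A a) / (n+1) - e * a))}) (C := C5) (δ := δ5) (N := V) (by
      intro a ha
      have ha' : (V:ℝ) ≤ a := by exact_mod_cast ha
      obtain ⟨i1, i2⟩ := bbf_bd h A a E8 (by linarith)
      exact H5 a (hVa5.trans ha) _ i1 i2) E1
  have B4 := union_tail (S := fun a : ℕ => if a < V then {u | u ∈ Icc α β ∧ ∃ y ∈ Icc (0:ℝ) 1, |u - y| ≤ 2 * d ∧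
        y ∈ Wc n θ (lam + e1) a} else ∅) (C := C4) (δ := δ4) (N := a1) (by
      intro a ha
      split_ifs with hc
      · have ha' : (a:ℝ) ≤ V := by exact_mod_cast hc.le
        exact H4 A a (ha1.trans ha) (by linarith)
      · simp) ha1t
  obtain ⟨x0, hx0, n1, n2, n3, n4⟩ := pick_pt hαβ hvol B2 B3 B4
  have hx0I : x0 ∈ Icc α β := ⟨by linarith [hx0.1], by linarith [hx0.2]⟩
  have hx01 : x0 ∈ Icc (0:ℝ) 1 := ⟨by linarith [hx0I.1], by linarith [hx0I.2]⟩
  have hgA : GoodM (Hm n (wE n lam A (bb0 n lam g e A)) x0) (E (e * A)) := by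
    by_contra hc
    refine n2 ⟨hx0I, ?_⟩
    have : ((2 - (n-1) * lam) * A - bb0 n lam g e A) / (n+1) - e * A = e * A := by
      rw [h.v, hbb, hs]; field_simp; ring
    rw [this]; exact hc
  have hgood : ∀ a : ℕ, V ≤ a → GoodM (Hm n (wE n lam a (bbf lam g ε A a)) x0)
        (E (((2 - (n-1) * lam) * a - bbf lam g ε A a) / (n+1) - e * a)) := by
    intro a ha
    by_contra hc
    refine n3 ?_
    simp only [mem_iUnion, exists_prop]
    exact ⟨a, ha, hx0I, hc⟩
  obtain ⟨xk, p, q, hq, hxk, hcl⟩ := stepB_core (by omega : 2 ≤ n) lam (bb0 n lam g e A) (E (e * A)) A θ x0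
    ⟨by linarith [hx0I.1], by linarith [hx0I.2]⟩ hlam hlam1 (E_pos _) (by
      rw [div_eq_mul_inv, ← E_neg]; exact E7.le) hgA hb0le hb0ge (by linarith)
  set r := E (-((1 + lam) * A)) / (8 * n) with hr
  have hrp : 0 < r := div_pos (E_pos _) (by linarith)
  have hrd : r ≤ d := (div_le_self (E_pos _).le (by linarith)).trans (E_le.2 (by linarith))
  have hxk' := abs_le.1 hxk
  have hJl : x0 - 2 * d ≤ xk - r := by linarith
  have hJr : xk + r ≤ x0 + 2 * d := by linarith
  have hJα : α ≤ xk - r := by linarith [hx0.1]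
  have hJβ : xk + r ≤ β := by linarith [hx0.2]
  have hJ0 : 0 ≤ xk - r := by linarith
  have hJ1 : xk + r ≤ 1 := by linarith
  have hJ : 4 * n * (xk + r - (xk - r)) = E (-((1 + lam) * A)) := by rw [hr]; field_simp; ring
  refine ⟨xk - r, xk + r, V, hJα, by linarith, hJβ, hVu, ?_, ?_, p, q, ?_, ?_⟩
  · intro a hua haV y hy hw
    have hy01 : y ∈ Icc (0:ℝ) 1 := ⟨hJ0.trans hy.1, hy.2.trans hJ1⟩
    have hxy : |x0 - y| ≤ 2 * d := by
      rw [abs_le]; constructor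
      · linarith [hy.2]
      · linarith [hy.1]
    rcases lt_or_ge a a1 with hc | hc
    · have hx := Wc_near lam e1 hlam he1 a a1 (hu.trans hua) hc x0 y (2 * d) hx01 hy01 hxy (by linarith) hw
      refine n1 ⟨hx0I, ?_⟩
      simp only [mem_iUnion, exists_prop]
      exact ⟨a, hua, hx⟩
    · refine n4 ?_
      simp only [mem_iUnion, exists_prop]
      refine ⟨a, hc, ?_⟩
      rw [if_pos haV]
      exact ⟨hx0I, y, hy01, hxy, Wc_mono (by linarith) hw⟩
  · have hU := union_tail' (S := fun a : ℕ => Icc (xk - r) (xk + r) ∩ Wc n θ (lam + e2) a) (C := C6) (δ := δ6) (N := V)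
      (r := ENNReal.ofReal (xk + r - (xk - r))) (by
        intro a ha
        have ha' : (V:ℝ) ≤ a := by exact_mod_cast ha
        exact H6 A a (hVa6.trans ha) E8 E9 (by linarith) x0 _ _ hx01 (hgood a ha) hJ0 hJ1 hJl hJr hJ) E2
    rw [← ENNReal.ofReal_mul (by linarith), mul_one_div] at hU
    refine le_trans (measure_mono ?_) hU
    rintro y ⟨hy, hw⟩
    simp only [mem_iUnion, exists_prop] at hw ⊢
    obtain ⟨a, ha, hya⟩ := hw
    exact ⟨a, ha, hy, hya⟩
  · exact (Nat.pow_le_pow_right (by norm_num) hVA).trans hq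
  · intro y hy
    refine hcl y ?_
    rw [abs_le]; constructor
    · linarith [hy.1]
    · linarith [hy.2]

lemma seq_exists {X : Type*} (P : ℕ → X → Prop) (R : ℕ → X → X → Prop) (x0 : X) (h0 : P 0 x0)
    (h : ∀ k x, P k x → ∃ y, P (k+1) y ∧ R k x y) : ∃ f : ℕ → X, ∀ k, P k (f k) ∧ R k (f k) (f (k+1)) := by
  choose G hG1 hG2 using h
  let F : ∀ k, {x // P k x} := fun k => Nat.rec (motive := fun k => {x // P k x}) ⟨x0, h0⟩
    (fun k s => ⟨G k s.1 s.2, hG1 k s.1 s.2⟩) k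
  exact ⟨fun k => (F k).1, fun k => ⟨(F k).2, hG2 k (F k).1 (F k).2⟩⟩

lemma par_exists {n : ℕ} (hn : 3 ≤ n) (lam : ℝ) (h1 : 1 / (n:ℝ) ≤ lam)
    (h2 : lam ≤ 1 / (n : ℝ) + ((n : ℝ) + 1) / ((n : ℝ) * (2 * (n : ℝ) - 1) * ((n : ℝ) ^ 2 + (n : ℝ) + 1))) :
    ∃ g σ : ℝ, ∀ e2 : ℝ, 0 < e2 → ∃ ε e : ℝ, Par n lam g σ ε e ∧ 32 * ε ≤ e2 := by
  have hn' : (3:ℝ) ≤ n := by exact_mod_cast hn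
  have hnp : (0:ℝ) < n := by linarith
  have hg0 : 0 ≤ n * lam - 1 := by
    rw [div_le_iff₀ hnp] at h1; linarith
  have hlam : 0 ≤ lam := le_trans (by positivity) h1
  have hden : (0:ℝ) < (2 * n - 1) * (n ^ 2 + n + 1) := mul_pos (by linarith) (by positivity)
  have hgle : (n * lam - 1) * ((2 * n - 1) * (n ^ 2 + n + 1)) ≤ n + 1 := by
    have h3 : n * lam ≤ n * (1 / (n : ℝ) + ((n : ℝ) + 1) / ((n : ℝ) * (2 * (n : ℝ) - 1) * ((n : ℝ) ^ 2 + (n : ℝ) + 1))) :=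
      mul_le_mul_of_nonneg_left h2 hnp.le
    have e1 : n * (1 / (n : ℝ) + ((n : ℝ) + 1) / ((n : ℝ) * (2 * (n : ℝ) - 1) * ((n : ℝ) ^ 2 + (n : ℝ) + 1))) =
       1 + (n+1) / ((2 * n - 1) * (n ^ 2 + n + 1)) := by
      have : (2 * (n:ℝ) - 1) ≠ 0 := by linarith
      field_simp
    rw [e1] at h3
    rw [← le_div_iff₀ hden]; linarith
  set g := n * lam - 1 with hg
  have hkey : g * (n * (2 * n ^ 2 + 2)) < n + 1 := by
    rcases hg0.eq_or_lt with hz | hz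
    · rw [← hz, zero_mul]; linarith
    · refine lt_of_lt_of_le (mul_lt_mul_of_pos_left ?_ hz) hgle
      nlinarith
  have hlam1 : lam ≤ 1 := by
    have : n * lam ≤ 2 := by
      have : g * 60 ≤ g * (n * (2 * n ^ 2 + 2)) := mul_le_mul_of_nonneg_left (by nlinarith [mul_nonneg hnp.le hnp.le]) hg0
      nlinarith
    nlinarith
  have hσ : 0 < 1 + lam - (2 * n ^ 2 + 2) * g := by
    have h5 : (n:ℝ) * (1 + lam - (2 * n ^ 2 + 2) * g) = n + 1 + g - g * (n * (2 * n ^ 2 + 2)) := by rw [hg]; ring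
    have : 0 < (n:ℝ) * (1 + lam - (2 * n ^ 2 + 2) * g) := by rw [h5]; linarith
    exact pos_of_mul_pos_right this hnp.le
  set σ := 1 + lam - (2 * n ^ 2 + 2) * g with hσd
  refine ⟨g, σ, fun e2 he2 => ?_⟩
  set ε := min (min (σ / 16) (1 / 100)) (e2 / 32) with hε
  have hεp : 0 < ε := lt_min (lt_min (by linarith) (by norm_num)) (by linarith)
  set e := min (ε / (8 * (n+1))) (σ / (32 * (n + 1) * (4 * n * (n + 1) + 1))) with he
  have hep : 0 < e := lt_min (by positivity) (by positivity)
  have i1 : e ≤ ε / (8 * (n+1)) := min_le_left _ _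
  have i2 : e ≤ σ / (32 * (n + 1) * (4 * n * (n + 1) + 1)) := min_le_right _ _
  rw [le_div_iff₀ (by positivity), mul_comm] at i1 i2
  have i3 : ε ≤ e2 / 32 := min_le_right _ _
  exact ⟨ε, e, ⟨hn, hg, hg0, hlam, hlam1, hσ, hσd, hεp, (min_le_left _ _).trans (min_le_left _ _),
    (min_le_left _ _).trans (min_le_right _ _), hep, i1, i2⟩, by linarith⟩

lemma fin_small {n : ℕ} (θ : Fin n → ℝ) (τ x : ℝ) (hτ : 0 ≤ τ) (hx : x ∈ Icc (0:ℝ) 1) (Q : ℕ) :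
    {pq : (Fin n → ℤ) × ℕ | 0 < pq.2 ∧ Cl n θ τ x pq.1 pq.2 ∧ pq.2 < Q}.Finite := by
  obtain ⟨B, hB⟩ := exists_nat_ge ((Q:ℝ) + ‖θ‖ + 1)
  have hf : ({p : Fin n → ℤ | ∀ i, p i ∈ Icc (-(B:ℤ)) B} ×ˢ Iio Q).Finite := by
    refine Set.Finite.prod ?_ (Set.finite_Iio Q)
    exact Set.Finite.pi' fun i => Set.finite_Icc _ _
  refine hf.subset ?_
  rintro ⟨p, q⟩ ⟨hq, hc, hqQ⟩
  refine ⟨fun i => ?_, hqQ⟩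
  simp only at hq hc hqQ
  have h1 := Cl_mul hq hc i
  have h2 : (q:ℝ) ^ (-τ) ≤ 1 := Real.rpow_le_one_of_one_le_of_nonpos (by exact_mod_cast hq) (by linarith)
  have h3 : |θ i| ≤ ‖θ‖ := by rw [← Real.norm_eq_abs]; exact norm_le_pi_norm θ i
  have h4 : x ^ (i.val+1) ≤ 1 := pow_le_one₀ hx.1 hx.2
  have h5 : 0 ≤ x ^ (i.val+1) := pow_nonneg hx.1 _
  have hqQ' : (q:ℝ) ≤ Q := by exact_mod_cast hqQ.le
  have h6 : (q:ℝ) * x ^ (i.val+1) ≤ Q := by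
    calc (q:ℝ) * x ^ (i.val+1) ≤ Q * 1 := mul_le_mul hqQ' h4 h5 (Nat.cast_nonneg _)
      _ = Q := mul_one _
  have h7 : 0 ≤ (q:ℝ) * x ^ (i.val+1) := by positivity
  have h8 := abs_le.1 (h1.trans h2)
  have h9 := abs_le.1 h3
  have hQ0 : (0:ℝ) ≤ Q := Nat.cast_nonneg _
  constructor
  · have : ((-(B:ℤ) : ℤ) : ℝ) ≤ p i := by push_cast; linarith
    exact_mod_cast this
  · have : (p i : ℝ) ≤ ((B:ℤ) : ℝ) := by push_cast; linarith
    exact_mod_cast this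

theorem core {n : ℕ} (hn : 3 ≤ n) (θ : Fin n → ℝ) (lam : ℝ) (h1 : 1 / (n:ℝ) ≤ lam)
    (h2 : lam ≤ 1 / (n : ℝ) + ((n : ℝ) + 1) / ((n : ℝ) * (2 * (n : ℝ) - 1) * ((n : ℝ) ^ 2 + (n : ℝ) + 1))) :
    ∃ x : ℝ, {pq : (Fin n → ℤ) × ℕ | 0 < pq.2 ∧ Cl n θ lam x pq.1 pq.2}.Infinite ∧
      ∀ τ, lam < τ → {pq : (Fin n → ℤ) × ℕ | 0 < pq.2 ∧ Cl n θ τ x pq.1 pq.2}.Finite := by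
  obtain ⟨g, σ, hpar⟩ := par_exists hn lam h1 h2
  have hlam : 0 ≤ lam := le_trans (by positivity) h1
  obtain ⟨ε, e, hP, -⟩ := hpar 1 one_pos
  obtain ⟨u0, hu0, hv0⟩ := W_base hP 1 one_pos θ (1/4) (3/4) (by norm_num) (by norm_num) (by norm_num)
  obtain ⟨f, hf⟩ := seq_exists (X := ℝ × ℝ × ℕ)
    (fun k s => s.1 < s.2.1 ∧ 1/4 ≤ s.1 ∧ s.2.1 ≤ 3/4 ∧ 1 ≤ s.2.2 ∧
      volume (Icc s.1 s.2.1 ∩ ⋃ a ∈ {a | s.2.2 ≤ a}, Wc n θ (lam + 1 / ((k:ℝ) + 1)) a) ≤ ENNReal.ofReal ((s.2.1 - s.1) / 4))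
    (fun k s t => Icc t.1 t.2.1 ⊆ Icc s.1 s.2.1 ∧ s.2.2 < t.2.2 ∧
      (∀ a, s.2.2 ≤ a → a < t.2.2 → ∀ y ∈ Icc t.1 t.2.1, y ∉ Wc n θ (lam + 2 * (1 / ((k:ℝ) + 1))) a) ∧
      ∃ (p : Fin n → ℤ) (q : ℕ), 2 ^ t.2.2 ≤ q ∧ ∀ y ∈ Icc t.1 t.2.1, Cl n θ lam y p q)
    (1/4, 3/4, u0) (by
      refine ⟨by norm_num, by norm_num, by norm_num, hu0, ?_⟩
      simpa using hv0) (by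
      rintro k ⟨α, β, u⟩ ⟨i1, i2, i3, i4, i5⟩
      obtain ⟨ε, e, hP, he⟩ := hpar (1 / (((k+1 : ℕ) : ℝ) + 1)) (by positivity)
      obtain ⟨α', β', v, j1, j2, j3, j4, j5, j6, j7⟩ := step hP (1 / ((k:ℝ) + 1)) _ (by positivity) he θ α β i1 i2 i3 u i4 i5
      exact ⟨(α', β', v), ⟨j2, i2.trans j1, j3.trans i3, Nat.one_le_of_lt j4, j6⟩, Icc_subset_Icc j1 j3, j4, j5, j7⟩)
  have hne : (⋂ k, Icc (f k).1 (f k).2.1).Nonempty :=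
    IsCompact.nonempty_iInter_of_sequence_nonempty_isCompact_isClosed (fun k => Icc (f k).1 (f k).2.1)
      (fun k => (hf k).2.1) (fun k => nonempty_Icc.2 (hf k).1.1.le) isCompact_Icc (fun k => isClosed_Icc)
  obtain ⟨x, hx⟩ := hne
  rw [mem_iInter] at hx
  have hmono : StrictMono (fun k => (f k).2.2) := strictMono_nat_of_lt_succ fun k => (hf k).2.2.1
  have hx01 : x ∈ Icc (0:ℝ) 1 := ⟨by linarith [(hx 0).1, (hf 0).1.2.1], by linarith [(hx 0).2, (hf 0).1.2.2.1]⟩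
  refine ⟨x, ?_, ?_⟩
  · intro hfin
    obtain ⟨N, hN⟩ := (hfin.image Prod.snd).bddAbove
    obtain ⟨p, q, hq, hc⟩ := (hf N).2.2.2.2
    have hq0 : 0 < q := lt_of_lt_of_le (by positivity) hq
    have h3 : q ≤ N := hN ⟨(p, q), ⟨hq0, hc x (hx (N+1))⟩, rfl⟩
    have h4 : N + 1 ≤ (f (N+1)).2.2 := hmono.le_apply
    have h5 : (f (N+1)).2.2 < 2 ^ (f (N+1)).2.2 := Nat.lt_two_pow_self
    omega
  · intro τ hτ
    obtain ⟨K, hK⟩ := exists_nat_gt (2 / (τ - lam))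
    have hτ' : 0 < τ - lam := by linarith
    rw [div_lt_iff₀ hτ'] at hK
    refine (fin_small θ τ x (by linarith) hx01 (2 ^ (f K).2.2)).subset ?_
    rintro ⟨p, q⟩ ⟨hq, hc⟩
    refine ⟨hq, hc, ?_⟩
    simp only at hq hc ⊢
    by_contra hge
    push Not at hge
    set a := Nat.log 2 q with ha
    have ha1 : 2 ^ a ≤ q := Nat.pow_log_le_self 2 hq.ne'
    have ha2 : q < 2 ^ (a+1) := Nat.lt_pow_succ_log_self (by norm_num) q
    have haK : (f K).2.2 ≤ a := Nat.le_log_of_pow_le (by norm_num) hge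
    have hex : ∃ k, a < (f k).2.2 := ⟨a + 1, lt_of_lt_of_le (Nat.lt_succ_self a) hmono.le_apply⟩
    classical
    set k := Nat.find hex with hk
    have hk1 : a < (f k).2.2 := Nat.find_spec hex
    have hKk : K < k := by
      by_contra hle
      push Not at hle
      have : (f k).2.2 ≤ (f K).2.2 := hmono.monotone hle
      omega
    obtain ⟨j, hj⟩ : ∃ j, k = j + 1 := ⟨k - 1, by omega⟩
    have hk2 : (f j).2.2 ≤ a := not_lt.1 (Nat.find_min hex (by omega : j < k))
    rw [hj] at hk1
    refine (hf j).2.2.2.1 a hk2 hk1 x (hx (j+1)) (Wc_mono ?_ ⟨p, q, ha1, ha2, hc⟩)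
    have hKj : (K:ℝ) ≤ j := by exact_mod_cast (by omega : K ≤ j)
    have : 2 * (1 / ((j:ℝ) + 1)) ≤ τ - lam := by
      rw [mul_one_div, div_le_iff₀ (by positivity)]
      nlinarith
    linarith

/-- **Interval in the inhomogeneous spectrum** (Corollary 2.7). -/
theorem interval_subset_spectrum
    (n : ℕ) (hn : 3 ≤ n) (θ : Fin n → ℝ) :
    ∀ lam ∈ Set.Icc (ENNReal.ofReal (1 / (n : ℝ)))
        (ENNReal.ofReal (1 / (n : ℝ) +
          ((n : ℝ) + 1) / ((n : ℝ) * (2 * (n : ℝ) - 1) * ((n : ℝ) ^ 2 + (n : ℝ) + 1)))),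
      ∃ x : ℝ, lambdaN n θ x = lam := by
  intro lam hl
  have hlt : lam ≠ ∞ := ne_top_of_le_ne_top ENNReal.ofReal_ne_top hl.2
  obtain ⟨r, hr0, rfl⟩ : ∃ r : ℝ, 0 ≤ r ∧ ENNReal.ofReal r = lam :=
    ⟨lam.toReal, ENNReal.toReal_nonneg, ENNReal.ofReal_toReal hlt⟩
  have hn' : (3:ℝ) ≤ n := by exact_mod_cast hn
  have hnp : (0:ℝ) < n := by linarith
  have hpos : 0 ≤ ((n : ℝ) + 1) / ((n : ℝ) * (2 * (n : ℝ) - 1) * ((n : ℝ) ^ 2 + (n : ℝ) + 1)) :=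
    div_nonneg (by linarith) (mul_nonneg (mul_nonneg hnp.le (by linarith)) (by positivity))
  have hpos1 : 0 ≤ 1 / (n:ℝ) := by positivity
  have h1 := (ENNReal.ofReal_le_ofReal_iff hr0).1 hl.1
  have h2 := (ENNReal.ofReal_le_ofReal_iff (by linarith)).1 hl.2
  obtain ⟨x, hx1, hx2⟩ := core hn θ r h1 h2
  have key : ∀ τ : ℝ, ((fun i : Fin n => x ^ ((i : ℕ) + 1)) ∈ SApprox n θ (fun q => q ^ (-τ))) ↔
      {pq : (Fin n → ℤ) × ℕ | 0 < pq.2 ∧ Cl n θ τ x pq.1 pq.2}.Infinite := by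
    intro τ
    have : {pq : (Fin n → ℤ) × ℕ | 0 < pq.2 ∧ Cl n θ τ x pq.1 pq.2} =
        {pq : (Fin n → ℤ) × ℕ | 0 < pq.2 ∧
          ‖fun i : Fin n => x ^ ((i : ℕ) + 1) - (pq.1 i + θ i) / pq.2‖ ≤ (pq.2 : ℝ) ^ (-τ) / pq.2} := by
      ext pq
      refine and_congr_right fun hq => ?_
      rw [pi_norm_le_iff_of_nonneg (by positivity)]
      exact Iff.rfl
    rw [this]
    exact Iff.rfl
  refine ⟨x, le_antisymm (sSup_le ?_) (le_sSup ⟨r, rfl, (key r).2 hx1⟩)⟩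
  rintro _ ⟨τ, rfl, hτ⟩
  refine ENNReal.ofReal_le_ofReal ?_
  by_contra hc
  push Not at hc
  exact (key τ).1 hτ (hx2 τ hc)
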